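/- Let A^{αβ} ∈ ℝ^{n×n}, for |α| = |β| = m, be constant matrices with entries bounded by K satisfying the Legendre–Hadamard condition with constant λ > 0, and let 0 < R ≤ 1. Let X₀ = (t₀,x₀) with (x₀)_d = 0, and let u ∈ C^∞(ℝ^{d+1}; ℝⁿ) satisfy ∂_t u + (−1)^m Σ_{|α|=|β|=m} A^{αβ} D^{α+β} u = 0 in Q_{2R}⁺(X₀), with u = D_d u = ⋯ = D_d^{m−1} u = 0 on {x_d = 0} ∩ Q_{2R}(X₀). Then there exists a constant C depending only on d, n, m, λ, K such that for all 0 < r < R: ∫_{Q_r⁺(X₀)} |∂_t u|² dx dt ≤ C (r/R)^{d+4m} ∫_{Q_R⁺(X₀)} |∂_t u|² dx dt. -/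

import Mathlib

open MeasureTheory Metric Set Topology

noncomputable section

/-- The parabolic cylinder `Q_r(t₀,x₀) = (t₀ - r^{2m}, t₀) × B_r(x₀)`. -/
def QCyl (d m : ℕ) (r : ℝ) (X : ℝ × EuclideanSpace ℝ (Fin d)) :
    Set (ℝ × EuclideanSpace ℝ (Fin d)) :=
  Set.Ioo (X.1 - r ^ (2 * m)) X.1 ×ˢ Metric.ball X.2 r

/-- The upper-half parabolic cylinder, `i` being the index of the normal direction. -/
def QCylP (d m : ℕ) (i : Fin d) (r : ℝ) (X : ℝ × EuclideanSpace ℝ (Fin d)) :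
    Set (ℝ × EuclideanSpace ℝ (Fin d)) :=
  {p ∈ QCyl d m r X | 0 < p.2 i}

/-- Multi-indices of order exactly `k`. -/
def MIdx (d k : ℕ) : Finset (Fin d → ℕ) :=
  (Fintype.piFinset fun _ : Fin d => Finset.range (k + 1)).filter fun γ => ∑ i, γ i = k

/-- Multi-indices of order at most `k`. -/
def MIdxLe (d k : ℕ) : Finset (Fin d → ℕ) :=
  (Fintype.piFinset fun _ : Fin d => Finset.range (k + 1)).filter fun γ => ∑ i, γ i ≤ k

/-- Multi-indices of order strictly less than `k`. -/
def MIdxLt (d k : ℕ) : Finset (Fin d → ℕ) :=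
  (Fintype.piFinset fun _ : Fin d => Finset.range (k + 1)).filter fun γ => ∑ i, γ i < k

variable {d n : ℕ} {F : Type*} [NormedAddCommGroup F] [NormedSpace ℝ F]

/-- Spatial partial derivative in the `i`-th coordinate direction. -/
def pder (i : Fin d) (u : ℝ × EuclideanSpace ℝ (Fin d) → F) :
    ℝ × EuclideanSpace ℝ (Fin d) → F :=
  fun p => fderiv ℝ (fun y => u (p.1, y)) p.2 (EuclideanSpace.single i 1)

/-- Multi-index spatial derivative `D^γ`. -/
def Dmul (γ : Fin d → ℕ) (u : ℝ × EuclideanSpace ℝ (Fin d) → F) :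
    ℝ × EuclideanSpace ℝ (Fin d) → F :=
  (List.finRange d).foldr (fun i v => (pder i)^[γ i] v) u

/-- Time derivative `∂_t`. -/
def tder (u : ℝ × EuclideanSpace ℝ (Fin d) → F) : ℝ × EuclideanSpace ℝ (Fin d) → F :=
  fun p => deriv (fun s => u (s, p.2)) p.1

/-- The set of difference quotients entering the spatial Hölder seminorm `[f]*_{a,D}`. -/
def sHolderSet (a : ℝ) (D : Set (ℝ × EuclideanSpace ℝ (Fin d)))
    (f : ℝ × EuclideanSpace ℝ (Fin d) → F) : Set ℝ :=
  {c | ∃ p ∈ D, ∃ q ∈ D, p.1 = q.1 ∧ p.2 ≠ q.2 ∧ c = ‖f p - f q‖ / dist p.2 q.2 ^ a}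

/-- The spatial Hölder seminorm `[f]*_{a,D}`. -/
def sHolder (a : ℝ) (D : Set (ℝ × EuclideanSpace ℝ (Fin d)))
    (f : ℝ × EuclideanSpace ℝ (Fin d) → F) : ℝ :=
  sSup (sHolderSet a D f)

/-- The set of difference quotients entering the parabolic Hölder seminorm `[f]_{σ,a,D}`. -/
def pHolderSet (σ a : ℝ) (D : Set (ℝ × EuclideanSpace ℝ (Fin d)))
    (f : ℝ × EuclideanSpace ℝ (Fin d) → F) : Set ℝ :=
  {c | ∃ p ∈ D, ∃ q ∈ D, p ≠ q ∧ c = ‖f p - f q‖ / (|p.1 - q.1| ^ σ + dist p.2 q.2 ^ a)}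

/-- The parabolic Hölder seminorm `[f]_{σ,a,D}`. -/
def pHolder (σ a : ℝ) (D : Set (ℝ × EuclideanSpace ℝ (Fin d)))
    (f : ℝ × EuclideanSpace ℝ (Fin d) → F) : ℝ :=
  sSup (pHolderSet σ a D f)

/-- The set of difference quotients entering the time Hölder seminorm `⟨f⟩_{σ,D}`. -/
def tHolderSet (σ : ℝ) (D : Set (ℝ × EuclideanSpace ℝ (Fin d)))
    (f : ℝ × EuclideanSpace ℝ (Fin d) → F) : Set ℝ :=
  {c | ∃ p ∈ D, ∃ q ∈ D, p.2 = q.2 ∧ p.1 ≠ q.1 ∧ c = ‖f p - f q‖ / |p.1 - q.1| ^ σ}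

/-- The time Hölder seminorm `⟨f⟩_{σ,D}`. -/
def tHolder (σ : ℝ) (D : Set (ℝ × EuclideanSpace ℝ (Fin d)))
    (f : ℝ × EuclideanSpace ℝ (Fin d) → F) : ℝ :=
  sSup (tHolderSet σ D f)

/-- The `L^∞` norm over a set. -/
def LpInf (D : Set (ℝ × EuclideanSpace ℝ (Fin d)))
    (f : ℝ × EuclideanSpace ℝ (Fin d) → F) : ℝ :=
  (eLpNorm f ⊤ (volume.restrict D)).toReal

/-- The `L²` norm over a set. -/
def L2Norm (D : Set (ℝ × EuclideanSpace ℝ (Fin d)))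
    (f : ℝ × EuclideanSpace ℝ (Fin d) → F) : ℝ :=
  (eLpNorm f 2 (volume.restrict D)).toReal

/-- The Legendre–Hadamard ellipticity condition with constant `lam`. -/
def LegHad (d n m : ℕ) (lam : ℝ)
    (B : (Fin d → ℕ) → (Fin d → ℕ) → Fin n → Fin n → ℝ) : Prop :=
  ∀ (ξ : Fin n → ℝ) (η : Fin d → ℝ),
    lam * (∑ i, ξ i ^ 2) * (∑ k, η k ^ 2) ^ m ≤
      ∑ α ∈ MIdx d m, ∑ β ∈ MIdx d m, ∑ i, ∑ j,
        B α β i j * ξ i * ξ j * ((∏ k, η k ^ α k) * ∏ k, η k ^ β k)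

end

section Lines

variable {W G : Type*} [NormedAddCommGroup W] [NormedSpace ℝ W] [MeasurableSpace W]
  [BorelSpace W] [FiniteDimensional ℝ W] [NormedAddCommGroup G] [NormedSpace ℝ G]
  [CompleteSpace G]

/-- An integral over `W` is an average of integrals over the lines parallel to `e`. -/
theorem integral_eq_integral_lines (μ : Measure W) [μ.IsAddHaarMeasure] (l : W →L[ℝ] ℝ) {e : W}
    (he : l e = 1) {g : W → G} (hg : Integrable g μ) :
    ∫ x, g x ∂μ =
      ∫ x, ((Ico (0 : ℝ) 1).indicator (fun _ => (1 : ℝ)) (l x) • ∫ s : ℝ, g (x + s • e)) ∂μ := by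
  set k : ℝ → ℝ := (Ico (0 : ℝ) 1).indicator (fun _ => (1 : ℝ)) with hk
  have hkm : Measurable k := measurable_const.indicator measurableSet_Ico
  have hki : ∀ c : ℝ, (fun s => k (c - s)) = (Ioc (c - 1) c).indicator (fun _ => (1 : ℝ)) := by
    intro c
    ext s
    simp only [hk, indicator_apply, mem_Ico, mem_Ioc]
    congr 1
    simp only [eq_iff_iff]
    constructor <;> rintro ⟨h1, h2⟩ <;> constructor <;> linarith
  have hkint : ∀ c : ℝ, Integrable (fun s => k (c - s)) := by
    intro c
    rw [hki, integrable_indicator_iff measurableSet_Ioc]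
    exact integrableOn_const (by simp)
  have hk1 : ∀ c : ℝ, ∫ s, k (c - s) = 1 := by
    intro c
    rw [hki, integral_indicator measurableSet_Ioc]
    simp
  have hk0 : ∀ c, 0 ≤ k c := fun c => indicator_nonneg (fun _ _ => zero_le_one) _
  let K : ℝ × W → G := fun p => k (l p.2 - p.1) • g p.2
  have hKm : AEStronglyMeasurable K (volume.prod μ) := by
    refine AEStronglyMeasurable.smul ?_ hg.1.comp_snd
    exact (hkm.comp ((l.continuous.measurable.comp measurable_snd).sub
      measurable_fst)).aestronglyMeasurable
  have hK : Integrable K (volume.prod μ) := by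
    rw [integrable_prod_iff' hKm]
    constructor
    · exact Filter.Eventually.of_forall fun y => (hkint (l y)).smul_const (g y)
    · have : (fun y => ∫ x, ‖K (x, y)‖) = fun y => ‖g y‖ := by
        ext y
        simp only [K, norm_smul, Real.norm_of_nonneg (hk0 _)]
        rw [integral_mul_const, hk1, one_mul]
      rw [this]
      exact hg.norm
  have hT : MeasurePreserving (fun p : ℝ × W => (p.1, p.2 + p.1 • e)) (volume.prod μ)
      (volume.prod μ) := by
    refine (MeasurePreserving.id volume).skew_product (g := fun s x => x + s • e) ?_ ?_
    · exact (by fun_prop : Continuous fun p : ℝ × W => p.2 + p.1 • e).measurable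
    · exact Filter.Eventually.of_forall fun s => map_add_right_eq_self μ _
  have hH : Integrable (fun p : ℝ × W => k (l p.2) • g (p.2 + p.1 • e)) (volume.prod μ) := by
    have := hT.integrable_comp_of_integrable hK
    refine this.congr (Filter.Eventually.of_forall fun p => ?_)
    simp [K, he]
  calc ∫ x, g x ∂μ = ∫ y, (∫ s, K (s, y)) ∂μ := by
        congr 1; ext y; simp only [K]; rw [integral_smul_const, hk1, one_smul]
    _ = ∫ p, K p ∂(volume.prod μ) := (integral_prod_symm _ hK).symm
    _ = ∫ s, ∫ y, K (s, y) ∂μ := integral_prod _ hK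
    _ = ∫ s, ∫ y, k (l y) • g (y + s • e) ∂μ := by
        congr 1; ext s
        rw [← integral_add_right_eq_self _ (s • e)]
        simp [K, he]
    _ = ∫ p : ℝ × W, k (l p.2) • g (p.2 + p.1 • e) ∂(volume.prod μ) := (integral_prod _ hH).symm
    _ = ∫ y, (∫ s : ℝ, k (l y) • g (y + s • e)) ∂μ := integral_prod_symm _ hH
    _ = _ := by congr 1; ext y; rw [integral_smul]

/-- A function whose integral over every line parallel to `e` vanishes has integral zero. -/
theorem integral_eq_zero_of_lines (μ : Measure W) [μ.IsAddHaarMeasure] (l : W →L[ℝ] ℝ) {e : W}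
    (he : l e = 1) {g : W → G} (hg : Integrable g μ) (h : ∀ x, ∫ s : ℝ, g (x + s • e) = 0) :
    ∫ x, g x ∂μ = 0 := by
  simp [integral_eq_integral_lines μ l he hg, h]

/-- A function whose integral over every line parallel to `e` is nonnegative has nonnegative
integral. -/
theorem integral_nonneg_of_lines (μ : Measure W) [μ.IsAddHaarMeasure] (l : W →L[ℝ] ℝ) {e : W}
    (he : l e = 1) {g : W → ℝ} (hg : Integrable g μ) (h : ∀ x, 0 ≤ ∫ s : ℝ, g (x + s • e)) :
    0 ≤ ∫ x, g x ∂μ := by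
  rw [integral_eq_integral_lines μ l he hg]
  exact integral_nonneg fun x => smul_nonneg (indicator_nonneg (fun _ _ => zero_le_one) _) (h x)

end Lines

section OneDim

theorem sq_intervalIntegral_abs_le {a b : ℝ} (hab : a < b) {f : ℝ → ℝ} (hf : Continuous f) :
    (∫ s in a..b, |f s|) ^ 2 ≤ (b - a) * ∫ s in a..b, f s ^ 2 := by
  set I := ∫ s in a..b, |f s|
  have hba : 0 < b - a := sub_pos.2 hab
  set c := I / (b - a)
  have h0 : 0 ≤ ∫ s in a..b, (|f s| - c) ^ 2 :=
    intervalIntegral.integral_nonneg hab.le fun _ _ => sq_nonneg _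
  have h1 : ∫ s in a..b, (|f s| - c) ^ 2 =
      (∫ s in a..b, f s ^ 2) - 2 * c * I + (b - a) * c ^ 2 := by
    have : ∀ s, (|f s| - c) ^ 2 = f s ^ 2 - 2 * c * |f s| + c ^ 2 := by
      intro s; rw [sub_sq, sq_abs]; ring
    simp only [this]
    rw [intervalIntegral.integral_add, intervalIntegral.integral_sub,
      intervalIntegral.integral_const_mul, intervalIntegral.integral_const, smul_eq_mul]
    all_goals exact Continuous.intervalIntegrable (by fun_prop) _ _
  have h2 : c * (b - a) = I := div_mul_cancel₀ _ hba.ne'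
  rw [h1] at h0
  have h3 : 0 ≤ (b - a) * ((∫ s in a..b, f s ^ 2) - 2 * c * I + (b - a) * c ^ 2) :=
    mul_nonneg hba.le h0
  have h4 : I ^ 2 = (c * (b - a)) ^ 2 := by rw [h2]
  have h5 : (b - a) * ((∫ s in a..b, f s ^ 2) - 2 * c * I + (b - a) * c ^ 2) =
      (b - a) * (∫ s in a..b, f s ^ 2) - 2 * (c * (b - a)) * I + (c * (b - a)) ^ 2 := by ring
  rw [h5, h2] at h3
  nlinarith

open Polynomial in
/-- Pointwise control of a function by the `L²` norms of the function and its `m`-th derivative,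
on one-sided intervals of fixed length. -/
theorem exists_sq_le_integral_sq_add_sq (m : ℕ) (hm : 1 ≤ m) (b : ℝ) (hb : 0 < b) :
    ∃ C : ℝ, 0 ≤ C ∧ ∀ g : ℕ → ℝ → ℝ, (∀ k s, HasDerivAt (g k) (g (k + 1) s) s) →
      ∀ x, g 0 x ^ 2 ≤ C * ∫ s in x..(x + b), (g 0 s ^ 2 + g m s ^ 2) := by
  obtain ⟨M, rfl⟩ : ∃ M, m = M + 1 := ⟨m - 1, by omega⟩
  set p : ℝ[X] := X ^ M * (X - C b) ^ (M + 1) with hp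
  set P : ℕ → ℝ → ℝ := fun k s => (derivative^[k] p).eval s with hP
  have hPd : ∀ k s, HasDerivAt (P k) (P (k + 1) s) s := by
    intro k s
    simp only [hP, Function.iterate_succ_apply']
    exact Polynomial.hasDerivAt _ _
  have hPb : ∀ k, k < M + 1 → P k b = 0 := by
    intro k hk
    have h1 : (X - C b) ^ (M + 1 - k) ∣ derivative^[k] p :=
      pow_sub_dvd_iterate_derivative_of_pow_dvd k (Dvd.intro_left _ rfl)
    have h2 : (X - C b) ∣ derivative^[k] p :=
      (dvd_pow_self _ (by omega)).trans h1
    exact dvd_iff_isRoot.1 h2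
  have hP0' : ∀ k, P k 0 = k.factorial * p.coeff k := by
    intro k
    simp only [hP]
    rw [← coeff_zero_eq_eval_zero, coeff_iterate_derivative, zero_add, Nat.descFactorial_self,
      nsmul_eq_mul]
  have hP0 : ∀ k, k < M → P k 0 = 0 := by
    intro k hk
    rw [hP0', hp, coeff_X_pow_mul', if_neg (by omega), mul_zero]
  have hPM : P M 0 = M.factorial * (-b) ^ (M + 1) := by
    rw [hP0', hp, coeff_X_pow_mul', if_pos le_rfl, Nat.sub_self, coeff_zero_eq_eval_zero]
    simp
  have hPc : ∀ k, Continuous (P k) := fun k => Polynomial.continuous _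
  obtain ⟨B, hB⟩ := (isCompact_Icc (a := (0 : ℝ)) (b := b)).exists_bound_of_continuousOn
    (f := fun s => |P 0 s| + |P (M + 1) s|) (by fun_prop)
  have hB0 : ∀ s ∈ Icc (0 : ℝ) b, |P 0 s| ≤ B := fun s hs => by
    have := hB s hs
    rw [Real.norm_of_nonneg (by positivity)] at this
    linarith [abs_nonneg (P (M + 1) s)]
  have hBM : ∀ s ∈ Icc (0 : ℝ) b, |P (M + 1) s| ≤ B := fun s hs => by
    have := hB s hs
    rw [Real.norm_of_nonneg (by positivity)] at this
    linarith [abs_nonneg (P 0 s)]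
  have hBn : 0 ≤ B := (abs_nonneg _).trans (hB0 0 ⟨le_rfl, hb.le⟩)
  have hPM0 : P M 0 ≠ 0 := by
    rw [hPM]
    have : (-b) ^ (M + 1) ≠ 0 := pow_ne_zero _ (by linarith)
    positivity
  refine ⟨2 * B ^ 2 * b / (P M 0) ^ 2, by positivity, fun g hg x => ?_⟩
  have hgc : ∀ k, Continuous (g k) := fun k =>
    continuous_iff_continuousAt.2 fun s => (hg k s).continuousAt
  set S : ℕ → ℝ := fun k => ∫ s in x..(x + b), P k (s - x) * g (M + 1 - k) s with hS
  have hstep : ∀ k, k < M + 1 → S k = P k b * g (M - k) (x + b) - P k 0 * g (M - k) x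
      - S (k + 1) := by
    intro k hk
    have := intervalIntegral.integral_mul_deriv_eq_deriv_mul (a := x) (b := x + b)
      (u := fun s => P k (s - x)) (v := g (M - k)) (u' := fun s => P (k + 1) (s - x))
      (v' := g (M - k + 1))
      (fun s _ => (hPd k (s - x)).comp_sub_const s x)
      (fun s _ => hg _ s)
      ((hPc _).comp (continuous_id.sub continuous_const) |>.intervalIntegrable _ _)
      ((hgc _).intervalIntegrable _ _)
    simp only [add_sub_cancel_left, sub_self] at this
    simp only [hS]
    rw [show M + 1 - k = M - k + 1 by omega, show M + 1 - (k + 1) = M - k by omega]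
    exact this
  have hSk : ∀ k, k ≤ M → S 0 = (-1) ^ k * S k := by
    intro k
    induction k with
    | zero => simp
    | succ k ih =>
      intro hk
      rw [ih (by omega), hstep k (by omega), hPb k (by omega), hP0 k (by omega)]
      ring
  have hfin : |P M 0 * g 0 x| ≤ |S 0| + |S (M + 1)| := by
    have h1 := hSk M le_rfl
    have h2 := hstep M (by omega)
    rw [hPb M (by omega), Nat.sub_self] at h2
    have h3 : P M 0 * g 0 x = - S M - S (M + 1) := by linarith
    have h4 : |S 0| = |S M| := by rw [h1, abs_mul, abs_pow, abs_neg, abs_one, one_pow, one_mul]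
    rw [h3, h4]
    calc |-S M - S (M + 1)| ≤ |-S M| + |S (M + 1)| := abs_sub _ _
      _ = _ := by rw [abs_neg]
  have hSb : ∀ k, (∀ s ∈ Icc (0 : ℝ) b, |P k s| ≤ B) →
      |S k| ^ 2 ≤ B ^ 2 * b * ∫ s in x..(x + b), g (M + 1 - k) s ^ 2 := by
    intro k hk
    have h1 : |S k| ≤ B * ∫ s in x..(x + b), |g (M + 1 - k) s| := by
      rw [← intervalIntegral.integral_const_mul]
      refine (intervalIntegral.abs_integral_le_integral_abs (by linarith)).trans ?_
      refine intervalIntegral.integral_mono_on (by linarith) ?_ ?_ ?_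
      · exact (((hPc k).comp (continuous_id.sub continuous_const)).mul
          (hgc _)).abs.intervalIntegrable _ _
      · exact (continuous_const.mul (hgc _).abs).intervalIntegrable _ _
      · intro s hs
        rw [abs_mul]
        exact mul_le_mul_of_nonneg_right (hk _ ⟨by linarith [hs.1], by linarith [hs.2]⟩)
          (abs_nonneg _)
    have h2 := sq_intervalIntegral_abs_le (show x < x + b by linarith) (hgc (M + 1 - k))
    rw [add_sub_cancel_left] at h2
    calc |S k| ^ 2 ≤ (B * ∫ s in x..(x + b), |g (M + 1 - k) s|) ^ 2 :=
          pow_le_pow_left₀ (abs_nonneg _) h1 2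
      _ = B ^ 2 * (∫ s in x..(x + b), |g (M + 1 - k) s|) ^ 2 := by ring
      _ ≤ B ^ 2 * (b * ∫ s in x..(x + b), g (M + 1 - k) s ^ 2) :=
          mul_le_mul_of_nonneg_left h2 (sq_nonneg _)
      _ = _ := by ring
  have e0 := hSb 0 hB0
  have e1 := hSb (M + 1) hBM
  rw [Nat.sub_zero] at e0
  rw [Nat.sub_self] at e1
  have hadd : ∫ s in x..(x + b), (g 0 s ^ 2 + g (M + 1) s ^ 2) =
      (∫ s in x..(x + b), g 0 s ^ 2) + ∫ s in x..(x + b), g (M + 1) s ^ 2 :=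
    intervalIntegral.integral_add (((hgc _).pow 2).intervalIntegrable _ _)
      (((hgc _).pow 2).intervalIntegrable _ _)
  rw [hadd, div_mul_eq_mul_div, le_div_iff₀ (by positivity)]
  have h3 : (P M 0 * g 0 x) ^ 2 ≤ (|S 0| + |S (M + 1)|) ^ 2 := by
    rw [← sq_abs (P M 0 * g 0 x)]
    exact pow_le_pow_left₀ (abs_nonneg _) hfin 2
  nlinarith [sq_nonneg (|S 0| - |S (M + 1)|)]

/-- Taylor bound for a function vanishing to order `m` at the left end point. -/
theorem abs_le_mul_pow_of_vanishing (m : ℕ) {A r x : ℝ} (g : ℕ → ℝ → ℝ)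
    (hg : ∀ k s, HasDerivAt (g k) (g (k + 1) s) s) (h0 : ∀ k < m, g k x = 0)
    (hA : ∀ s ∈ Icc x (x + r), |g m s| ≤ A) :
    ∀ s ∈ Icc x (x + r), |g 0 s| ≤ A * r ^ m := by
  induction m generalizing g with
  | zero => simpa using hA
  | succ m ih =>
    have h1 := ih (fun k => g (k + 1)) (fun k s => hg (k + 1) s)
      (fun k hk => h0 (k + 1) (by omega)) hA
    intro s hs
    have h2 := norm_image_sub_le_of_norm_deriv_le_segment' (f := g 0) (f' := g 1) (a := x)
      (b := x + r) (C := A * r ^ m) (fun y _ => (hg 0 y).hasDerivWithinAt)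
      (fun y hy => h1 y ⟨hy.1, hy.2.le⟩) s hs
    rw [h0 0 (by omega), sub_zero, Real.norm_eq_abs] at h2
    have h3 : 0 ≤ A * r ^ m := (abs_nonneg _).trans (h1 s hs)
    calc |g 0 s| ≤ A * r ^ m * (s - x) := h2
      _ ≤ A * r ^ m * r := mul_le_mul_of_nonneg_left (by linarith [hs.2]) h3
      _ = _ := by ring

end OneDim

noncomputable section SmoothAlgebra

/-- The algebra of smooth real functions of `(t, x)`. -/
def smoothAlg (d : ℕ) : Subalgebra ℝ (ℝ × EuclideanSpace ℝ (Fin d) → ℝ) where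
  carrier := {f | ContDiff ℝ (⊤ : ℕ∞) f}
  mul_mem' {_ _} hf hg := by
    rw [mem_ofPred_eq] at hf hg ⊢
    exact hf.mul hg
  add_mem' {_ _} hf hg := by
    rw [mem_ofPred_eq] at hf hg ⊢
    exact hf.add hg
  algebraMap_mem' c := (contDiff_const : ContDiff ℝ (⊤ : ℕ∞) fun _ => c)

variable {d : ℕ}

theorem smoothAlg_contDiff (f : smoothAlg d) : ContDiff ℝ (⊤ : ℕ∞) f.1 := f.2

theorem smoothAlg_continuous (f : smoothAlg d) : Continuous f.1 := (smoothAlg_contDiff f).continuous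

theorem smoothAlg_differentiable (f : smoothAlg d) : Differentiable ℝ f.1 :=
  (smoothAlg_contDiff f).differentiable (by simp)

/-- Directional derivative, as a derivation of the algebra of smooth functions. -/
def dirDer (e : ℝ × EuclideanSpace ℝ (Fin d)) : Derivation ℝ (smoothAlg d) (smoothAlg d) :=
  Derivation.mk'
    { toFun := fun f => ⟨fun p => fderiv ℝ f.1 p e,
        ((smoothAlg_contDiff f).fderiv_right (m := (⊤ : ℕ∞)) (by simp)).clm_apply contDiff_const⟩
      map_add' := fun f g => by
        ext p
        simp [fderiv_add (smoothAlg_differentiable f p) (smoothAlg_differentiable g p)]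
      map_smul' := fun c f => by
        ext p
        simp [fderiv_const_smul (smoothAlg_differentiable f p)] }
    (fun f g => by
      ext p
      simp [fderiv_mul (smoothAlg_differentiable f p) (smoothAlg_differentiable g p)])

theorem dirDer_apply (e : ℝ × EuclideanSpace ℝ (Fin d)) (f : smoothAlg d)
    (p : ℝ × EuclideanSpace ℝ (Fin d)) : (dirDer e f).1 p = fderiv ℝ f.1 p e := rfl

theorem dirDer_comm (e v : ℝ × EuclideanSpace ℝ (Fin d)) (f : smoothAlg d) :
    dirDer e (dirDer v f) = dirDer v (dirDer e f) := by
  ext p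
  have hd : DifferentiableAt ℝ (fderiv ℝ f.1) p :=
    ((smoothAlg_contDiff f).fderiv_right (m := (⊤ : ℕ∞)) (by simp)).differentiable (by simp) p
  have key : ∀ a b : ℝ × EuclideanSpace ℝ (Fin d),
      (dirDer a (dirDer b f)).1 p = fderiv ℝ (fderiv ℝ f.1) p a b := by
    intro a b
    rw [dirDer_apply]
    have : (dirDer b f).1 = fun q => fderiv ℝ f.1 q b := rfl
    rw [this, fderiv_clm_apply hd (differentiableAt_const b)]
    simp
  rw [key, key]
  have hs : IsSymmSndFDerivAt ℝ f.1 p :=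
    (smoothAlg_contDiff f).contDiffAt.isSymmSndFDerivAt (by
      simp only [minSmoothness_of_isRCLikeNormedField]
      exact WithTop.coe_le_coe.2 (le_top : (2 : ℕ∞) ≤ ⊤))
  exact hs e v

/-- Derivative in the `i`-th space direction. -/
def spD (i : Fin d) : Derivation ℝ (smoothAlg d) (smoothAlg d) :=
  dirDer (0, EuclideanSpace.single i 1)

/-- Time derivative. -/
def tmD : Derivation ℝ (smoothAlg d) (smoothAlg d) := dirDer (1, 0)

theorem spD_comm (i j : Fin d) (f : smoothAlg d) : spD i (spD j f) = spD j (spD i f) :=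
  dirDer_comm _ _ _

theorem spD_tmD (i : Fin d) (f : smoothAlg d) : spD i (tmD f) = tmD (spD i f) :=
  dirDer_comm _ _ _

/-- The derivative `D^γ` on smooth functions. -/
def multiD (γ : Fin d → ℕ) : Module.End ℝ (smoothAlg d) :=
  ((List.finRange d).map fun i => ((spD i : Derivation ℝ (smoothAlg d) (smoothAlg d)).toLinearMap :
    Module.End ℝ (smoothAlg d)) ^ γ i).prod

theorem commute_spD (i j : Fin d) :
    Commute (S := Module.End ℝ (smoothAlg d)) (spD i).toLinearMap (spD j).toLinearMap := by
  ext1 f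
  exact spD_comm i j f

theorem multiD_zero (f : smoothAlg d) : multiD 0 f = f := by
  have : (multiD 0 : Module.End ℝ (smoothAlg d)) = 1 := by
    simp [multiD]
  rw [this]; rfl

theorem multiD_add (α β : Fin d → ℕ) (f : smoothAlg d) :
    multiD (α + β) f = multiD α (multiD β f) := by
  have : ∀ l : List (Fin d),
      (l.map fun i => ((spD i).toLinearMap : Module.End ℝ (smoothAlg d)) ^ (α + β) i).prod =
      (l.map fun i => ((spD i).toLinearMap : Module.End ℝ (smoothAlg d)) ^ α i).prod *
      (l.map fun i => ((spD i).toLinearMap : Module.End ℝ (smoothAlg d)) ^ β i).prod := by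
    intro l
    induction l with
    | nil => simp
    | cons i l ih =>
      rw [List.map_cons, List.prod_cons, ih]
      simp only [List.map_cons, List.prod_cons, Pi.add_apply, pow_add]
      have hc : Commute (((spD i).toLinearMap : Module.End ℝ (smoothAlg d)) ^ β i)
          (l.map fun i => ((spD i).toLinearMap : Module.End ℝ (smoothAlg d)) ^ α i).prod := by
        refine Commute.list_prod_right _ _ fun x hx => ?_
        obtain ⟨j, -, rfl⟩ := List.mem_map.1 hx
        exact (commute_spD i j).pow_pow _ _
      have hc' := hc.eq
      simp only [mul_assoc]
      congr 1
      rw [← mul_assoc, hc', mul_assoc]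
  have h := this (List.finRange d)
  exact congrArg (fun T : Module.End ℝ (smoothAlg d) => T f) h

theorem multiD_single (i : Fin d) (k : ℕ) (f : smoothAlg d) :
    multiD (Pi.single i k) f = (spD i)^[k] f := by
  have : ∀ l : List (Fin d), l.Nodup →
      (l.map fun j => ((spD j).toLinearMap : Module.End ℝ (smoothAlg d)) ^
        (Pi.single i k : Fin d → ℕ) j).prod =
      if i ∈ l then ((spD i).toLinearMap : Module.End ℝ (smoothAlg d)) ^ k else 1 := by
    intro l hl
    induction l with
    | nil => simp
    | cons j l ih =>
      rw [List.nodup_cons] at hl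
      simp only [List.map_cons, List.prod_cons, ih hl.2, List.mem_cons]
      by_cases h : j = i
      · subst h
        simp [hl.1]
      · have h' : ¬ i = j := fun e => h e.symm
        simp [h, h']
  rw [multiD, this _ (List.nodup_finRange d), if_pos (List.mem_finRange i), Module.End.pow_apply]
  rfl

theorem multiD_single_one (i : Fin d) (f : smoothAlg d) :
    multiD (Pi.single i 1) f = spD i f := by
  rw [multiD_single]; rfl

theorem spD_multiD (i : Fin d) (γ : Fin d → ℕ) (f : smoothAlg d) :
    spD i (multiD γ f) = multiD (γ + Pi.single i 1) f := by
  rw [← multiD_single_one, ← multiD_add, add_comm]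

theorem multiD_spD (i : Fin d) (γ : Fin d → ℕ) (f : smoothAlg d) :
    multiD γ (spD i f) = multiD (γ + Pi.single i 1) f := by
  rw [← multiD_single_one, ← multiD_add]

theorem multiD_tmD (γ : Fin d → ℕ) (f : smoothAlg d) :
    multiD γ (tmD f) = tmD (multiD γ f) := by
  have : Commute (S := Module.End ℝ (smoothAlg d)) (multiD γ) (tmD.toLinearMap) := by
    refine Commute.list_prod_left _ _ fun x hx => ?_
    obtain ⟨j, -, rfl⟩ := List.mem_map.1 hx
    refine Commute.pow_left ?_ _
    ext1 f
    exact spD_tmD j f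
  exact congrArg (fun T : Module.End ℝ (smoothAlg d) => T f) this.eq

theorem pder_coe (i : Fin d) (f : smoothAlg d) : pder i f.1 = (spD i f).1 := by
  ext p
  have h : HasFDerivAt (fun y => f.1 (p.1, y))
      ((fderiv ℝ f.1 p).comp (ContinuousLinearMap.inr ℝ ℝ (EuclideanSpace ℝ (Fin d)))) p.2 :=
    (smoothAlg_differentiable f p).hasFDerivAt.comp p.2 (hasFDerivAt_prodMk_right p.1 p.2)
  rw [pder, h.fderiv]
  simp [spD, dirDer_apply]

theorem tder_coe (f : smoothAlg d) : tder f.1 = (tmD f).1 := by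
  ext p
  have h : HasFDerivAt (fun s => f.1 (s, p.2))
      ((fderiv ℝ f.1 p).comp (ContinuousLinearMap.inl ℝ ℝ (EuclideanSpace ℝ (Fin d)))) p.1 :=
    (smoothAlg_differentiable f p).hasFDerivAt.comp p.1 (hasFDerivAt_prodMk_left p.1 p.2)
  rw [tder, h.hasDerivAt.deriv]
  simp [tmD, dirDer_apply]

section Components

variable {n : ℕ}

/-- The `j`-th component of a smooth vector valued function. -/
def component (u : ℝ × EuclideanSpace ℝ (Fin d) → EuclideanSpace ℝ (Fin n))
    (hu : ContDiff ℝ (⊤ : ℕ∞) u) (j : Fin n) : smoothAlg d :=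
  ⟨fun p => u p j, contDiff_euclidean.1 hu j⟩

theorem pder_apply_comp (i : Fin d) {u : ℝ × EuclideanSpace ℝ (Fin d) → EuclideanSpace ℝ (Fin n)}
    (hu : ContDiff ℝ (⊤ : ℕ∞) u) :
    ∃ h : ContDiff ℝ (⊤ : ℕ∞) (pder i u), ∀ j, component _ h j = spD i (component u hu j) := by
  have hd : Differentiable ℝ u := hu.differentiable (by simp)
  have h : ∀ p, HasFDerivAt (fun y => u (p.1, y))
      ((fderiv ℝ u p).comp (ContinuousLinearMap.inr ℝ ℝ (EuclideanSpace ℝ (Fin d)))) p.2 :=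
    fun p => (hd p).hasFDerivAt.comp p.2 (hasFDerivAt_prodMk_right p.1 p.2)
  have h2 : ∀ p j, pder i u p j = (spD i (component u hu j)).1 p := by
    intro p j
    rw [← pder_coe, pder, pder]
    have h3 : HasFDerivAt (fun y => (component u hu j).1 (p.1, y))
        ((EuclideanSpace.proj j).comp ((fderiv ℝ u p).comp
          (ContinuousLinearMap.inr ℝ ℝ (EuclideanSpace ℝ (Fin d))))) p.2 :=
      ((EuclideanSpace.proj (𝕜 := ℝ) j).hasFDerivAt).comp p.2 (h p)
    rw [h3.fderiv, (h p).fderiv]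
    rfl
  have h4 : ContDiff ℝ (⊤ : ℕ∞) (pder i u) := by
    rw [contDiff_euclidean]
    intro j
    have : (fun p => pder i u p j) = (spD i (component u hu j)).1 := funext fun p => h2 p j
    rw [this]
    exact (spD i (component u hu j)).2
  exact ⟨h4, fun j => Subtype.ext (funext fun p => h2 p j)⟩

theorem pder_iterate_apply (i : Fin d) (k : ℕ)
    {u : ℝ × EuclideanSpace ℝ (Fin d) → EuclideanSpace ℝ (Fin n)} (hu : ContDiff ℝ (⊤ : ℕ∞) u) :
    ∃ h : ContDiff ℝ (⊤ : ℕ∞) ((pder i)^[k] u),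
      ∀ j, component _ h j = (spD i)^[k] (component u hu j) := by
  induction k with
  | zero => exact ⟨hu, fun _ => rfl⟩
  | succ k ih =>
    obtain ⟨h, hc⟩ := ih
    obtain ⟨h', hc'⟩ := pder_apply_comp i h
    rw [Function.iterate_succ_apply']
    exact ⟨h', fun j => by rw [hc', hc, Function.iterate_succ_apply']⟩

theorem Dmul_apply_comp (γ : Fin d → ℕ)
    {u : ℝ × EuclideanSpace ℝ (Fin d) → EuclideanSpace ℝ (Fin n)} (hu : ContDiff ℝ (⊤ : ℕ∞) u)
    (p : ℝ × EuclideanSpace ℝ (Fin d)) (j : Fin n) :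
    Dmul γ u p j = (multiD γ (component u hu j)).1 p := by
  have : ∀ l : List (Fin d), ∃ h : ContDiff ℝ (⊤ : ℕ∞) (l.foldr (fun i v => (pder i)^[γ i] v) u),
      ∀ j, component _ h j =
        (l.map fun i => ((spD i).toLinearMap : Module.End ℝ (smoothAlg d)) ^ γ i).prod
          (component u hu j) := by
    intro l
    induction l with
    | nil => exact ⟨hu, fun _ => rfl⟩
    | cons i l ih =>
      obtain ⟨h, hc⟩ := ih
      obtain ⟨h', hc'⟩ := pder_iterate_apply i (γ i) h
      refine ⟨h', fun j => ?_⟩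
      rw [List.map_cons, List.prod_cons, Module.End.mul_apply, Module.End.pow_apply, ← hc]
      exact hc' j
  obtain ⟨h, hc⟩ := this (List.finRange d)
  have := congrArg (fun f : smoothAlg d => f.1 p) (hc j)
  exact this

theorem tder_apply_comp {u : ℝ × EuclideanSpace ℝ (Fin d) → EuclideanSpace ℝ (Fin n)}
    (hu : ContDiff ℝ (⊤ : ℕ∞) u) (p : ℝ × EuclideanSpace ℝ (Fin d)) (j : Fin n) :
    tder u p j = (tmD (component u hu j)).1 p := by
  have hd : Differentiable ℝ u := hu.differentiable (by simp)
  have h : HasFDerivAt (fun s => u (s, p.2))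
      ((fderiv ℝ u p).comp (ContinuousLinearMap.inl ℝ ℝ (EuclideanSpace ℝ (Fin d)))) p.1 :=
    (hd p).hasFDerivAt.comp p.1 (hasFDerivAt_prodMk_left p.1 p.2)
  rw [← tder_coe, tder, tder]
  have h3 : HasFDerivAt (fun s => (component u hu j).1 (s, p.2))
      ((EuclideanSpace.proj j).comp ((fderiv ℝ u p).comp
        (ContinuousLinearMap.inl ℝ ℝ (EuclideanSpace ℝ (Fin d))))) p.1 :=
    ((EuclideanSpace.proj (𝕜 := ℝ) j).hasFDerivAt).comp p.1 h
  rw [h3.hasDerivAt.deriv, h.hasDerivAt.deriv]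
  rfl

end Components

end SmoothAlgebra

noncomputable section HalfCylinder

variable {d : ℕ}

theorem multiIndex_induction {P : (Fin d → ℕ) → Prop} (h0 : P 0)
    (hs : ∀ γ i, P γ → P (γ + Pi.single i 1)) (γ : Fin d → ℕ) : P γ := by
  have : ∀ k, ∀ γ : Fin d → ℕ, ∑ i, γ i = k → P γ := by
    intro k
    induction k with
    | zero =>
      intro γ h
      have : γ = 0 := by
        ext i
        exact Finset.sum_eq_zero_iff.1 h i (Finset.mem_univ i)
      rwa [this]
    | succ k ih =>
      intro γ h
      obtain ⟨i, hi⟩ : ∃ i, γ i ≠ 0 := by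
        by_contra! hc
        simp [hc] at h
      have h1 : γ = (γ - Pi.single i 1) + Pi.single i 1 := by
        ext j
        by_cases hj : j = i
        · subst hj; simp; omega
        · simp [hj]
      rw [h1]
      refine hs _ _ (ih _ ?_)
      have h2 : ∑ j, γ j = ∑ j, (γ - Pi.single i 1 : Fin d → ℕ) j + 1 := by
        conv_lhs => rw [h1]
        simp [Finset.sum_add_distrib]
      omega
  exact this _ γ rfl

theorem sum_add_single (γ : Fin d → ℕ) (i : Fin d) :
    ∑ j, (γ + Pi.single i 1 : Fin d → ℕ) j = ∑ j, γ j + 1 := by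
  simp [Finset.sum_add_distrib]

/-- The unit half cylinder. -/
def halfCyl (N : Fin d) : Set (ℝ × EuclideanSpace ℝ (Fin d)) :=
  Ioo (-1) 0 ×ˢ (ball 0 1 ∩ {x | 0 < x N})

/-- The flat lateral part of the boundary of the unit half cylinder. -/
def flatBdry (N : Fin d) : Set (ℝ × EuclideanSpace ℝ (Fin d)) :=
  Ioo (-1) 0 ×ˢ (ball 0 1 ∩ {x | x N = 0})

theorem continuous_coord (N : Fin d) : Continuous fun x : EuclideanSpace ℝ (Fin d) => x N :=
  (EuclideanSpace.proj (𝕜 := ℝ) N).continuous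

theorem isOpen_halfCyl (N : Fin d) : IsOpen (halfCyl N) :=
  isOpen_Ioo.prod (isOpen_ball.inter (isOpen_lt continuous_const (continuous_coord N)))

theorem measurableSet_halfCyl (N : Fin d) : MeasurableSet (halfCyl N) :=
  (isOpen_halfCyl N).measurableSet

theorem halfCyl_subset (N : Fin d) : halfCyl N ⊆ closedBall 0 1 := by
  rintro ⟨t, x⟩ ⟨⟨h1, h2⟩, h3, -⟩
  simp only [mem_closedBall, dist_zero_right, Prod.norm_def, sup_le_iff] at *
  simp only [mem_ball, dist_zero_right] at h3
  refine ⟨?_, h3.le⟩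
  rw [Real.norm_eq_abs, abs_le]
  constructor <;> linarith

theorem integrableOn_halfCyl (N : Fin d) (f : smoothAlg d) : IntegrableOn f.1 (halfCyl N) :=
  ((smoothAlg_continuous f).continuousOn.integrableOn_compact
    (isCompact_closedBall 0 1)).mono_set (halfCyl_subset N)

/-- Integration over the unit half cylinder. -/
def intU (N : Fin d) : smoothAlg d →ₗ[ℝ] ℝ where
  toFun f := ∫ p in halfCyl N, f.1 p
  map_add' f g := integral_add (integrableOn_halfCyl N f) (integrableOn_halfCyl N g)
  map_smul' c _ := integral_const_mul c _

theorem intU_apply (N : Fin d) (f : smoothAlg d) : intU N f = ∫ p in halfCyl N, f.1 p := rfl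

theorem intU_mono (N : Fin d) {f g : smoothAlg d} (h : ∀ p ∈ halfCyl N, f.1 p ≤ g.1 p) :
    intU N f ≤ intU N g :=
  setIntegral_mono_on (integrableOn_halfCyl N f) (integrableOn_halfCyl N g)
    (measurableSet_halfCyl N) h

theorem intU_nonneg (N : Fin d) {f : smoothAlg d} (h : ∀ p ∈ halfCyl N, 0 ≤ f.1 p) :
    0 ≤ intU N f :=
  setIntegral_nonneg (measurableSet_halfCyl N) h

theorem intU_sq_nonneg (N : Fin d) (f : smoothAlg d) : 0 ≤ intU N (f ^ 2) :=
  intU_nonneg N fun _ _ => sq_nonneg _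

theorem intU_congr (N : Fin d) {f g : smoothAlg d} (h : ∀ p ∈ halfCyl N, f.1 p = g.1 p) :
    intU N f = intU N g :=
  setIntegral_congr_fun (measurableSet_halfCyl N) h

theorem exists_bound_halfCyl (N : Fin d) (f : smoothAlg d) :
    ∃ M : ℝ, 0 ≤ M ∧ ∀ p ∈ halfCyl N, |f.1 p| ≤ M := by
  obtain ⟨M, hM⟩ := (isCompact_closedBall (0 : ℝ × EuclideanSpace ℝ (Fin d))
    1).exists_bound_of_continuousOn (smoothAlg_continuous f).continuousOn
  exact ⟨max M 0, le_max_right _ _,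
    fun p hp => (hM p (halfCyl_subset N hp)).trans (le_max_left _ _)⟩

/-- Smooth functions supported in a fixed ball inside the unit cylinder. -/
def Cut (f : smoothAlg d) : Prop := tsupport f.1 ⊆ closedBall 0 (3 / 4)

theorem Cut.mul_right {f : smoothAlg d} (hf : Cut f) (g : smoothAlg d) : Cut (f * g) :=
  (closure_mono (Function.support_mul_subset_left f.1 g.1)).trans hf

theorem Cut.dirDer {f : smoothAlg d} (hf : Cut f) (e : ℝ × EuclideanSpace ℝ (Fin d)) :
    Cut (dirDer e f) := by
  refine (closure_minimal ?_ (isClosed_tsupport _)).trans hf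
  intro p hp
  refine support_fderiv_subset ℝ (f := f.1) ?_
  intro h0
  exact hp (by rw [dirDer_apply, h0]; rfl)

theorem Cut.spD {f : smoothAlg d} (hf : Cut f) (i : Fin d) : Cut (spD i f) := hf.dirDer _

theorem Cut.hasCompactSupport {f : smoothAlg d} (hf : Cut f) : HasCompactSupport f.1 :=
  (isCompact_closedBall _ _).of_isClosed_subset (isClosed_tsupport _) hf

theorem Cut.eq_zero {f : smoothAlg d} (hf : Cut f) {p : ℝ × EuclideanSpace ℝ (Fin d)}
    (hp : 3 / 4 < ‖p‖) : f.1 p = 0 := by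
  by_contra h
  have := hf (subset_tsupport _ h)
  rw [mem_closedBall, dist_zero_right] at this
  linarith

/-- The unbounded region `{t < 0, x_N > 0}`. -/
def quarter (N : Fin d) : Set (ℝ × EuclideanSpace ℝ (Fin d)) := {p | p.1 < 0 ∧ 0 < p.2 N}

theorem measurableSet_quarter (N : Fin d) : MeasurableSet (quarter N) :=
  ((isOpen_lt continuous_fst continuous_const).inter
    (isOpen_lt continuous_const ((continuous_coord N).comp continuous_snd))).measurableSet

theorem Cut.intU_eq {N : Fin d} {f : smoothAlg d} (hf : Cut f) :
    intU N f = ∫ p, (quarter N).indicator f.1 p := by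
  rw [intU_apply, ← integral_indicator (measurableSet_halfCyl N)]
  congr 1
  ext p
  change (halfCyl N).indicator f.1 p = (quarter N).indicator f.1 p
  by_cases hp : 3 / 4 < ‖p‖
  · simp [indicator, hf.eq_zero hp]
  · have h1 : ‖p.1‖ ≤ 3 / 4 := (norm_fst_le p).trans (not_lt.1 hp)
    have h2 : ‖p.2‖ ≤ 3 / 4 := (norm_snd_le p).trans (not_lt.1 hp)
    have : p ∈ halfCyl N ↔ p ∈ quarter N := by
      rw [Real.norm_eq_abs, abs_le] at h1
      constructor
      · rintro ⟨h3, -, h4⟩; exact ⟨h3.2, h4⟩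
      · rintro ⟨h3, h4⟩
        refine ⟨⟨by linarith, h3⟩, ?_, h4⟩
        rw [mem_ball, dist_zero_right]; linarith
    by_cases hq : p ∈ quarter N
    · rw [indicator_of_mem hq, indicator_of_mem (this.2 hq)]
    · rw [indicator_of_notMem hq, indicator_of_notMem fun h => hq (this.1 h)]

theorem Cut.integrable {f : smoothAlg d} (hf : Cut f) : Integrable f.1 :=
  (smoothAlg_continuous f).integrable_of_hasCompactSupport hf.hasCompactSupport

theorem isAddHaarMeasure_volume_prod :
    (volume : Measure (ℝ × EuclideanSpace ℝ (Fin d))).IsAddHaarMeasure := by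
  rw [Measure.volume_eq_prod]
  infer_instance

theorem hasDerivAt_line (f : smoothAlg d) (x e : ℝ × EuclideanSpace ℝ (Fin d)) (s : ℝ) :
    HasDerivAt (fun s : ℝ => f.1 (x + s • e)) ((dirDer e f).1 (x + s • e)) s := by
  have h1 : HasDerivAt (fun s : ℝ => x + s • e) e s := by
    simpa using ((hasDerivAt_id s).smul_const e).const_add x
  exact (smoothAlg_differentiable f _).hasFDerivAt.comp_hasDerivAt s h1

theorem contDiff_line (f : smoothAlg d) (x e : ℝ × EuclideanSpace ℝ (Fin d)) :
    ContDiff ℝ (⊤ : ℕ∞) (fun s : ℝ => f.1 (x + s • e)) :=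
  (smoothAlg_contDiff f).comp (contDiff_const.add (contDiff_id.smul contDiff_const))

theorem Cut.hasCompactSupport_line {f : smoothAlg d} (hf : Cut f)
    (x : ℝ × EuclideanSpace ℝ (Fin d)) {e : ℝ × EuclideanSpace ℝ (Fin d)} (he : e ≠ 0) :
    HasCompactSupport (fun s : ℝ => f.1 (x + s • e)) := by
  have hne : 0 < ‖e‖ := norm_pos_iff.2 he
  refine HasCompactSupport.intro (isCompact_closedBall (0 : ℝ) ((1 + ‖x‖) / ‖e‖)) fun s hs => ?_
  refine hf.eq_zero ?_
  rw [mem_closedBall, dist_zero_right, not_le, div_lt_iff₀ hne, ← norm_smul] at hs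
  have : ‖s • e‖ ≤ ‖x + s • e‖ + ‖x‖ := by
    simpa using norm_sub_le (x + s • e) x
  linarith

theorem deriv_line (f : smoothAlg d) (x e : ℝ × EuclideanSpace ℝ (Fin d)) :
    deriv (fun s : ℝ => f.1 (x + s • e)) = fun s => (dirDer e f).1 (x + s • e) :=
  funext fun s => (hasDerivAt_line f x e s).deriv

/-- The coordinate functional `x_i` on space-time. -/
def spCoord (i : Fin d) : (ℝ × EuclideanSpace ℝ (Fin d)) →L[ℝ] ℝ :=
  (EuclideanSpace.proj i).comp (ContinuousLinearMap.snd ℝ ℝ _)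

theorem spCoord_single (i : Fin d) :
    spCoord i ((0 : ℝ), EuclideanSpace.single i (1 : ℝ)) = 1 := by
  simp [spCoord]

/-- No boundary term appears when integrating a tangential derivative, or the normal derivative
of a function vanishing on the flat boundary. -/
theorem Cut.intU_spD_eq_zero {N i : Fin d} {f : smoothAlg d} (hf : Cut f)
    (h : i ≠ N ∨ ∀ p ∈ flatBdry N, f.1 p = 0) : intU N (_root_.spD i f) = 0 := by
  have hne : ((0 : ℝ), EuclideanSpace.single i (1 : ℝ)) ≠ 0 := by
    intro h0
    have := spCoord_single i
    rw [h0, map_zero] at this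
    exact zero_ne_one this
  rw [(hf.spD i).intU_eq]
  have := isAddHaarMeasure_volume_prod (d := d)
  refine integral_eq_zero_of_lines volume (spCoord i) (spCoord_single i)
    ((hf.spD i).integrable.indicator (measurableSet_quarter N)) fun x => ?_
  have hc := hf.hasCompactSupport_line x hne
  have hcd := (contDiff_line f x ((0 : ℝ), EuclideanSpace.single i (1 : ℝ))).of_le
    (m := 1) (by simp)
  have hx1 : ∀ s : ℝ, (x + s • ((0 : ℝ), EuclideanSpace.single i (1 : ℝ))).1 = x.1 := by
    intro s; simp
  by_cases hi : i = N
  · subst hi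
    have hx2 : ∀ s : ℝ, (x + s • ((0 : ℝ), EuclideanSpace.single i (1 : ℝ))).2 i = x.2 i + s := by
      intro s; simp
    by_cases ht : x.1 < 0
    · have : ∀ s : ℝ, (quarter i).indicator (_root_.spD i f).1
          (x + s • ((0 : ℝ), EuclideanSpace.single i (1 : ℝ))) =
          (Ioi (- x.2 i)).indicator (deriv (fun s : ℝ =>
            f.1 (x + s • ((0 : ℝ), EuclideanSpace.single i (1 : ℝ))))) s := by
        intro s
        rw [deriv_line]
        simp only [indicator_apply, quarter, mem_ofPred_eq, hx1, hx2, ht, true_and, mem_Ioi,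
          neg_lt_iff_pos_add']
        rfl
      simp only [this]
      rw [integral_indicator measurableSet_Ioi, hc.integral_Ioi_deriv_eq hcd, neg_eq_zero]
      set q := x + (- x.2 i) • ((0 : ℝ), EuclideanSpace.single i (1 : ℝ)) with hq
      have hq1 : q.1 = x.1 := hx1 _
      have hq2 : q.2 i = 0 := by rw [hq, hx2]; ring
      by_cases hqn : 3 / 4 < ‖q‖
      · exact hf.eq_zero hqn
      · have h1 : ‖q.1‖ ≤ 3 / 4 := (norm_fst_le q).trans (not_lt.1 hqn)
        have h2 : ‖q.2‖ ≤ 3 / 4 := (norm_snd_le q).trans (not_lt.1 hqn)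
        rw [Real.norm_eq_abs, abs_le] at h1
        refine (h.resolve_left (by simp)) q ⟨⟨by linarith, by linarith⟩, ?_, hq2⟩
        rw [mem_ball, dist_zero_right]; linarith
    · simp only [indicator_apply, quarter, mem_ofPred_eq, hx1, ht, false_and, if_false,
        integral_zero]
  · have hx2 : ∀ s : ℝ, (x + s • ((0 : ℝ), EuclideanSpace.single i (1 : ℝ))).2 N = x.2 N := by
      intro s; simp [Ne.symm hi]
    by_cases hp : x ∈ quarter N
    · have : ∀ s : ℝ, (quarter N).indicator (_root_.spD i f).1
          (x + s • ((0 : ℝ), EuclideanSpace.single i (1 : ℝ))) =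
          deriv (fun s : ℝ => f.1 (x + s • ((0 : ℝ), EuclideanSpace.single i (1 : ℝ)))) s := by
        intro s
        rw [deriv_line, indicator_of_mem]
        · rfl
        · exact ⟨by rw [hx1]; exact hp.1, by rw [hx2]; exact hp.2⟩
      simp only [this]
      exact integral_eq_zero_of_hasDerivAt_of_integrable
        (fun s => (hcd.differentiable (by simp) s).hasDerivAt)
        ((hcd.continuous_deriv (by simp)).integrable_of_hasCompactSupport hc.deriv)
        (hcd.continuous.integrable_of_hasCompactSupport hc)
    · have : ∀ s : ℝ, (quarter N).indicator (_root_.spD i f).1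
          (x + s • ((0 : ℝ), EuclideanSpace.single i (1 : ℝ))) = 0 := by
        intro s
        refine indicator_of_notMem (fun h3 => hp ?_) _
        have h4 := h3.1
        have h5 := h3.2
        rw [hx1] at h4
        rw [hx2] at h5
        exact ⟨h4, h5⟩
      simp only [this, integral_zero]

theorem Cut.intU_tmD_nonneg {N : Fin d} {f : smoothAlg d} (hf : Cut f) (h : ∀ p, 0 ≤ f.1 p) :
    0 ≤ intU N (tmD f) := by
  have hne : ((1 : ℝ), (0 : EuclideanSpace ℝ (Fin d))) ≠ 0 := by simp
  have hD : Cut (tmD f) := hf.dirDer _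
  rw [hD.intU_eq]
  have := isAddHaarMeasure_volume_prod (d := d)
  refine integral_nonneg_of_lines volume (ContinuousLinearMap.fst ℝ ℝ _)
    (e := ((1 : ℝ), (0 : EuclideanSpace ℝ (Fin d)))) (by simp)
    (hD.integrable.indicator (measurableSet_quarter N)) fun x => ?_
  have hc := hf.hasCompactSupport_line x hne
  have hcd := (contDiff_line f x ((1 : ℝ), (0 : EuclideanSpace ℝ (Fin d)))).of_le
    (m := 1) (by simp)
  have hx1 : ∀ s : ℝ, (x + s • ((1 : ℝ), (0 : EuclideanSpace ℝ (Fin d)))).1 = x.1 + s := by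
    intro s; simp
  have hx2 : ∀ s : ℝ, (x + s • ((1 : ℝ), (0 : EuclideanSpace ℝ (Fin d)))).2 N = x.2 N := by
    intro s; simp
  by_cases hN : 0 < x.2 N
  · have : ∀ s : ℝ, (quarter N).indicator (tmD f).1
        (x + s • ((1 : ℝ), (0 : EuclideanSpace ℝ (Fin d)))) =
        (Iio (- x.1)).indicator (deriv (fun s : ℝ =>
          f.1 (x + s • ((1 : ℝ), (0 : EuclideanSpace ℝ (Fin d)))))) s := by
      intro s
      rw [deriv_line]
      have h3 : x.1 + s < 0 ↔ s < - x.1 := by constructor <;> intro <;> linarith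
      simp only [indicator_apply, quarter, mem_ofPred_eq, hx1, hx2, hN, and_true, mem_Iio, h3]
      rfl
    simp only [this]
    rw [integral_indicator measurableSet_Iio, ← integral_Iic_eq_integral_Iio,
      hc.integral_Iic_deriv_eq hcd]
    exact h _
  · simp only [indicator_apply, quarter, mem_ofPred_eq, hx2, hN, and_false, if_false,
      integral_zero, le_refl]

/-- All space derivatives of order less than `k` vanish on the flat boundary. -/
def Van (N : Fin d) : ℕ → smoothAlg d → Prop
  | 0, _ => True
  | k + 1, f => (∀ p ∈ flatBdry N, f.1 p = 0) ∧ ∀ i, Van N k (spD i f)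

variable {N : Fin d}

theorem Van.pred {k : ℕ} {f : smoothAlg d} (h : Van N (k + 1) f) : Van N k f := by
  induction k generalizing f with
  | zero => trivial
  | succ k ih => exact ⟨h.1, fun i => ih (h.2 i)⟩

theorem Van.mono {k l : ℕ} (hkl : l ≤ k) {f : smoothAlg d} (h : Van N k f) : Van N l f := by
  induction k, hkl using Nat.le_induction with
  | base => exact h
  | succ k _ ih => exact ih h.pred

theorem Van.add {k : ℕ} {f g : smoothAlg d} (hf : Van N k f) (hg : Van N k g) :
    Van N k (f + g) := by
  induction k generalizing f g with
  | zero => trivial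
  | succ k ih =>
    refine ⟨fun p hp => ?_, fun i => ?_⟩
    · have h1 := hf.1 p hp
      have h2 := hg.1 p hp
      simp [h1, h2]
    · rw [map_add]; exact ih (hf.2 i) (hg.2 i)

theorem Van.mul_left {k : ℕ} {f : smoothAlg d} (hf : Van N k f) (g : smoothAlg d) :
    Van N k (g * f) := by
  induction k generalizing f g with
  | zero => trivial
  | succ k ih =>
    refine ⟨fun p hp => ?_, fun i => ?_⟩
    · have h1 := hf.1 p hp
      simp [h1]
    · rw [Derivation.leibniz, smul_eq_mul, smul_eq_mul, mul_comm f]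
      exact (ih (hf.2 i) g).add (ih hf.pred _)

theorem Van.multiD {k : ℕ} (γ : Fin d → ℕ) {f : smoothAlg d} (hf : Van N (k + ∑ i, γ i) f) :
    Van N k (multiD γ f) := by
  induction γ using multiIndex_induction generalizing k with
  | h0 => rw [multiD_zero]; simpa using hf
  | hs γ i ih =>
    rw [← spD_multiD]
    rw [sum_add_single] at hf
    have h1 : Van N (k + 1) (_root_.multiD γ f) := ih (by
      rwa [show k + 1 + ∑ i, γ i = k + (∑ i, γ i + 1) by ring])
    exact h1.2 i

theorem dirDer_eq_zero_of_tangential {e : ℝ × EuclideanSpace ℝ (Fin d)} (he : e.2 N = 0)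
    {f : smoothAlg d} (hf : ∀ p ∈ flatBdry N, f.1 p = 0) :
    ∀ p ∈ flatBdry N, (dirDer e f).1 p = 0 := by
  intro p hp
  have h1 := hasDerivAt_line f p e 0
  simp only [zero_smul, add_zero] at h1
  have hc : Continuous fun s : ℝ => p + s • e := by fun_prop
  have ho : IsOpen (Ioo (-1 : ℝ) 0 ×ˢ (ball (0 : EuclideanSpace ℝ (Fin d)) 1)) :=
    isOpen_Ioo.prod isOpen_ball
  have h2 : ∀ᶠ s : ℝ in 𝓝 0, p + s • e ∈ Ioo (-1 : ℝ) 0 ×ˢ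
      (ball (0 : EuclideanSpace ℝ (Fin d)) 1) := by
    refine hc.continuousAt.eventually (ho.mem_nhds ?_)
    simpa using ⟨hp.1, by simpa using hp.2.1⟩
  have h3 : (fun s : ℝ => f.1 (p + s • e)) =ᶠ[𝓝 0] fun _ => 0 := by
    filter_upwards [h2] with s hs
    refine hf _ ⟨hs.1, hs.2, ?_⟩
    have : p.2 N = 0 := hp.2.2
    simp [this, he]
  exact h1.unique ((hasDerivAt_const (0 : ℝ) (0 : ℝ)).congr_of_eventuallyEq h3)

theorem Van.dirDer {k : ℕ} {f : smoothAlg d} (hf : Van N k f)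
    {e : ℝ × EuclideanSpace ℝ (Fin d)} (he : e.2 N = 0) : Van N k (dirDer e f) := by
  induction k generalizing f with
  | zero => trivial
  | succ k ih =>
    refine ⟨dirDer_eq_zero_of_tangential he hf.1, fun i => ?_⟩
    rw [_root_.spD, dirDer_comm]
    exact ih (hf.2 i)

theorem Van.spD {k : ℕ} {f : smoothAlg d} (hf : Van N k f) {i : Fin d} (hi : i ≠ N) :
    Van N k (spD i f) :=
  hf.dirDer (by simp [Ne.symm hi])

theorem Van.tmD {k : ℕ} {f : smoothAlg d} (hf : Van N k f) : Van N k (tmD f) :=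
  hf.dirDer (by simp)

theorem van_of_normal {k : ℕ} {f : smoothAlg d}
    (h : ∀ l < k, ∀ p ∈ flatBdry N, ((spD N)^[l] f).1 p = 0) : Van N k f := by
  induction k generalizing f with
  | zero => trivial
  | succ k ih =>
    refine ⟨h 0 (by omega), fun i => ih fun l hl => ?_⟩
    by_cases hi : i = N
    · subst hi
      exact h (l + 1) (by omega)
    · have : (spD N)^[l] (spD i f) = spD i ((spD N)^[l] f) := by
        rw [← multiD_single, ← multiD_single, multiD_spD, spD_multiD]
      rw [this]
      exact dirDer_eq_zero_of_tangential (by simp [Ne.symm hi]) (h l (by omega))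

theorem intU_mul_spD {f : smoothAlg d} (hf : Cut f) {i : Fin d}
    (h : i ≠ N ∨ ∀ p ∈ flatBdry N, f.1 p = 0) (g : smoothAlg d) :
    intU N (f * spD i g) = - intU N (spD i f * g) := by
  have h1 := (hf.mul_right g).intU_spD_eq_zero (N := N) (i := i)
    (h.imp id fun h p hp => by simp [h p hp])
  rw [Derivation.leibniz, smul_eq_mul, smul_eq_mul, map_add, mul_comm g] at h1
  linarith

/-- Iterated integration by parts. -/
theorem intU_mul_multiD (γ : Fin d → ℕ) {f : smoothAlg d} (hf : Cut f)
    (hv : Van N (∑ i, γ i) f) (g : smoothAlg d) :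
    intU N (f * multiD γ g) = (-1) ^ (∑ i, γ i) * intU N (multiD γ f * g) := by
  induction γ using multiIndex_induction generalizing f with
  | h0 => simp [multiD_zero]
  | hs γ i ih =>
    rw [sum_add_single] at hv ⊢
    rw [← spD_multiD, intU_mul_spD hf (Or.inr hv.1), ih (hf.spD i) (hv.2 i), multiD_spD]
    ring

variable (d) in
/-- A smooth cutoff function. -/
def chiBump : ContDiffBump (0 : ℝ × EuclideanSpace ℝ (Fin d)) :=
  ⟨1 / 2, 3 / 4, by norm_num, by norm_num⟩

variable (d) in
/-- A smooth cutoff function, as an element of the algebra of smooth functions. -/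
def chi : smoothAlg d := ⟨fun p => chiBump d p, (chiBump d).contDiff⟩

theorem chi_nonneg (p : ℝ × EuclideanSpace ℝ (Fin d)) : 0 ≤ (chi d).1 p := (chiBump d).nonneg

theorem chi_eq_one {p : ℝ × EuclideanSpace ℝ (Fin d)} (hp : ‖p‖ ≤ 1 / 2) : (chi d).1 p = 1 :=
  (chiBump d).one_of_mem_closedBall (by simpa [chiBump] using hp)

theorem cut_chi : Cut (chi d) := (chiBump d).tsupport_eq.subset

theorem cut_chi_pow {k : ℕ} (hk : 1 ≤ k) (f : smoothAlg d) : Cut (chi d ^ k * f) := by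
  obtain ⟨l, rfl⟩ : ∃ l, k = l + 1 := ⟨k - 1, by omega⟩
  rw [pow_succ', mul_assoc]
  exact cut_chi.mul_right _

end HalfCylinder

noncomputable section Plancherel

open FourierTransform SchwartzMap

section General

variable {V : Type*} [NormedAddCommGroup V] [InnerProductSpace ℝ V] [FiniteDimensional ℝ V]
  [MeasurableSpace V] [BorelSpace V]

/-- On `L¹ ∩ L²` the `L²` Fourier transform is given by the Fourier integral. -/
theorem fourier_toLp_ae_eq {f : V → ℂ} (hf : Integrable f) (hf2 : MemLp f 2) :
    (𝓕 (hf2.toLp f) : Lp ℂ 2 (volume : Measure V)) =ᵐ[volume] fun ξ => 𝓕 f ξ := by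
  have hcont : Continuous (fun ξ => 𝓕 f ξ) :=
    VectorFourier.fourierIntegral_continuous Real.continuous_fourierChar
      (innerSL ℝ).continuous₂ hf
  refine ae_eq_of_integral_contDiff_smul_eq
    ((Lp.memLp _).locallyIntegrable (by norm_num)) hcont.locallyIntegrable ?_
  intro g hg hgc
  have hg₁ : HasCompactSupport (Complex.ofRealCLM ∘ g) := hgc.comp_left rfl
  have hg₂ : ContDiff ℝ (⊤ : ℕ∞) (Complex.ofRealCLM ∘ g) := by fun_prop
  set G : 𝓢(V, ℂ) := hg₁.toSchwartzMap hg₂ with hG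
  have h1 : ∫ x, g x • (𝓕 (hf2.toLp f) : Lp ℂ 2 (volume : Measure V)) x =
      ((𝓕 (hf2.toLp f) : Lp ℂ 2 (volume : Measure V)) : 𝓢'(V, ℂ)) G := by
    rw [Lp.toTemperedDistribution_apply]
    simp [hG]
  have h2 : ∫ x, g x • 𝓕 f x = ∫ x, G x • 𝓕 f x := by simp [hG]
  rw [h1, h2, ← Lp.fourier_toTemperedDistribution_eq, TemperedDistribution.fourier_apply,
    Lp.toTemperedDistribution_apply]
  have h3 : ∫ x, (𝓕 G) x • (hf2.toLp f : Lp ℂ 2 (volume : Measure V)) x = ∫ x, (𝓕 G) x • f x := by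
    refine integral_congr_ae ?_
    filter_upwards [hf2.coeFn_toLp] with x hx
    rw [hx]
  rw [h3]
  have := VectorFourier.integral_fourierIntegral_smul_eq_flip (μ := volume) (ν := volume)
    (L := innerₗ V) (f := fun x => G x) (g := f) Real.continuous_fourierChar
    (innerSL ℝ).continuous₂ G.integrable hf
  rw [flip_innerₗ] at this
  exact this

/-- Plancherel's identity on `L¹ ∩ L²`. -/
theorem integral_inner_fourier {f g : V → ℂ} (hf : Integrable f) (hf2 : MemLp f 2)
    (hg : Integrable g) (hg2 : MemLp g 2) :
    Integrable (fun ξ => inner ℂ (𝓕 f ξ) (𝓕 g ξ)) ∧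
      ∫ ξ, inner ℂ (𝓕 f ξ) (𝓕 g ξ) = ∫ x, inner ℂ (f x) (g x) := by
  have h1 := Lp.inner_fourier_eq (hf2.toLp f) (hg2.toLp g)
  have h2 := L2.integrable_inner (𝕜 := ℂ)
    (𝓕 (hf2.toLp f) : Lp ℂ 2 (volume : Measure V)) (𝓕 (hg2.toLp g))
  rw [L2.inner_def, L2.inner_def] at h1
  have h3 : (fun ξ => inner ℂ ((𝓕 (hf2.toLp f) : Lp ℂ 2 (volume : Measure V)) ξ)
      ((𝓕 (hg2.toLp g) : Lp ℂ 2 (volume : Measure V)) ξ)) =ᵐ[volume]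
      fun ξ => inner ℂ (𝓕 f ξ) (𝓕 g ξ) := by
    filter_upwards [fourier_toLp_ae_eq hf hf2, fourier_toLp_ae_eq hg hg2] with x hx hy
    rw [hx, hy]
  refine ⟨h2.congr h3, ?_⟩
  rw [← integral_congr_ae h3, h1]
  refine integral_congr_ae ?_
  filter_upwards [hf2.coeFn_toLp, hg2.coeFn_toLp] with x hx hy
  rw [hx, hy]

end General

section HalfSpace

variable {d : ℕ} {N : Fin d}

/-- The half space `x_N > 0`. -/
def halfSp (N : Fin d) : Set (EuclideanSpace ℝ (Fin d)) := {x | 0 < x N}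

theorem measurableSet_halfSp (N : Fin d) : MeasurableSet (halfSp N) :=
  (isOpen_lt continuous_const (continuous_coord N)).measurableSet

theorem hasCompactSupport_comp_line {G : Type*} [NormedAddCommGroup G]
    {g : EuclideanSpace ℝ (Fin d) → G}
    (hg : HasCompactSupport g) (x : EuclideanSpace ℝ (Fin d)) {e : EuclideanSpace ℝ (Fin d)}
    (he : e ≠ 0) : HasCompactSupport fun s : ℝ => g (x + s • e) := by
  obtain ⟨R, hR⟩ := hg.isBounded.subset_closedBall 0
  have hne : 0 < ‖e‖ := norm_pos_iff.2 he
  refine HasCompactSupport.intro (isCompact_closedBall (0 : ℝ) ((R + ‖x‖) / ‖e‖)) fun s hs => ?_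
  by_contra h0
  have h1 := hR (subset_tsupport _ h0)
  rw [mem_closedBall, dist_zero_right] at h1
  rw [mem_closedBall, dist_zero_right, not_le, div_lt_iff₀ hne, ← norm_smul] at hs
  have : ‖s • e‖ ≤ ‖x + s • e‖ + ‖x‖ := by simpa using norm_sub_le (x + s • e) x
  linarith

/-- The integral of a derivative over the half space vanishes in the absence of boundary terms. -/
theorem integral_halfSp_deriv_eq_zero {g g' : EuclideanSpace ℝ (Fin d) → ℂ} {k : Fin d}
    (hgc : HasCompactSupport g) (hg'c : HasCompactSupport g') (hg' : Continuous g')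
    (hd : ∀ x (s : ℝ), HasDerivAt (fun s : ℝ => g (x + s • EuclideanSpace.single k (1 : ℝ)))
      (g' (x + s • EuclideanSpace.single k (1 : ℝ))) s)
    (h : ∀ x, x N = 0 → g x = 0) : ∫ x, (halfSp N).indicator g' x = 0 := by
  have hne : EuclideanSpace.single k (1 : ℝ) ≠ 0 := by simp
  refine integral_eq_zero_of_lines volume (EuclideanSpace.proj (𝕜 := ℝ) k)
    (e := EuclideanSpace.single k (1 : ℝ)) (by simp)
    ((hg'.integrable_of_hasCompactSupport hg'c).indicator (measurableSet_halfSp N)) fun x => ?_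
  have hc := hasCompactSupport_comp_line hgc x hne
  have hder : deriv (fun s : ℝ => g (x + s • EuclideanSpace.single k (1 : ℝ))) =
      fun s => g' (x + s • EuclideanSpace.single k (1 : ℝ)) := funext fun s => (hd x s).deriv
  have hcd : ContDiff ℝ 1 (fun s : ℝ => g (x + s • EuclideanSpace.single k (1 : ℝ))) := by
    rw [contDiff_one_iff_deriv, hder]
    exact ⟨fun s => (hd x s).differentiableAt, hg'.comp (by fun_prop)⟩
  by_cases hk : k = N
  · subst hk
    have h2 : ∀ s : ℝ, (halfSp k).indicator g' (x + s • EuclideanSpace.single k (1 : ℝ)) =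
        (Ioi (- x k)).indicator
          (deriv (fun s : ℝ => g (x + s • EuclideanSpace.single k (1 : ℝ)))) s := by
      intro s
      rw [hder]
      simp only [indicator_apply, halfSp, mem_ofPred_eq, mem_Ioi, neg_lt_iff_pos_add']
      simp
    simp only [h2]
    rw [integral_indicator measurableSet_Ioi, hc.integral_Ioi_deriv_eq hcd, neg_eq_zero]
    exact h _ (by simp)
  · have hx2 : ∀ s : ℝ, (x + s • EuclideanSpace.single k (1 : ℝ)) N = x N := by
      intro s; simp [Ne.symm hk]
    by_cases hp : x ∈ halfSp N
    · have : ∀ s : ℝ, (halfSp N).indicator g' (x + s • EuclideanSpace.single k (1 : ℝ)) =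
          deriv (fun s : ℝ => g (x + s • EuclideanSpace.single k (1 : ℝ))) s := by
        intro s
        rw [hder, indicator_of_mem]
        rw [halfSp, mem_ofPred_eq, hx2]; exact hp
      simp only [this]
      exact integral_eq_zero_of_hasDerivAt_of_integrable
        (fun s => (hcd.differentiable (by simp) s).hasDerivAt)
        ((hcd.continuous_deriv (by simp)).integrable_of_hasCompactSupport hc.deriv)
        (hcd.continuous.integrable_of_hasCompactSupport hc)
    · have : ∀ s : ℝ, (halfSp N).indicator g' (x + s • EuclideanSpace.single k (1 : ℝ)) = 0 := by
        intro s
        refine indicator_of_notMem (fun h3 => hp ?_) _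
        rw [halfSp, mem_ofPred_eq, hx2] at h3
        exact h3
      simp only [this, integral_zero]

/-- The zero extension of the restriction of a real function to the half space. -/
def zeroExt (N : Fin d) (f : EuclideanSpace ℝ (Fin d) → ℝ) : EuclideanSpace ℝ (Fin d) → ℂ :=
  (halfSp N).indicator fun x => (f x : ℂ)

theorem integrable_zeroExt {f : EuclideanSpace ℝ (Fin d) → ℝ} (hf : Continuous f)
    (hc : HasCompactSupport f) : Integrable (zeroExt N f) :=
  ((Complex.continuous_ofReal.comp hf).integrable_of_hasCompactSupport
    (hc.comp_left rfl)).indicator (measurableSet_halfSp N)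

theorem memLp_zeroExt {f : EuclideanSpace ℝ (Fin d) → ℝ} (hf : Continuous f)
    (hc : HasCompactSupport f) : MemLp (zeroExt N f) 2 :=
  ((Complex.continuous_ofReal.comp hf).memLp_of_hasCompactSupport
    (hc.comp_left rfl)).indicator (measurableSet_halfSp N)

open Complex in
theorem fourier_zeroExt_deriv {f f' : EuclideanSpace ℝ (Fin d) → ℝ} {k : Fin d}
    (hf : Continuous f) (hc : HasCompactSupport f) (hf' : Continuous f')
    (hc' : HasCompactSupport f')
    (hd : ∀ x (s : ℝ), HasDerivAt (fun s : ℝ => f (x + s • EuclideanSpace.single k (1 : ℝ)))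
      (f' (x + s • EuclideanSpace.single k (1 : ℝ))) s)
    (h : ∀ x, x N = 0 → f x = 0) (ξ : EuclideanSpace ℝ (Fin d)) :
    𝓕 (zeroExt N f') ξ = (2 * Real.pi * I * ξ k) * 𝓕 (zeroExt N f) ξ := by
  set E : EuclideanSpace ℝ (Fin d) → ℂ := fun x => cexp (((-2 * Real.pi * inner ℝ x ξ : ℝ) : ℂ) * I)
    with hE
  have hEc : Continuous E := by fun_prop
  have hE' : ∀ x (s : ℝ), HasDerivAt (fun s : ℝ => E (x + s • EuclideanSpace.single k (1 : ℝ)))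
      (-(2 * Real.pi * I * ξ k) * E (x + s • EuclideanSpace.single k (1 : ℝ))) s := by
    intro x s
    have h1 : HasDerivAt (fun s : ℝ => (-2 * Real.pi *
        inner ℝ (x + s • EuclideanSpace.single k (1 : ℝ)) ξ : ℝ)) (-2 * Real.pi * ξ k) s := by
      have : (fun s : ℝ => (-2 * Real.pi *
        inner ℝ (x + s • EuclideanSpace.single k (1 : ℝ)) ξ : ℝ)) =
        fun s => -2 * Real.pi * (inner ℝ x ξ + s * ξ k) := by
        ext s
        rw [inner_add_left, inner_smul_left, EuclideanSpace.inner_single_left]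
        simp
      rw [this]
      have := (((hasDerivAt_id s).mul_const (ξ k)).const_add (inner ℝ x ξ)).const_mul
        (-2 * Real.pi)
      simpa using this
    have h2 := (h1.ofReal_comp.mul_const I).cexp
    convert h2 using 1
    simp only [hE]
    push_cast
    ring
  have key := integral_halfSp_deriv_eq_zero (N := N) (k := k) (g := fun x => E x * f x)
    (g' := fun x => E x * f' x - 2 * Real.pi * I * ξ k * (E x * f x))
    (HasCompactSupport.mul_left (hc.comp_left (g := ((↑) : ℝ → ℂ)) rfl))
    ((HasCompactSupport.mul_left (hc'.comp_left (g := ((↑) : ℝ → ℂ)) rfl)).sub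
      (HasCompactSupport.mul_left
        (HasCompactSupport.mul_left (hc.comp_left (g := ((↑) : ℝ → ℂ)) rfl))))
    (by fun_prop) (fun x s => ?_) (fun x hx => by simp [h x hx])
  · rw [Real.fourier_eq', Real.fourier_eq', ← integral_const_mul]
    rw [← sub_eq_zero, ← integral_sub]
    · rw [← key]
      congr 1
      ext x
      by_cases hx : x ∈ halfSp N
      · simp only [zeroExt, indicator_of_mem hx, hE, smul_eq_mul]
      · simp only [zeroExt, indicator_of_notMem hx, smul_zero, mul_zero, sub_zero]
    · have := (Real.fourierIntegral_convergent_iff ξ).2 (integrable_zeroExt (N := N) hf' hc')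
      simp only [Real.fourierChar_apply, Circle.smul_def] at this
      convert! this using 3
      push_cast
      ring_nf
    · refine Integrable.const_mul ?_ _
      have := (Real.fourierIntegral_convergent_iff ξ).2 (integrable_zeroExt (N := N) hf hc)
      simp only [Real.fourierChar_apply, Circle.smul_def] at this
      convert! this using 3
      push_cast
      ring_nf
  · convert! (hE' x s).mul (hd x s).ofReal_comp using 1
    ring

theorem mem_MIdx {k : ℕ} {γ : Fin d → ℕ} : γ ∈ MIdx d k ↔ ∑ i, γ i = k := by
  simp only [MIdx, Finset.mem_filter, Fintype.mem_piFinset, Finset.mem_range]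
  refine ⟨fun h => h.2, fun h => ⟨fun i => ?_, h⟩⟩
  have := Finset.single_le_sum (f := γ) (fun i _ => Nat.zero_le _) (Finset.mem_univ i)
  omega

theorem sq_prod_pow_le {k : ℕ} {γ : Fin d → ℕ} (hγ : ∑ i, γ i = k) (η : Fin d → ℝ) :
    (∏ i, η i ^ γ i) ^ 2 ≤ (∑ i, η i ^ 2) ^ k := by
  rw [← hγ, ← Finset.prod_pow_eq_pow_sum, ← Finset.prod_pow]
  refine Finset.prod_le_prod (fun i _ => sq_nonneg _) fun i _ => ?_
  rw [← pow_mul, mul_comm, pow_mul]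
  exact pow_le_pow_left₀ (sq_nonneg _)
    (Finset.single_le_sum (f := fun i => η i ^ 2) (fun i _ => sq_nonneg _) (Finset.mem_univ i)) _

/-- The algebraic form of the Gårding inequality, on the Fourier side. -/
theorem LegHad.le_sum_re {n m : ℕ} {lam : ℝ} {B : (Fin d → ℕ) → (Fin d → ℕ) → Fin n → Fin n → ℝ}
    (hlam : 0 ≤ lam) (hB : LegHad d n m lam B) (η : Fin d → ℝ) (z : Fin n → ℂ) (c : ℂ) :
    lam * ∑ i, ∑ γ ∈ MIdx d m, ‖(c * ∏ k, (η k : ℂ) ^ γ k) * z i‖ ^ 2 ≤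
      (MIdx d m).card * ∑ α ∈ MIdx d m, ∑ β ∈ MIdx d m, ∑ i, ∑ j, B α β i j *
        (inner ℂ ((c * ∏ k, (η k : ℂ) ^ α k) * z i) ((c * ∏ k, (η k : ℂ) ^ β k) * z j)).re := by
  have e1 : ∀ (i j : Fin n) (α β : Fin d → ℕ), (inner ℂ ((c * ∏ k, (η k : ℂ) ^ α k) * z i)
      ((c * ∏ k, (η k : ℂ) ^ β k) * z j)).re =
      ‖c‖ ^ 2 * (((z i).re * (z j).re + (z i).im * (z j).im) *
        ((∏ k, η k ^ α k) * ∏ k, η k ^ β k)) := by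
    intro i j α β
    have h1 : ∀ α : Fin d → ℕ, ∏ k, (η k : ℂ) ^ α k = ((∏ k, η k ^ α k : ℝ) : ℂ) := by
      intro α; push_cast; rfl
    rw [h1, h1, ← Complex.normSq_eq_norm_sq, Complex.normSq_apply]
    simp only [RCLike.inner_apply, map_mul, Complex.conj_ofReal, Complex.mul_re, Complex.mul_im,
      Complex.conj_re, Complex.conj_im, Complex.ofReal_re, Complex.ofReal_im]
    ring
  have e2 : ∀ i (γ : Fin d → ℕ), ‖(c * ∏ k, (η k : ℂ) ^ γ k) * z i‖ ^ 2 =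
      ‖c‖ ^ 2 * (((z i).re ^ 2 + (z i).im ^ 2) * (∏ k, η k ^ γ k) ^ 2) := by
    intro i γ
    have := e1 i i γ γ
    rw [inner_self_eq_norm_sq_to_K] at this
    have h2 : ((‖(c * ∏ k, (η k : ℂ) ^ γ k) * z i‖ : ℂ) ^ 2).re =
      ‖(c * ∏ k, (η k : ℂ) ^ γ k) * z i‖ ^ 2 := by norm_cast
    rw [← h2]
    refine this.trans ?_
    ring
  have h1 := hB (fun i => (z i).re) η
  have h2 := hB (fun i => (z i).im) η
  have h3 : ∑ i, ∑ γ ∈ MIdx d m, ‖(c * ∏ k, (η k : ℂ) ^ γ k) * z i‖ ^ 2 ≤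
      ‖c‖ ^ 2 * ((MIdx d m).card *
        ((∑ i, (z i).re ^ 2 + ∑ i, (z i).im ^ 2) * (∑ k, η k ^ 2) ^ m)) := by
    simp only [e2, ← Finset.mul_sum]
    refine mul_le_mul_of_nonneg_left ?_ (sq_nonneg _)
    rw [← Finset.sum_add_distrib, Finset.sum_mul, Finset.mul_sum]
    refine Finset.sum_le_sum fun i _ => ?_
    have : ∑ γ ∈ MIdx d m, (∏ k, η k ^ γ k) ^ 2 ≤ (MIdx d m).card * (∑ k, η k ^ 2) ^ m := by
      rw [← nsmul_eq_mul]
      exact Finset.sum_le_card_nsmul _ _ _ fun γ hγ => sq_prod_pow_le (mem_MIdx.1 hγ) η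
    calc _ ≤ ((z i).re ^ 2 + (z i).im ^ 2) * ((MIdx d m).card * (∑ k, η k ^ 2) ^ m) :=
          mul_le_mul_of_nonneg_left this (by positivity)
      _ = _ := by ring
  refine (mul_le_mul_of_nonneg_left h3 hlam).trans ?_
  simp only [e1]
  have h4 : ∑ α ∈ MIdx d m, ∑ β ∈ MIdx d m, ∑ i, ∑ j, B α β i j *
      (‖c‖ ^ 2 * (((z i).re * (z j).re + (z i).im * (z j).im) *
        ((∏ k, η k ^ α k) * ∏ k, η k ^ β k))) =
      ‖c‖ ^ 2 * ((∑ α ∈ MIdx d m, ∑ β ∈ MIdx d m, ∑ i, ∑ j,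
        B α β i j * (z i).re * (z j).re * ((∏ k, η k ^ α k) * ∏ k, η k ^ β k)) +
      ∑ α ∈ MIdx d m, ∑ β ∈ MIdx d m, ∑ i, ∑ j,
        B α β i j * (z i).im * (z j).im * ((∏ k, η k ^ α k) * ∏ k, η k ^ β k)) := by
    simp only [← Finset.sum_add_distrib, Finset.mul_sum]
    refine Finset.sum_congr rfl fun α _ => Finset.sum_congr rfl fun β _ =>
      Finset.sum_congr rfl fun i _ => Finset.sum_congr rfl fun j _ => ?_
    ring
  rw [h4]
  have h5 := mul_le_mul_of_nonneg_left (add_le_add h1 h2)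
    (by positivity : (0 : ℝ) ≤ (MIdx d m).card * ‖c‖ ^ 2)
  refine le_trans (le_of_eq ?_) (h5.trans (le_of_eq ?_)) <;> ring

/-- The Gårding inequality on the half space with Dirichlet boundary conditions. -/
theorem LegHad.le_integral_halfSp {n m : ℕ} {lam : ℝ}
    {B : (Fin d → ℕ) → (Fin d → ℕ) → Fin n → Fin n → ℝ}
    (hlam : 0 ≤ lam) (hB : LegHad d n m lam B)
    (f : (Fin d → ℕ) → Fin n → EuclideanSpace ℝ (Fin d) → ℝ)
    (hf : ∀ γ i, Continuous (f γ i)) (hc : ∀ γ i, HasCompactSupport (f γ i))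
    (hd : ∀ γ i k x (s : ℝ), HasDerivAt
      (fun s : ℝ => f γ i (x + s • EuclideanSpace.single k (1 : ℝ)))
      (f (γ + Pi.single k 1) i (x + s • EuclideanSpace.single k (1 : ℝ))) s)
    (h0 : ∀ γ i x, ∑ k, γ k < m → x N = 0 → f γ i x = 0) :
    lam * ∑ i, ∑ γ ∈ MIdx d m, ∫ x in halfSp N, f γ i x ^ 2 ≤
      (MIdx d m).card * ∑ α ∈ MIdx d m, ∑ β ∈ MIdx d m, ∑ i, ∑ j,
        B α β i j * ∫ x in halfSp N, f α i x * f β j x := by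
  set g : (Fin d → ℕ) → Fin n → EuclideanSpace ℝ (Fin d) → ℂ := fun γ i => 𝓕 (zeroExt N (f γ i))
  have hg : ∀ γ i ξ, ∑ k, γ k ≤ m → g γ i ξ =
      ((2 * Real.pi * Complex.I) ^ (∑ k, γ k) * ∏ k, (ξ k : ℂ) ^ γ k) * g 0 i ξ := by
    intro γ i ξ
    induction γ using multiIndex_induction with
    | h0 => simp
    | hs γ k ih =>
      intro hγ
      rw [sum_add_single] at hγ ⊢
      have h1 : g (γ + Pi.single k 1) i ξ = _ := fourier_zeroExt_deriv (hf γ i) (hc γ i)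
        (hf _ i) (hc _ i) (hd γ i k) (fun x => h0 γ i x (by omega)) ξ
      have h2 : ∏ l, (ξ l : ℂ) ^ (γ + Pi.single k 1 : Fin d → ℕ) l =
          (∏ l, (ξ l : ℂ) ^ γ l) * ξ k := by
        simp only [Pi.add_apply, pow_add, Finset.prod_mul_distrib]
        congr 1
        rw [Finset.prod_eq_single k (fun b _ hb => by simp [hb]) (by simp)]
        simp
      rw [h1, h2]
      change _ * g γ i ξ = _
      rw [ih (by omega)]
      ring
  have hpl : ∀ α β i j, Integrable (fun ξ => (inner ℂ (g α i ξ) (g β j ξ)).re) ∧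
      ∫ ξ, (inner ℂ (g α i ξ) (g β j ξ)).re = ∫ x in halfSp N, f α i x * f β j x := by
    intro α β i j
    obtain ⟨h1, h2⟩ := integral_inner_fourier (integrable_zeroExt (N := N) (hf α i) (hc α i))
      (memLp_zeroExt (hf α i) (hc α i)) (integrable_zeroExt (N := N) (hf β j) (hc β j))
      (memLp_zeroExt (hf β j) (hc β j))
    refine ⟨h1.re, ?_⟩
    have h3 := integral_re h1
    refine h3.trans ?_
    rw [h2, ← integral_indicator (measurableSet_halfSp N)]
    have h4 : ∀ x, inner ℂ (zeroExt N (f α i) x) (zeroExt N (f β j) x) =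
        (((halfSp N).indicator (fun x => f α i x * f β j x) x : ℝ) : ℂ) := by
      intro x
      by_cases hx : x ∈ halfSp N
      · simp [zeroExt, indicator_of_mem hx, mul_comm]
      · simp [zeroExt, indicator_of_notMem hx]
    simp only [h4]
    exact (congrArg Complex.re integral_complex_ofReal).trans (Complex.ofReal_re _)
  have hsq : ∀ γ i, Integrable (fun ξ => ‖g γ i ξ‖ ^ 2) ∧
      ∫ ξ, ‖g γ i ξ‖ ^ 2 = ∫ x in halfSp N, f γ i x ^ 2 := by
    intro γ i
    have h1 := hpl γ γ i i
    have h2 : ∀ ξ, (inner ℂ (g γ i ξ) (g γ i ξ)).re = ‖g γ i ξ‖ ^ 2 := by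
      intro ξ
      rw [inner_self_eq_norm_sq_to_K]
      norm_cast
    simpa only [h2, ← sq] using h1
  simp only [← (hsq _ _).2, ← (hpl _ _ _ _).2]
  have hI1 : ∀ i, Integrable (fun ξ => ∑ γ ∈ MIdx d m, ‖g γ i ξ‖ ^ 2) := fun i =>
    integrable_finsetSum _ fun γ _ => (hsq γ i).1
  have hJ1 : ∀ α β i j, Integrable (fun ξ => B α β i j * (inner ℂ (g α i ξ) (g β j ξ)).re) :=
    fun α β i j => (hpl α β i j).1.const_mul _
  have hJ2 : ∀ α β i, Integrable (fun ξ => ∑ j, B α β i j * (inner ℂ (g α i ξ) (g β j ξ)).re) :=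
    fun α β i => integrable_finsetSum _ fun j _ => hJ1 α β i j
  have hJ3 : ∀ α β, Integrable (fun ξ => ∑ i, ∑ j, B α β i j *
      (inner ℂ (g α i ξ) (g β j ξ)).re) :=
    fun α β => integrable_finsetSum _ fun i _ => hJ2 α β i
  have hJ4 : ∀ α, Integrable (fun ξ => ∑ β ∈ MIdx d m, ∑ i, ∑ j, B α β i j *
      (inner ℂ (g α i ξ) (g β j ξ)).re) :=
    fun α => integrable_finsetSum _ fun β _ => hJ3 α β
  have hJ5 : Integrable (fun ξ => ∑ α ∈ MIdx d m, ∑ β ∈ MIdx d m, ∑ i, ∑ j, B α β i j *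
      (inner ℂ (g α i ξ) (g β j ξ)).re) :=
    integrable_finsetSum _ fun α _ => hJ4 α
  have e1 : ∑ i, ∑ γ ∈ MIdx d m, ∫ ξ, ‖g γ i ξ‖ ^ 2 = ∫ ξ, ∑ i, ∑ γ ∈ MIdx d m, ‖g γ i ξ‖ ^ 2 := by
    rw [integral_finsetSum _ fun i _ => hI1 i]
    refine Finset.sum_congr rfl fun i _ => ?_
    rw [integral_finsetSum _ fun γ _ => (hsq γ i).1]
  have e2 : ∑ α ∈ MIdx d m, ∑ β ∈ MIdx d m, ∑ i, ∑ j, B α β i j *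
      ∫ ξ, (inner ℂ (g α i ξ) (g β j ξ)).re = ∫ ξ, ∑ α ∈ MIdx d m, ∑ β ∈ MIdx d m, ∑ i, ∑ j,
        B α β i j * (inner ℂ (g α i ξ) (g β j ξ)).re := by
    rw [integral_finsetSum _ fun α _ => hJ4 α]
    refine Finset.sum_congr rfl fun α _ => ?_
    rw [integral_finsetSum _ fun β _ => hJ3 α β]
    refine Finset.sum_congr rfl fun β _ => ?_
    rw [integral_finsetSum _ fun i _ => hJ2 α β i]
    refine Finset.sum_congr rfl fun i _ => ?_
    rw [integral_finsetSum _ fun j _ => hJ1 α β i j]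
    refine Finset.sum_congr rfl fun j _ => ?_
    rw [integral_const_mul]
  rw [e1, e2, ← integral_const_mul, ← integral_const_mul]
  refine integral_mono ((integrable_finsetSum _ fun i _ => hI1 i).const_mul _)
    (hJ5.const_mul _) fun ξ => ?_
  have := hB.le_sum_re hlam (fun k => ξ k) (fun i => g 0 i ξ) ((2 * Real.pi * Complex.I) ^ m)
  have e3 : ∀ γ ∈ MIdx d m, ∀ i, ((2 * Real.pi * Complex.I) ^ m * ∏ k, (ξ k : ℂ) ^ γ k) * g 0 i ξ =
      g γ i ξ := by
    intro γ hγ i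
    rw [mem_MIdx] at hγ
    rw [hg γ i ξ hγ.le, hγ]
  refine le_trans (le_of_eq ?_) (this.trans (le_of_eq ?_))
  · congr 1
    refine Finset.sum_congr rfl fun i _ => Finset.sum_congr rfl fun γ hγ => ?_
    rw [e3 γ hγ]
  · congr 1
    refine Finset.sum_congr rfl fun α hα => Finset.sum_congr rfl fun β hβ =>
      Finset.sum_congr rfl fun i _ => Finset.sum_congr rfl fun j _ => ?_
    rw [e3 α hα, e3 β hβ]

end HalfSpace

end Plancherel

noncomputable section Garding

variable {d : ℕ} {N : Fin d}

theorem Cut.multiD {f : smoothAlg d} (hf : Cut f) (γ : Fin d → ℕ) : Cut (multiD γ f) := by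
  induction γ using multiIndex_induction with
  | h0 => rwa [multiD_zero]
  | hs γ i ih => rw [← spD_multiD]; exact ih.spD i

theorem Van.multiD_eq_zero {k : ℕ} {f : smoothAlg d} (hf : Van N k f) {γ : Fin d → ℕ}
    (hγ : ∑ i, γ i < k) : ∀ p ∈ flatBdry N, (_root_.multiD γ f).1 p = 0 := by
  have h1 : Van N 1 (_root_.multiD γ f) := Van.multiD γ (hf.mono (by omega))
  exact h1.1

/-- Integration over the slice at time `t` of the unit half cylinder. -/
def sliceInt (N : Fin d) (t : ℝ) : smoothAlg d →ₗ[ℝ] ℝ where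
  toFun f := ∫ x in ball 0 1 ∩ halfSp N, f.1 (t, x)
  map_add' f g := by
    have h : ∀ f : smoothAlg d, IntegrableOn (fun x => f.1 (t, x)) (ball 0 1 ∩ halfSp N) := fun f =>
      (((smoothAlg_continuous f).comp (by fun_prop : Continuous fun x :
        EuclideanSpace ℝ (Fin d) => (t, x))).continuousOn.integrableOn_compact
        (isCompact_closedBall 0 1)).mono_set (inter_subset_left.trans ball_subset_closedBall)
    exact integral_add (h f) (h g)
  map_smul' c _ := integral_const_mul c _

theorem intU_eq_integral_sliceInt (f : smoothAlg d) :
    intU N f = ∫ t in Ioo (-1) 0, sliceInt N t f := by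
  have h := integrableOn_halfCyl N f
  rw [intU_apply, halfCyl, Measure.volume_eq_prod, setIntegral_prod]
  · rfl
  · rwa [halfCyl, Measure.volume_eq_prod] at h

theorem Cut.sliceInt_eq {f : smoothAlg d} (hf : Cut f) (t : ℝ) :
    sliceInt N t f = ∫ x in halfSp N, f.1 (t, x) := by
  refine (setIntegral_eq_of_subset_of_forall_sdiff_eq_zero (measurableSet_halfSp N)
    inter_subset_right fun x hx => hf.eq_zero ?_).symm
  have h1 : x ∉ ball 0 1 := fun h => hx.2 ⟨h, hx.1⟩
  rw [mem_ball, dist_zero_right, not_lt] at h1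
  have h2 := norm_snd_le (t, x)
  simp only at h2
  linarith

/-- The Gårding inequality on the unit half cylinder. -/
theorem LegHad.le_intU {n m : ℕ} {lam : ℝ}
    {B : (Fin d → ℕ) → (Fin d → ℕ) → Fin n → Fin n → ℝ}
    (hlam : 0 ≤ lam) (hB : LegHad d n m lam B) {f : Fin n → smoothAlg d} (hf : ∀ i, Cut (f i))
    (hv : ∀ i, Van N m (f i)) :
    lam * ∑ i, ∑ γ ∈ MIdx d m, intU N (multiD γ (f i) ^ 2) ≤
      (MIdx d m).card * ∑ α ∈ MIdx d m, ∑ β ∈ MIdx d m, ∑ i, ∑ j,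
        B α β i j * intU N (multiD α (f i) * multiD β (f j)) := by
  set P : smoothAlg d := ((MIdx d m).card : ℝ) • ∑ α ∈ MIdx d m, ∑ β ∈ MIdx d m, ∑ i, ∑ j,
        B α β i j • (multiD α (f i) * multiD β (f j)) -
      lam • ∑ i, ∑ γ ∈ MIdx d m, (multiD γ (f i) ^ 2) with hP
  suffices h : 0 ≤ intU N P by
    simp only [hP, map_sub, map_smul, map_sum, smul_eq_mul] at h
    linarith
  rw [intU_eq_integral_sliceInt]
  refine setIntegral_nonneg measurableSet_Ioo fun t ht => ?_
  simp only [hP, map_sub, map_smul, map_sum, smul_eq_mul, sub_nonneg]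
  have h1 : ∀ i γ, sliceInt N t (multiD γ (f i) ^ 2) =
      ∫ x in halfSp N, (multiD γ (f i)).1 (t, x) ^ 2 := fun i γ => by
    rw [sq, (((hf i).multiD γ).mul_right _).sliceInt_eq]
    simp [sq]
  have h2 : ∀ α β i j, sliceInt N t (multiD α (f i) * multiD β (f j)) =
      ∫ x in halfSp N, (multiD α (f i)).1 (t, x) * (multiD β (f j)).1 (t, x) := fun α β i j => by
    rw [(((hf i).multiD α).mul_right _).sliceInt_eq]
    rfl
  simp only [h1, h2]
  refine hB.le_integral_halfSp hlam (fun γ i x => (multiD γ (f i)).1 (t, x)) (fun γ i => ?_)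
    (fun γ i => ?_) (fun γ i k x s => ?_) fun γ i x hγ hx => ?_
  · exact (smoothAlg_continuous _).comp (by fun_prop)
  · refine HasCompactSupport.intro (isCompact_closedBall 0 1) fun x hx => ?_
    refine ((hf i).multiD γ).eq_zero ?_
    rw [mem_closedBall, dist_zero_right, not_le] at hx
    have h2 := norm_snd_le (t, x)
    simp only at h2
    linarith
  · have := hasDerivAt_line (multiD γ (f i)) (t, x) (0, EuclideanSpace.single k (1 : ℝ)) s
    rw [← spD_multiD]
    simpa [_root_.spD] using this
  · by_cases hn : 3 / 4 < ‖(t, x)‖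
    · exact ((hf i).multiD γ).eq_zero hn
    · refine (hv i).multiD_eq_zero hγ _ ⟨ht, ?_, hx⟩
      have h2 := norm_snd_le (t, x)
      rw [mem_ball, dist_zero_right]
      simp only at h2
      linarith

end Garding

noncomputable section LowerOrder

variable {d : ℕ} {N : Fin d}

/-- The operators of order less than `k` generated by `χ^{e+|δ|} D^δ`. -/
def lowOps (d e k : ℕ) : Submodule (smoothAlg d) (smoothAlg d → smoothAlg d) :=
  Submodule.span (smoothAlg d)
    {T | ∃ δ : Fin d → ℕ, ∑ i, δ i < k ∧ T = fun f => chi d ^ (e + ∑ i, δ i) * multiD δ f}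

theorem mem_lowOps {e k : ℕ} (δ : Fin d → ℕ) (hδ : ∑ i, δ i < k) :
    (fun f => chi d ^ (e + ∑ i, δ i) * multiD δ f) ∈ lowOps d e k :=
  Submodule.subset_span ⟨δ, hδ, rfl⟩

theorem lowOps_le {e k : ℕ} : lowOps d (e + 1) k ≤ lowOps d e (k + 1) := by
  refine Submodule.span_le.2 ?_
  rintro T ⟨δ, hδ, rfl⟩
  have h := (lowOps d e (k + 1)).smul_mem (chi d) (mem_lowOps (e := e) δ (Nat.lt_succ_of_lt hδ))
  have e1 : (fun f => chi d ^ (e + 1 + ∑ i, δ i) * multiD δ f) =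
      chi d • fun f => chi d ^ (e + ∑ i, δ i) * multiD δ f := by
    ext1 f
    simp only [Pi.smul_apply, smul_eq_mul]
    ring
  rw [SetLike.mem_coe, e1]
  exact h

theorem spD_comp_mem_lowOps {e k : ℕ} {T : smoothAlg d → smoothAlg d} (i : Fin d)
    (hT : T ∈ lowOps d (e + 1) k) : (fun f => spD i (T f)) ∈ lowOps d e (k + 1) := by
  induction hT using Submodule.span_induction with
  | mem T hT =>
    obtain ⟨δ, hδ, rfl⟩ := hT
    have h1 : (fun f => chi d ^ (e + (∑ j, δ j + 1)) *
        multiD (δ + Pi.single i 1) f) ∈ lowOps d e (k + 1) := by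
      rw [← sum_add_single δ i]
      exact mem_lowOps _ (by rw [sum_add_single]; omega)
    have h2 := (lowOps d e (k + 1)).smul_mem (((e + 1 + ∑ j, δ j : ℕ) : smoothAlg d) *
      spD i (chi d)) (mem_lowOps (e := e) δ (Nat.lt_succ_of_lt hδ))
    convert (lowOps d e (k + 1)).add_mem h1 h2 using 1
    ext1 f
    simp only [Pi.add_apply, Pi.smul_apply, smul_eq_mul]
    rw [Derivation.leibniz, Derivation.leibniz_pow, spD_multiD]
    simp only [smul_eq_mul, nsmul_eq_mul]
    rw [show e + 1 + ∑ j, δ j - 1 = e + ∑ j, δ j by omega]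
    ring
  | zero =>
    convert (lowOps d e (k + 1)).zero_mem using 1
    ext1 f
    simp
  | add T S _ _ h1 h2 =>
    convert (lowOps d e (k + 1)).add_mem h1 h2 using 1
    ext1 f
    simp
  | smul a T hT h =>
    convert (lowOps d e (k + 1)).add_mem ((lowOps d e (k + 1)).smul_mem a h)
      ((lowOps d e (k + 1)).smul_mem (spD i a) (lowOps_le hT)) using 1
    ext1 f
    simp only [Pi.add_apply, Pi.smul_apply, smul_eq_mul]
    rw [Derivation.leibniz]
    simp only [smul_eq_mul]
    ring

/-- The Leibniz rule for a derivative of `χ^{e+|γ|} f`. -/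
theorem exists_multiD_chi_pow_mul (γ : Fin d → ℕ) (e : ℕ) :
    ∃ T ∈ lowOps d e (∑ i, γ i), ∀ f, multiD γ (chi d ^ (e + ∑ i, γ i) * f) =
      chi d ^ (e + ∑ i, γ i) * multiD γ f + T f := by
  induction γ using multiIndex_induction generalizing e with
  | h0 => exact ⟨0, Submodule.zero_mem _, fun f => by simp [multiD_zero]⟩
  | hs γ i ih =>
    obtain ⟨T, hT, h⟩ := ih (e + 1)
    rw [sum_add_single]
    refine ⟨_, (lowOps d e _).add_mem ((lowOps d e _).smul_mem
      (((e + 1 + ∑ j, γ j : ℕ) : smoothAlg d) * spD i (chi d))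
      (mem_lowOps (e := e) γ (Nat.lt_succ_self _))) (spD_comp_mem_lowOps i hT), fun f => ?_⟩
    rw [← spD_multiD, ← add_assoc, add_right_comm, h f, map_add, Derivation.leibniz,
      Derivation.leibniz_pow, spD_multiD]
    simp only [Pi.add_apply, Pi.smul_apply, smul_eq_mul, nsmul_eq_mul]
    rw [show e + 1 + ∑ j, γ j - 1 = e + ∑ j, γ j by omega]
    ring

theorem exists_eq_chi_pow_mul {e e' k : ℕ} {T : smoothAlg d → smoothAlg d}
    (hT : T ∈ lowOps d (e + e') k) : ∃ S ∈ lowOps d e k, ∀ f, T f = chi d ^ e' * S f := by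
  induction hT using Submodule.span_induction with
  | mem T hT =>
    obtain ⟨δ, hδ, rfl⟩ := hT
    exact ⟨_, mem_lowOps δ hδ, fun f => by ring⟩
  | zero => exact ⟨0, Submodule.zero_mem _, fun f => by simp⟩
  | add T₁ T₂ _ _ h1 h2 =>
    obtain ⟨S₁, hS₁, h1⟩ := h1
    obtain ⟨S₂, hS₂, h2⟩ := h2
    refine ⟨_, Submodule.add_mem _ hS₁ hS₂, fun f => ?_⟩
    rw [Pi.add_apply, Pi.add_apply, h1, h2, mul_add]
  | smul a T _ h =>
    obtain ⟨S, hS, h⟩ := h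
    refine ⟨_, Submodule.smul_mem _ a hS, fun f => ?_⟩
    rw [Pi.smul_apply, Pi.smul_apply, h, smul_eq_mul, smul_eq_mul, mul_left_comm]

/-- The weighted energy of order `k`. -/
def energy (N : Fin d) (σ k : ℕ) (f : smoothAlg d) : ℝ :=
  ∑ γ ∈ MIdx d k, intU N ((chi d ^ (σ + k) * multiD γ f) ^ 2)

theorem energy_nonneg (σ k : ℕ) (f : smoothAlg d) : 0 ≤ energy N σ k f :=
  Finset.sum_nonneg fun _ _ => intU_sq_nonneg N _

theorem intU_sq_le_energy (σ : ℕ) {k : ℕ} {γ : Fin d → ℕ} (hγ : ∑ i, γ i = k) (f : smoothAlg d) :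
    intU N ((chi d ^ (σ + k) * multiD γ f) ^ 2) ≤ energy N σ k f :=
  Finset.single_le_sum (f := fun γ => intU N ((chi d ^ (σ + k) * multiD γ f) ^ 2))
    (fun _ _ => intU_sq_nonneg N _) (mem_MIdx.2 hγ)

theorem energy_zero (σ : ℕ) (f : smoothAlg d) : energy N σ 0 f = intU N ((chi d ^ σ * f) ^ 2) := by
  have : MIdx d 0 = {0} := by
    ext γ
    rw [mem_MIdx, Finset.mem_singleton, Finset.sum_eq_zero_iff, funext_iff]
    simp
  simp [energy, this, multiD_zero]

theorem abs_mul_le_sq_add_sq {ε : ℝ} (hε : 0 < ε) (a b : ℝ) :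
    |a * b| ≤ ε * a ^ 2 + ε⁻¹ * b ^ 2 := by
  have h1 : 0 ≤ (ε * |a| - |b|) ^ 2 := sq_nonneg _
  have h3 : ε * (|a| * |b|) ≤ ε * (ε * |a| ^ 2 + ε⁻¹ * |b| ^ 2) := by
    rw [mul_add, ← mul_assoc ε ε⁻¹, mul_inv_cancel₀ hε.ne']
    nlinarith [mul_nonneg hε.le (mul_nonneg (abs_nonneg a) (abs_nonneg b))]
  rw [abs_mul, ← sq_abs a, ← sq_abs b]
  exact le_of_mul_le_mul_left h3 hε

theorem intU_mul_le {ε : ℝ} (hε : 0 < ε) (f g : smoothAlg d) :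
    |intU N (f * g)| ≤ ε * intU N (f ^ 2) + ε⁻¹ * intU N (g ^ 2) := by
  have h : ∀ p, |f.1 p * g.1 p| ≤ ε * f.1 p ^ 2 + ε⁻¹ * g.1 p ^ 2 :=
    fun p => abs_mul_le_sq_add_sq hε _ _
  have e : ε * intU N (f ^ 2) + ε⁻¹ * intU N (g ^ 2) = intU N (ε • f ^ 2 + ε⁻¹ • g ^ 2) := by
    simp
  rw [e, abs_le, ← map_neg]
  refine ⟨intU_mono N fun p _ => ?_, intU_mono N fun p _ => ?_⟩
  · have := neg_le_of_abs_le (h p)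
    exact this
  · exact le_of_abs_le (h p)

theorem intU_mul_bounded_sq_le {a : smoothAlg d} {M : ℝ}
    (hM' : ∀ p ∈ halfCyl N, |a.1 p| ≤ M) (f : smoothAlg d) :
    intU N ((a * f) ^ 2) ≤ M ^ 2 * intU N (f ^ 2) := by
  have e : M ^ 2 * intU N (f ^ 2) = intU N (M ^ 2 • f ^ 2) := by simp
  rw [e]
  refine intU_mono N fun p hp => ?_
  have : (a.1 p * f.1 p) ^ 2 ≤ M ^ 2 * f.1 p ^ 2 := by
    rw [mul_pow]
    refine mul_le_mul_of_nonneg_right ?_ (sq_nonneg _)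
    rw [← sq_abs]
    exact pow_le_pow_left₀ (abs_nonneg _) (hM' p hp) 2
  exact this

variable (N) in
/-- Weighted interpolation for a single derivative. -/
theorem exists_intU_spD_sq_le (s : ℕ) {ε : ℝ} (hε : 0 < ε) :
    ∃ C : ℝ, 0 ≤ C ∧ ∀ (i : Fin d) (g : smoothAlg d), Van N 2 g →
      intU N ((chi d ^ (s + 1) * spD i g) ^ 2) ≤
        ε * intU N ((chi d ^ (s + 2) * spD i (spD i g)) ^ 2) +
          C * intU N ((chi d ^ s * g) ^ 2) := by
  have h : ∀ i : Fin d, ∃ C : ℝ, 0 ≤ C ∧ ∀ (g : smoothAlg d), Van N 2 g →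
      intU N ((chi d ^ (s + 1) * spD i g) ^ 2) ≤
        ε * intU N ((chi d ^ (s + 2) * spD i (spD i g)) ^ 2) +
          C * intU N ((chi d ^ s * g) ^ 2) := by
    intro i
    obtain ⟨M, hM, hM'⟩ := exists_bound_halfCyl N
      (((2 * (s + 1) : ℕ) : smoothAlg d) * spD i (chi d))
    refine ⟨2 * ((ε / 2)⁻¹ + 2 * M ^ 2), by positivity, fun g hg => ?_⟩
    have h1 := intU_mul_spD (N := N) (i := i) (cut_chi_pow (k := 2 * (s + 1)) (by omega) (spD i g))
      (Or.inr fun p hp => by simp [(hg.2 i).1 p hp]) g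
    have e1 : chi d ^ (2 * (s + 1)) * spD i g * spD i g = (chi d ^ (s + 1) * spD i g) ^ 2 := by ring
    have e2 : spD i (chi d ^ (2 * (s + 1)) * spD i g) * g =
        (chi d ^ (s + 2) * spD i (spD i g)) * (chi d ^ s * g) +
        (chi d ^ (s + 1) * spD i g) * ((((2 * (s + 1) : ℕ) : smoothAlg d) * spD i (chi d)) *
          (chi d ^ s * g)) := by
      rw [Derivation.leibniz, Derivation.leibniz_pow]
      simp only [smul_eq_mul, nsmul_eq_mul]
      rw [show 2 * (s + 1) - 1 = 2 * s + 1 by omega]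
      ring
    rw [e1, e2, map_add] at h1
    have h2 := intU_mul_le (N := N) (half_pos hε) (chi d ^ (s + 2) * spD i (spD i g))
      (chi d ^ s * g)
    have h3 := intU_mul_le (N := N) one_half_pos (chi d ^ (s + 1) * spD i g)
      ((((2 * (s + 1) : ℕ) : smoothAlg d) * spD i (chi d)) * (chi d ^ s * g))
    have h4 := intU_mul_bounded_sq_le hM' (chi d ^ s * g)
    rw [show ((1 : ℝ) / 2)⁻¹ = 2 by norm_num] at h3
    have h5 := neg_le_of_abs_le h2
    have h6 := neg_le_of_abs_le h3
    nlinarith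
  choose C hC hC' using h
  refine ⟨∑ i, C i, Finset.sum_nonneg fun i _ => hC i, fun i g hg => (hC' i g hg).trans ?_⟩
  have := Finset.single_le_sum (f := C) (fun i _ => hC i) (Finset.mem_univ i)
  have h1 := intU_sq_nonneg N (chi d ^ s * g)
  nlinarith [mul_le_mul_of_nonneg_right this h1]

variable (N) in
theorem exists_energy_le_step (σ k : ℕ) {ε : ℝ} (hε : 0 < ε) :
    ∃ C : ℝ, 0 ≤ C ∧ ∀ f : smoothAlg d, Van N (k + 2) f →
      energy N σ (k + 1) f ≤ ε * energy N σ (k + 2) f + C * energy N σ k f := by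
  have hM : 0 < ((MIdx d (k + 1)).card : ℝ) + 1 := by positivity
  obtain ⟨C, hC, h⟩ := exists_intU_spD_sq_le N (σ + k) (div_pos hε hM)
  refine ⟨(MIdx d (k + 1)).card * C, by positivity, fun f hf => ?_⟩
  have h1 : ∀ γ ∈ MIdx d (k + 1), intU N ((chi d ^ (σ + (k + 1)) * multiD γ f) ^ 2) ≤
      ε / ((MIdx d (k + 1)).card + 1) * energy N σ (k + 2) f + C * energy N σ k f := by
    intro γ hγ
    rw [mem_MIdx] at hγ
    obtain ⟨i, hi⟩ : ∃ i, γ i ≠ 0 := by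
      by_contra! hc
      simp [hc] at hγ
    obtain ⟨γ', rfl⟩ : ∃ γ', γ = γ' + Pi.single i 1 := ⟨γ - Pi.single i 1, by
      ext j
      by_cases hj : j = i
      · subst hj; simp; omega
      · simp [hj]⟩
    rw [sum_add_single] at hγ
    have hγ' : ∑ j, γ' j = k := by omega
    have h2 := h i (multiD γ' f) (Van.multiD γ' (hf.mono (by omega)))
    rw [spD_multiD, spD_multiD] at h2
    refine h2.trans (add_le_add (mul_le_mul_of_nonneg_left ?_ (by positivity))
      (mul_le_mul_of_nonneg_left (intU_sq_le_energy σ hγ' f) hC))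
    exact intU_sq_le_energy (N := N) σ (k := k + 2)
      (by rw [sum_add_single, sum_add_single]; omega) f
  refine (Finset.sum_le_card_nsmul _ _ _ h1).trans ?_
  rw [nsmul_eq_mul, mul_add, ← mul_assoc, ← mul_assoc]
  refine add_le_add (mul_le_mul_of_nonneg_right ?_ (energy_nonneg _ _ _)) le_rfl
  rw [mul_div_assoc', div_le_iff₀ hM]
  nlinarith

/-- Iterated interpolation inequalities for families of sequences. -/
theorem exists_le_of_interpolation {ι : Type*} (m : ℕ) (a : ι → ℕ → ℝ) (ha : ∀ x k, 0 ≤ a x k)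
    (h : ∀ k, k + 2 ≤ m → ∀ ε : ℝ, 0 < ε → ∃ C : ℝ, 0 ≤ C ∧ ∀ x,
      a x (k + 1) ≤ ε * a x (k + 2) + C * a x k) :
    ∀ k < m, ∀ ε : ℝ, 0 < ε → ∃ C : ℝ, 0 ≤ C ∧ ∀ x, a x k ≤ ε * a x m + C * a x 0 := by
  have h1 : ∀ k < m, ∀ ε : ℝ, 0 < ε → ∃ C : ℝ, 0 ≤ C ∧ ∀ x,
      a x k ≤ ε * a x (k + 1) + C * a x 0 := by
    intro k
    induction k with
    | zero =>
      intro _ ε hε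
      exact ⟨1, zero_le_one, fun x => by nlinarith [ha x (0 + 1)]⟩
    | succ k ih =>
      intro hk ε hε
      obtain ⟨C, hC, h2⟩ := h k (by omega) (ε / 2) (half_pos hε)
      obtain ⟨C', hC', h3⟩ := ih (by omega) (1 / (2 * (C + 1))) (by positivity)
      refine ⟨2 * (C * C'), by positivity, fun x => ?_⟩
      have h4 := h2 x
      have h5 := mul_le_mul_of_nonneg_left (h3 x) hC
      have h6 : C * (1 / (2 * (C + 1)) * a x (k + 1)) ≤ a x (k + 1) / 2 := by
        have : C * (1 / (2 * (C + 1))) ≤ 1 / 2 := by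
          rw [mul_one_div, div_le_iff₀ (by positivity)]; linarith
        nlinarith [mul_le_mul_of_nonneg_right this (ha x (k + 1))]
      rw [mul_add] at h5
      rw [add_assoc]
      norm_num
      nlinarith
  intro k hk
  obtain ⟨j, rfl⟩ : ∃ j, m = k + 1 + j := ⟨m - (k + 1), by omega⟩
  clear hk
  induction j generalizing k with
  | zero => exact h1 k (by omega)
  | succ j ih =>
    intro ε hε
    have e : k + 1 + (j + 1) = (k + 1) + 1 + j := by ring
    rw [e] at h h1 ⊢
    obtain ⟨C, hC, h2⟩ := ih (k + 1) h h1 ε hε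
    obtain ⟨C', hC', h3⟩ := h1 k (by omega) 1 one_pos
    refine ⟨C + C', add_nonneg hC hC', fun x => ?_⟩
    have := h2 x
    have := h3 x
    linarith

variable (N) in
theorem exists_energy_le (σ m : ℕ) : ∀ k < m, ∀ ε : ℝ, 0 < ε →
    ∃ C : ℝ, 0 ≤ C ∧ ∀ f : smoothAlg d, Van N m f →
      energy N σ k f ≤ ε * energy N σ m f + C * energy N σ 0 f := by
  intro k hk ε hε
  obtain ⟨C, hC, h⟩ := exists_le_of_interpolation (ι := {f : smoothAlg d // Van N m f}) m
    (fun f k => energy N σ k f.1) (fun _ _ => energy_nonneg _ _ _) (fun k hk ε hε => by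
      obtain ⟨C, hC, h⟩ := exists_energy_le_step N σ k hε
      exact ⟨C, hC, fun f => h f.1 (f.2.mono hk)⟩) k hk ε hε
  exact ⟨C, hC, fun f hf => h ⟨f, hf⟩⟩

end LowerOrder

noncomputable section EnergyEstimates

variable {d n : ℕ} {N : Fin d}

/-- The sum of the weighted energies of order less than `k`. -/
def lowEnergy (N : Fin d) (σ k : ℕ) (f : smoothAlg d) : ℝ :=
  ∑ l ∈ Finset.range k, energy N σ l f

theorem lowEnergy_nonneg (σ k : ℕ) (f : smoothAlg d) : 0 ≤ lowEnergy N σ k f :=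
  Finset.sum_nonneg fun _ _ => energy_nonneg _ _ _

theorem energy_le_lowEnergy (σ : ℕ) {k l : ℕ} (h : l < k) (f : smoothAlg d) :
    energy N σ l f ≤ lowEnergy N σ k f :=
  Finset.single_le_sum (f := fun l => energy N σ l f) (fun _ _ => energy_nonneg _ _ _)
    (Finset.mem_range.2 h)

theorem intU_add_sq_le (f g : smoothAlg d) :
    intU N ((f + g) ^ 2) ≤ 2 * intU N (f ^ 2) + 2 * intU N (g ^ 2) := by
  have e : 2 * intU N (f ^ 2) + 2 * intU N (g ^ 2) =
      intU N ((2 : ℝ) • f ^ 2 + (2 : ℝ) • g ^ 2) := by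
    simp
  rw [e]
  refine intU_mono N fun p _ => ?_
  have : (f.1 p + g.1 p) ^ 2 ≤ 2 * f.1 p ^ 2 + 2 * g.1 p ^ 2 := by
    nlinarith [sq_nonneg (f.1 p - g.1 p)]
  exact this

variable (N) in
theorem exists_intU_sq_le_lowEnergy {σ k : ℕ} {T : smoothAlg d → smoothAlg d}
    (hT : T ∈ lowOps d σ k) :
    ∃ C : ℝ, 0 ≤ C ∧ ∀ f, intU N (T f ^ 2) ≤ C * lowEnergy N σ k f := by
  induction hT using Submodule.span_induction with
  | mem T hT =>
    obtain ⟨δ, hδ, rfl⟩ := hT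
    refine ⟨1, zero_le_one, fun f => ?_⟩
    rw [one_mul]
    exact (intU_sq_le_energy σ rfl f).trans (energy_le_lowEnergy σ hδ f)
  | zero => exact ⟨0, le_rfl, fun f => by simp⟩
  | add T₁ T₂ _ _ h1 h2 =>
    obtain ⟨C₁, hC₁, h1⟩ := h1
    obtain ⟨C₂, hC₂, h2⟩ := h2
    refine ⟨2 * C₁ + 2 * C₂, by positivity, fun f => (intU_add_sq_le _ _).trans ?_⟩
    linarith [h1 f, h2 f]
  | smul a T _ h =>
    obtain ⟨C, hC, h⟩ := h
    obtain ⟨M, hM, hM'⟩ := exists_bound_halfCyl N a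
    refine ⟨M ^ 2 * C, by positivity, fun f => (intU_mul_bounded_sq_le hM' (T f)).trans ?_⟩
    rw [mul_assoc]
    exact mul_le_mul_of_nonneg_left (h f) (sq_nonneg M)

theorem exists_le_of_finite {ι κ : Type*} (s : Finset ι) {P : ι → κ → ℝ} {Q : ι → κ → ℝ}
    (hQ : ∀ i x, 0 ≤ Q i x) (h : ∀ i, ∃ C : ℝ, 0 ≤ C ∧ ∀ x, P i x ≤ C * Q i x) :
    ∃ C : ℝ, 0 ≤ C ∧ ∀ i ∈ s, ∀ x, P i x ≤ C * Q i x := by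
  choose C hC h using h
  refine ⟨∑ i ∈ s, C i, Finset.sum_nonneg fun i _ => hC i, fun i hi x => (h i x).trans ?_⟩
  exact mul_le_mul_of_nonneg_right (Finset.single_le_sum (f := C) (fun i _ => hC i) hi) (hQ i x)

variable (N) in
/-- The commutator of `D^γ` with a power of the cutoff. -/
theorem exists_commutator (σ τ m : ℕ) :
    ∃ (S : (Fin d → ℕ) → smoothAlg d → smoothAlg d) (C : ℝ), 0 ≤ C ∧ ∀ γ ∈ MIdx d m,
      (∀ f, multiD γ (chi d ^ (τ + (σ + m)) * f) =
        chi d ^ τ * (chi d ^ (σ + m) * multiD γ f + S γ f)) ∧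
      ∀ f, intU N (S γ f ^ 2) ≤ C * lowEnergy N σ m f := by
  have h : ∀ γ : Fin d → ℕ, ∃ S ∈ lowOps d σ (∑ i, γ i), ∀ f,
      multiD γ (chi d ^ (τ + (σ + ∑ i, γ i)) * f) =
        chi d ^ τ * (chi d ^ (σ + ∑ i, γ i) * multiD γ f + S f) := by
    intro γ
    obtain ⟨T, hT, h⟩ := exists_multiD_chi_pow_mul γ (σ + τ)
    obtain ⟨S, hS, h'⟩ := exists_eq_chi_pow_mul hT
    refine ⟨S, hS, fun f => ?_⟩
    rw [show τ + (σ + ∑ i, γ i) = σ + τ + ∑ i, γ i by ring, h, h']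
    ring
  choose S hS h using h
  obtain ⟨C, hC, h2⟩ := exists_le_of_finite (MIdx d m)
    (P := fun γ f => intU N (S γ f ^ 2)) (Q := fun γ f => lowEnergy N σ (∑ i, γ i) f)
    (fun _ _ => lowEnergy_nonneg _ _ _) (fun γ => exists_intU_sq_le_lowEnergy N (hS γ))
  refine ⟨S, C, hC, fun γ hγ => ?_⟩
  have hγ' := mem_MIdx.1 hγ
  refine ⟨fun f => ?_, fun f => ?_⟩
  · have := h γ f
    rwa [hγ'] at this
  · have := h2 γ hγ f
    rwa [hγ'] at this

variable (N) in
/-- Comparison of the two ways of inserting the cutoff in the bilinear form. -/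
theorem exists_cross_le (σ m : ℕ) {ε : ℝ} (hε : 0 < ε) :
    ∃ C : ℝ, 0 ≤ C ∧ ∀ α ∈ MIdx d m, ∀ β ∈ MIdx d m, ∀ f g : smoothAlg d,
      |intU N (multiD α (chi d ^ (σ + m) * f) * multiD β (chi d ^ (σ + m) * g)) -
        intU N (multiD α (chi d ^ (2 * (σ + m)) * f) * multiD β g)| ≤
      ε * (energy N σ m f + energy N σ m g) + C * (lowEnergy N σ m f + lowEnergy N σ m g) := by
  obtain ⟨S, C₁, hC₁, hS⟩ := exists_commutator N σ 0 m
  obtain ⟨T, C₂, hC₂, hT⟩ := exists_commutator N σ (σ + m) m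
  have hε2 := half_pos hε
  refine ⟨(ε / 2)⁻¹ * (C₁ + C₂) + C₁, by positivity, fun α hα β hβ f g => ?_⟩
  set a := chi d ^ (σ + m) * multiD α f with ha
  set b := chi d ^ (σ + m) * multiD β g with hb
  have e1 := (hS α hα).1 f
  have e2 := (hS β hβ).1 g
  have e3 := (hT α hα).1 f
  rw [← two_mul] at e3
  rw [zero_add, pow_zero, one_mul] at e1 e2
  rw [← map_sub, e1, e2, e3]
  have e4 : (a + S α f) * (b + S β g) - chi d ^ (σ + m) * (a + T α f) * multiD β g =
      a * S β g + b * (S α f - T α f) + S α f * S β g := by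
    rw [hb]; ring
  rw [e4, map_add, map_add]
  have i1 := intU_mul_le (N := N) hε2 a (S β g)
  have i2 := intU_mul_le (N := N) hε2 b (S α f)
  have i2' := intU_mul_le (N := N) hε2 b (T α f)
  have i3 := intU_mul_le (N := N) one_pos (S α f) (S β g)
  rw [mul_sub, map_sub]
  have j1 := (hS α hα).2 f
  have j2 := (hS β hβ).2 g
  have j3 := (hT α hα).2 f
  have k1 := intU_sq_le_energy (N := N) σ (mem_MIdx.1 hα) f
  have k2 := intU_sq_le_energy (N := N) σ (mem_MIdx.1 hβ) g
  rw [← ha] at k1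
  rw [← hb] at k2
  have hi := inv_nonneg.2 hε2.le
  have l1 := mul_le_mul_of_nonneg_left j1 hi
  have l2 := mul_le_mul_of_nonneg_left j2 hi
  have l3 := mul_le_mul_of_nonneg_left j3 hi
  have m1 := mul_le_mul_of_nonneg_left k1 hε2.le
  have m2 := mul_le_mul_of_nonneg_left k2 hε2.le
  have n1 : 0 ≤ (ε / 2)⁻¹ * (C₂ * lowEnergy N σ m g) :=
    mul_nonneg hi (mul_nonneg hC₂ (lowEnergy_nonneg _ _ _))
  rw [inv_one, one_mul, one_mul] at i3
  have n2 : (ε / 2)⁻¹ * (C₁ * lowEnergy N σ m g) + (ε / 2)⁻¹ * (C₁ * lowEnergy N σ m f) +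
      (ε / 2)⁻¹ * (C₂ * lowEnergy N σ m f) + C₁ * lowEnergy N σ m f + C₁ * lowEnergy N σ m g +
      (ε / 2)⁻¹ * (C₂ * lowEnergy N σ m g) = ((ε / 2)⁻¹ * (C₁ + C₂) + C₁) *
        (lowEnergy N σ m f + lowEnergy N σ m g) := by ring
  have o1 := abs_add_le (intU N (a * S β g) + (intU N (b * S α f) - intU N (b * T α f)))
    (intU N (S α f * S β g))
  have o2 := abs_add_le (intU N (a * S β g)) (intU N (b * S α f) - intU N (b * T α f))
  have o3 := abs_sub (intU N (b * S α f)) (intU N (b * T α f))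
  have n3 := mul_nonneg hε2.le (energy_nonneg (N := N) σ m f)
  rw [← n2]
  linarith

variable (N) in
theorem exists_energy_le_multiD (σ m : ℕ) :
    ∃ C : ℝ, 0 ≤ C ∧ ∀ f : smoothAlg d, energy N σ m f ≤
      2 * ∑ γ ∈ MIdx d m, intU N (multiD γ (chi d ^ (σ + m) * f) ^ 2) +
        C * lowEnergy N σ m f := by
  obtain ⟨S, C₁, hC₁, hS⟩ := exists_commutator N σ 0 m
  refine ⟨(MIdx d m).card * (2 * C₁), by positivity, fun f => ?_⟩
  have h : ∀ γ ∈ MIdx d m, intU N ((chi d ^ (σ + m) * multiD γ f) ^ 2) ≤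
      2 * intU N (multiD γ (chi d ^ (σ + m) * f) ^ 2) + 2 * C₁ * lowEnergy N σ m f := by
    intro γ hγ
    have e1 := (hS γ hγ).1 f
    rw [zero_add, pow_zero, one_mul] at e1
    have e2 := intU_add_sq_le (N := N) (multiD γ (chi d ^ (σ + m) * f)) (- S γ f)
    rw [show (- S γ f) ^ 2 = S γ f ^ 2 by ring] at e2
    have e3 : chi d ^ (σ + m) * multiD γ f = multiD γ (chi d ^ (σ + m) * f) + - S γ f := by
      rw [e1]; ring
    rw [e3]
    have := (hS γ hγ).2 f
    linarith
  refine (Finset.sum_le_sum h).trans ?_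
  rw [Finset.sum_add_distrib, Finset.sum_const, nsmul_eq_mul, ← Finset.mul_sum]
  linarith

end EnergyEstimates

noncomputable section Caccioppoli

variable {d n : ℕ} {N : Fin d}

variable (N) in
theorem exists_lowEnergy_le (σ m : ℕ) {ε : ℝ} (hε : 0 < ε) :
    ∃ C : ℝ, 0 ≤ C ∧ ∀ f : smoothAlg d, Van N m f →
      lowEnergy N σ m f ≤ ε * energy N σ m f + C * energy N σ 0 f := by
  have h : ∀ k, ∃ C : ℝ, 0 ≤ C ∧ (k < m → ∀ f : smoothAlg d, Van N m f →
      energy N σ k f ≤ ε / (m + 1) * energy N σ m f + C * energy N σ 0 f) := by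
    intro k
    by_cases hk : k < m
    · obtain ⟨C, hC, h⟩ := exists_energy_le N σ m k hk (ε / (m + 1)) (by positivity)
      exact ⟨C, hC, fun _ => h⟩
    · exact ⟨0, le_rfl, fun h => absurd h hk⟩
  choose C hC h using h
  refine ⟨∑ k ∈ Finset.range m, C k, Finset.sum_nonneg fun k _ => hC k, fun f hf => ?_⟩
  refine (Finset.sum_le_sum fun k hk => h k (Finset.mem_range.1 hk) f hf).trans ?_
  rw [Finset.sum_add_distrib, Finset.sum_const, Finset.card_range, nsmul_eq_mul, ← Finset.sum_mul,
    ← mul_assoc]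
  refine add_le_add (mul_le_mul_of_nonneg_right ?_ (energy_nonneg _ _ _)) le_rfl
  rw [mul_div_assoc', div_le_iff₀ (by positivity)]
  nlinarith

/-- Admissible coefficients: bounded by `K` and Legendre–Hadamard with constant `lam`. -/
structure Admissible (d n m : ℕ) (K lam : ℝ)
    (B : (Fin d → ℕ) → (Fin d → ℕ) → Fin n → Fin n → ℝ) : Prop where
  bound : ∀ α β i j, |B α β i j| ≤ K
  legHad : LegHad d n m lam B

theorem Admissible.sum_mul_le {m : ℕ} {K lam : ℝ}
    {B : (Fin d → ℕ) → (Fin d → ℕ) → Fin n → Fin n → ℝ} (hB : Admissible d n m K lam B)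
    {P Q : (Fin d → ℕ) → (Fin d → ℕ) → Fin n → Fin n → ℝ} {a b : Fin n → ℝ}
    (hK : 0 ≤ K) (h : ∀ α ∈ MIdx d m, ∀ β ∈ MIdx d m, ∀ i j, |P α β i j - Q α β i j| ≤ a i + b j) :
    ∑ α ∈ MIdx d m, ∑ β ∈ MIdx d m, ∑ i, ∑ j, B α β i j * P α β i j ≤
      ∑ α ∈ MIdx d m, ∑ β ∈ MIdx d m, ∑ i, ∑ j, B α β i j * Q α β i j +
      K * (MIdx d m).card ^ 2 * n * (∑ i, a i + ∑ i, b i) := by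
  have h1 : ∑ α ∈ MIdx d m, ∑ β ∈ MIdx d m, ∑ i, ∑ j, B α β i j * P α β i j ≤
      ∑ α ∈ MIdx d m, ∑ β ∈ MIdx d m, ∑ i, ∑ j, (B α β i j * Q α β i j + K * (a i + b j)) := by
    refine Finset.sum_le_sum fun α hα => Finset.sum_le_sum fun β hβ => Finset.sum_le_sum
      fun i _ => Finset.sum_le_sum fun j _ => ?_
    have h2 := h α hα β hβ i j
    have h3 := mul_le_mul (hB.bound α β i j) h2 (abs_nonneg _) hK
    rw [← abs_mul, mul_sub] at h3
    linarith [le_of_abs_le h3]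
  refine h1.trans (le_of_eq ?_)
  simp only [Finset.sum_add_distrib, Finset.sum_const, nsmul_eq_mul, ← Finset.mul_sum, mul_add,
    Finset.card_univ, Fintype.card_fin]
  ring

theorem le_of_absorption {lam Q P c C A L X E : ℝ} (hlam : 0 < lam) (hQ : 0 ≤ Q) (hP : 0 ≤ P)
    (hA : 0 ≤ A) (hE : 0 ≤ E) (hX : 0 ≤ X) (hc : 0 ≤ c) (hC : 0 ≤ C)
    (h1 : lam * A ≤ 2 * c * X + Q * (lam / (4 * (Q + 1)) * A) + P * L)
    (h2 : L ≤ lam / (4 * (P + 1)) * A + C * E) :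
    A ≤ 2 / lam * (2 * c + P * C) * (X + E) := by
  have h3 := mul_le_mul_of_nonneg_left h2 hP
  have h4 : ∀ x : ℝ, 0 ≤ x → x * (lam / (4 * (x + 1))) ≤ lam / 4 := by
    intro x hx
    rw [mul_div_assoc', div_le_div_iff₀ (by positivity) (by norm_num)]
    nlinarith
  have h5 := mul_le_mul_of_nonneg_right (h4 Q hQ) hA
  have h6 := mul_le_mul_of_nonneg_right (h4 P hP) hA
  have h7 : lam / 2 * A ≤ 2 * c * X + P * C * E := by
    rw [mul_add] at h3
    linarith
  have h8 : A ≤ 2 / lam * (2 * c * X + P * C * E) := by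
    have := mul_le_mul_of_nonneg_left h7 (show 0 ≤ 2 / lam by positivity)
    rwa [← mul_assoc, show 2 / lam * (lam / 2) = 1 by field_simp, one_mul] at this
  have h9 : 0 ≤ 2 * c * E := by positivity
  have h10 : 0 ≤ P * C * X := by positivity
  have h11 : 2 * c * X + P * C * E ≤ (2 * c + P * C) * (X + E) := by linarith
  refine h8.trans ((mul_le_mul_of_nonneg_left h11 (by positivity)).trans (le_of_eq ?_))
  ring

variable (N) in
/-- Coercivity of the localized bilinear form. -/
theorem exists_energy_le_of_test (n σ : ℕ) {m : ℕ} (hm : 1 ≤ m) {K lam : ℝ} (hK : 0 ≤ K)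
    (hlam : 0 < lam) :
    ∃ C : ℝ, 0 ≤ C ∧ ∀ B, Admissible d n m K lam B → ∀ w : Fin n → smoothAlg d,
      (∀ i, Van N m (w i)) → ∀ X : ℝ, 0 ≤ X →
      ∑ α ∈ MIdx d m, ∑ β ∈ MIdx d m, ∑ i, ∑ j, B α β i j *
        intU N (multiD α (chi d ^ (2 * (σ + m)) * w i) * multiD β (w j)) ≤ X →
      ∑ i, energy N σ m (w i) ≤ C * (X + ∑ i, energy N σ 0 (w i)) := by
  set c := ((MIdx d m).card : ℝ) with hc
  set Q : ℝ := 2 * c * (K * c ^ 2 * n * 2) with hQ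
  have hQ0 : 0 ≤ Q := by positivity
  obtain ⟨C₁, hC₁, h1⟩ := exists_energy_le_multiD N σ m
  obtain ⟨C₂, hC₂, h2⟩ := exists_cross_le N σ m (ε := lam / (4 * (Q + 1))) (by positivity)
  obtain ⟨C₃, hC₃, h3⟩ := exists_lowEnergy_le N σ m
    (ε := lam / (4 * (Q * C₂ + lam * C₁ + 1))) (by positivity)
  refine ⟨2 / lam * (2 * c + (Q * C₂ + lam * C₁) * C₃), by positivity, fun B hB w hw X hX hX' => ?_⟩
  set A := ∑ i, energy N σ m (w i) with hA
  set L := ∑ i, lowEnergy N σ m (w i) with hL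
  set E := ∑ i, energy N σ 0 (w i) with hE
  have hA0 : 0 ≤ A := Finset.sum_nonneg fun i _ => energy_nonneg _ _ _
  have hE0 : 0 ≤ E := Finset.sum_nonneg fun i _ => energy_nonneg _ _ _
  have i1 : A ≤ 2 * ∑ i, ∑ γ ∈ MIdx d m, intU N (multiD γ (chi d ^ (σ + m) * w i) ^ 2) +
      C₁ * L := by
    rw [hL, Finset.mul_sum, Finset.mul_sum, ← Finset.sum_add_distrib]
    exact Finset.sum_le_sum fun i _ => h1 (w i)
  have i2 := hB.legHad.le_intU hlam.le (N := N) (f := fun i => chi d ^ (σ + m) * w i)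
    (fun i => cut_chi_pow (by omega) _) (fun i => (hw i).mul_left _)
  have i3 := hB.sum_mul_le hK
    (P := fun α β i j => intU N (multiD α (chi d ^ (σ + m) * w i) *
      multiD β (chi d ^ (σ + m) * w j)))
    (Q := fun α β i j => intU N (multiD α (chi d ^ (2 * (σ + m)) * w i) * multiD β (w j)))
    (a := fun i => lam / (4 * (Q + 1)) * energy N σ m (w i) + C₂ * lowEnergy N σ m (w i))
    (b := fun i => lam / (4 * (Q + 1)) * energy N σ m (w i) + C₂ * lowEnergy N σ m (w i))
    (fun α hα β hβ i j => (h2 α hα β hβ (w i) (w j)).trans (le_of_eq (by ring)))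
  rw [Finset.sum_add_distrib, ← Finset.mul_sum, ← Finset.mul_sum, ← hA, ← hL] at i3
  have i4 : L ≤ lam / (4 * (Q * C₂ + lam * C₁ + 1)) * A + C₃ * E := by
    rw [hA, hE, Finset.mul_sum, Finset.mul_sum, ← Finset.sum_add_distrib]
    exact Finset.sum_le_sum fun i _ => h3 (w i) (hw i)
  have hc0 : 0 ≤ c := by positivity
  have i5 := i2.trans (mul_le_mul_of_nonneg_left (i3.trans (add_le_add hX' le_rfl)) hc0)
  have i6 : lam * A ≤ 2 * c * X + Q * (lam / (4 * (Q + 1)) * A) + (Q * C₂ + lam * C₁) * L := by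
    have := mul_le_mul_of_nonneg_left i1 hlam.le
    rw [hQ]
    linarith
  exact le_of_absorption (P := Q * C₂ + lam * C₁) hlam hQ0 (by positivity) hA0 hE0 hX hc0 hC₃ i6 i4

/-- Smooth solutions of the homogeneous Dirichlet problem in the unit half cylinder. -/
structure IsSol (N : Fin d) (m : ℕ) (B : (Fin d → ℕ) → (Fin d → ℕ) → Fin n → Fin n → ℝ)
    (w : Fin n → smoothAlg d) : Prop where
  van : ∀ i, Van N m (w i)
  eq : ∀ p ∈ halfCyl N, ∀ i, (tmD (w i) + (-1 : ℝ) ^ m • ∑ α ∈ MIdx d m, ∑ β ∈ MIdx d m, ∑ j,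
    B α β i j • multiD (α + β) (w j) : smoothAlg d).1 p = 0

variable {m : ℕ} {B : (Fin d → ℕ) → (Fin d → ℕ) → Fin n → Fin n → ℝ} {w : Fin n → smoothAlg d}

theorem dirDer_eq_zero_of_halfCyl {f : smoothAlg d} (hf : ∀ p ∈ halfCyl N, f.1 p = 0)
    (e : ℝ × EuclideanSpace ℝ (Fin d)) : ∀ p ∈ halfCyl N, (dirDer e f).1 p = 0 := by
  intro p hp
  rw [dirDer_apply]
  have h : f.1 =ᶠ[𝓝 p] fun _ => 0 := by
    filter_upwards [(isOpen_halfCyl N).mem_nhds hp] with q hq using hf q hq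
  rw [h.fderiv_eq]
  simp

theorem IsSol.tmD (hw : IsSol N m B w) : IsSol N m B fun i => tmD (w i) := by
  refine ⟨fun i => (hw.van i).tmD, fun p hp i => ?_⟩
  have h := dirDer_eq_zero_of_halfCyl (fun p hp => hw.eq p hp i) (1, 0) p hp
  rw [← h]
  change _ = (_root_.tmD _ : smoothAlg d).1 p
  simp only [map_add, Derivation.map_smul, map_sum, multiD_tmD]

theorem IsSol.spD (hw : IsSol N m B w) {k : Fin d} (hk : k ≠ N) :
    IsSol N m B fun i => spD k (w i) := by
  refine ⟨fun i => (hw.van i).spD hk, fun p hp i => ?_⟩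
  have h := dirDer_eq_zero_of_halfCyl (fun p hp => hw.eq p hp i) (0, EuclideanSpace.single k 1) p hp
  rw [← h]
  change _ = (_root_.spD k _ : smoothAlg d).1 p
  simp only [map_add, Derivation.map_smul, map_sum, multiD_spD, spD_multiD, spD_tmD]

/-- The weak formulation. -/
theorem IsSol.test (hw : IsSol N m B w) {φ : Fin n → smoothAlg d} (hφ : ∀ i, Cut (φ i))
    (hv : ∀ i, Van N m (φ i)) :
    ∑ i, intU N (φ i * _root_.tmD (w i)) + ∑ α ∈ MIdx d m, ∑ β ∈ MIdx d m, ∑ i, ∑ j,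
      B α β i j * intU N (multiD α (φ i) * multiD β (w j)) = 0 := by
  have h : ∀ i, intU N (φ i * _root_.tmD (w i)) + ∑ α ∈ MIdx d m, ∑ β ∈ MIdx d m, ∑ j,
      B α β i j * intU N (multiD α (φ i) * multiD β (w j)) = 0 := by
    intro i
    have h1 : intU N (φ i * (_root_.tmD (w i) + (-1 : ℝ) ^ m • ∑ α ∈ MIdx d m, ∑ β ∈ MIdx d m, ∑ j,
        B α β i j • multiD (α + β) (w j))) = intU N 0 := by
      refine intU_congr N fun p hp => ?_
      have h2 := hw.eq p hp i
      change (φ i).1 p * _ = 0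
      rw [h2, mul_zero]
    rw [map_zero, mul_add, map_add] at h1
    rw [← h1]
    congr 1
    simp only [mul_smul_comm, map_smul, smul_eq_mul, Finset.mul_sum, map_sum]
    refine Finset.sum_congr rfl fun α hα => Finset.sum_congr rfl fun β _ =>
      Finset.sum_congr rfl fun j _ => ?_
    have hα' := mem_MIdx.1 hα
    rw [multiD_add, intU_mul_multiD α (hφ i) (by rw [hα']; exact hv i), hα']
    have : ((-1 : ℝ) ^ m) * (-1) ^ m = 1 := by rw [← mul_pow]; norm_num
    linear_combination (-(B α β i j * intU N (multiD α (φ i) * multiD β (w j)))) * this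
  have h3 := Finset.sum_congr (rfl : (Finset.univ : Finset (Fin n)) = _) fun i _ => h i
  rw [Finset.sum_add_distrib, Finset.sum_const_zero] at h3
  rw [← h3]
  congr 1
  symm
  rw [Finset.sum_comm]
  exact Finset.sum_congr rfl fun α _ => Finset.sum_comm

end Caccioppoli

noncomputable section SolutionEstimates

variable {d n : ℕ} {N : Fin d}

variable (N) in
theorem exists_neg_intU_mul_tmD_le (σ : ℕ) {m : ℕ} (hm : 1 ≤ m) :
    ∃ M : ℝ, 0 ≤ M ∧ ∀ f : smoothAlg d,
      - intU N (chi d ^ (2 * (σ + m)) * f * tmD f) ≤ M * energy N σ 0 f := by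
  set a : smoothAlg d := ((σ + m : ℕ) : smoothAlg d) * (chi d ^ (2 * m - 1) * tmD (chi d)) with ha
  obtain ⟨M, hM, hM'⟩ := exists_bound_halfCyl N a
  refine ⟨M, hM, fun f => ?_⟩
  have e1 : (2 : ℝ) • (chi d ^ (2 * (σ + m)) * f * tmD f + a * (chi d ^ σ * f) ^ 2) =
      tmD (chi d ^ (2 * (σ + m)) * (f * f)) := by
    rw [Derivation.leibniz, Derivation.leibniz, Derivation.leibniz_pow, ha,
      show 2 * (σ + m) - 1 = 2 * σ + (2 * m - 1) by omega, two_smul]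
    simp only [smul_eq_mul, nsmul_eq_mul]
    push_cast
    ring
  have e2 : 0 ≤ intU N (tmD (chi d ^ (2 * (σ + m)) * (f * f))) := by
    refine (cut_chi_pow (by omega) _).intU_tmD_nonneg fun p => ?_
    exact mul_nonneg (pow_nonneg (chi_nonneg p) _) (mul_self_nonneg _)
  rw [← e1, map_smul, map_add, smul_eq_mul] at e2
  have e3 : intU N (a * (chi d ^ σ * f) ^ 2) ≤ intU N (M • (chi d ^ σ * f) ^ 2) :=
    intU_mono N fun p hp => mul_le_mul_of_nonneg_right ((le_abs_self _).trans (hM' p hp))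
      (sq_nonneg _)
  rw [map_smul, smul_eq_mul] at e3
  rw [energy_zero]
  linarith

variable (N) in
/-- The Caccioppoli inequality. -/
theorem exists_lowEnergy_succ_le (n σ : ℕ) {m : ℕ} (hm : 1 ≤ m) {K lam : ℝ} (hK : 0 ≤ K)
    (hlam : 0 < lam) :
    ∃ C : ℝ, 0 ≤ C ∧ ∀ B, Admissible d n m K lam B → ∀ w : Fin n → smoothAlg d, IsSol N m B w →
      ∑ i, lowEnergy N σ (m + 1) (w i) ≤ C * ∑ i, energy N σ 0 (w i) := by
  obtain ⟨M, hM, h1⟩ := exists_neg_intU_mul_tmD_le N σ hm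
  obtain ⟨C, hC, h2⟩ := exists_energy_le_of_test N n σ hm hK hlam
  obtain ⟨C', hC', h3⟩ := exists_lowEnergy_le N σ m one_pos
  refine ⟨2 * (C * (M + 1)) + C', by positivity, fun B hB w hw => ?_⟩
  set E := ∑ i, energy N σ 0 (w i) with hE
  have hE0 : 0 ≤ E := Finset.sum_nonneg fun i _ => energy_nonneg _ _ _
  have i1 := hw.test (φ := fun i => chi d ^ (2 * (σ + m)) * w i)
    (fun i => cut_chi_pow (by omega) _) (fun i => (hw.van i).mul_left _)
  have i2 : - ∑ i, intU N (chi d ^ (2 * (σ + m)) * w i * tmD (w i)) ≤ M * E := by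
    rw [hE, Finset.mul_sum, ← Finset.sum_neg_distrib]
    exact Finset.sum_le_sum fun i _ => h1 (w i)
  have i3 := h2 B hB w hw.van (M * E) (by positivity) (by linarith)
  have i4 : ∑ i, lowEnergy N σ (m + 1) (w i) ≤ 2 * ∑ i, energy N σ m (w i) + C' * E := by
    rw [hE, Finset.mul_sum, Finset.mul_sum, ← Finset.sum_add_distrib]
    refine Finset.sum_le_sum fun i _ => ?_
    have := h3 (w i) (hw.van i)
    have e : lowEnergy N σ (m + 1) (w i) = lowEnergy N σ m (w i) + energy N σ m (w i) :=
      Finset.sum_range_succ _ _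
    rw [e]
    linarith
  refine i4.trans (le_of_le_of_eq (add_le_add (mul_le_mul_of_nonneg_left i3 zero_le_two) le_rfl) ?_)
  rw [← hE]
  ring

variable (N) in
/-- The time derivative of a solution is controlled by the solution. -/
theorem exists_energy_tmD_le (n σ : ℕ) {m : ℕ} (hm : 1 ≤ m) {K lam : ℝ} (hK : 0 ≤ K)
    (hlam : 0 < lam) :
    ∃ C : ℝ, 0 ≤ C ∧ ∀ B, Admissible d n m K lam B → ∀ w : Fin n → smoothAlg d, IsSol N m B w →
      ∑ i, energy N (σ + 2 * m) 0 (tmD (w i)) ≤ C * ∑ i, energy N σ 0 (w i) := by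
  set τ := σ + 2 * m with hτ
  obtain ⟨S, C₁, hC₁, hS⟩ := exists_commutator N τ (σ + m) m
  obtain ⟨C₂, hC₂, h2⟩ := exists_lowEnergy_succ_le N n σ hm hK hlam
  obtain ⟨C₃, hC₃, h3⟩ := exists_lowEnergy_succ_le N n τ hm hK hlam
  set Q : ℝ := K * ((MIdx d m).card : ℝ) ^ 2 * n with hQ
  have hQ0 : 0 ≤ Q := by positivity
  set ε : ℝ := 1 / (2 * (Q * ((2 + 2 * C₁) * C₃) + 1)) with hε
  have hε0 : 0 < ε := by positivity
  refine ⟨2 * (Q * (ε⁻¹ * C₂)), by positivity, fun B hB w hw => ?_⟩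
  have hv := hw.tmD
  have i1 := hw.test (φ := fun i => chi d ^ (2 * τ) * tmD (w i))
    (fun i => cut_chi_pow (by omega) _) (fun i => (hv.van i).mul_left _)
  have i2 := hB.sum_mul_le hK
    (P := fun α β i j => - intU N (multiD α (chi d ^ (2 * τ) * tmD (w i)) * multiD β (w j)))
    (Q := fun α β i j => 0)
    (a := fun i => ε * ((2 + 2 * C₁) * lowEnergy N τ (m + 1) (tmD (w i))))
    (b := fun i => ε⁻¹ * lowEnergy N σ (m + 1) (w i))
    (fun α hα β hβ i j => by
      have e1 := (hS α hα).1 (tmD (w i))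
      rw [show σ + m + (τ + m) = 2 * τ by omega] at e1
      have e2 : multiD α (chi d ^ (2 * τ) * tmD (w i)) * multiD β (w j) =
          (chi d ^ (τ + m) * multiD α (tmD (w i)) + S α (tmD (w i))) *
            (chi d ^ (σ + m) * multiD β (w j)) := by
        rw [e1]; ring
      rw [sub_zero, abs_neg, e2]
      refine (intU_mul_le hε0 _ _).trans (add_le_add ?_ ?_)
      · refine mul_le_mul_of_nonneg_left ((intU_add_sq_le _ _).trans ?_) hε0.le
        have l1 := intU_sq_le_energy (N := N) τ (mem_MIdx.1 hα) (tmD (w i))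
        have l2 := energy_le_lowEnergy (N := N) τ (Nat.lt_succ_self m) (tmD (w i))
        have l3 := (hS α hα).2 (tmD (w i))
        have l4 : lowEnergy N τ (m + 1) (tmD (w i)) =
            lowEnergy N τ m (tmD (w i)) + energy N τ m (tmD (w i)) := Finset.sum_range_succ _ _
        have l5 : lowEnergy N τ m (tmD (w i)) ≤ lowEnergy N τ (m + 1) (tmD (w i)) := by
          rw [l4]; linarith [energy_nonneg (N := N) τ m (tmD (w i))]
        have l6 := mul_le_mul_of_nonneg_left l5 hC₁
        rw [Nat.succ_eq_add_one] at l2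
        linarith
      · exact mul_le_mul_of_nonneg_left ((intU_sq_le_energy σ (mem_MIdx.1 hβ) (w j)).trans
          (energy_le_lowEnergy σ (Nat.lt_succ_self m) (w j))) (inv_nonneg.2 hε0.le))
  simp only [mul_neg, mul_zero, Finset.sum_neg_distrib, Finset.sum_const_zero, zero_add] at i2
  rw [← Finset.mul_sum, ← Finset.mul_sum, ← Finset.mul_sum, ← hQ] at i2
  have i3 : ∑ i, energy N τ 0 (tmD (w i)) =
      ∑ i, intU N (chi d ^ (2 * τ) * tmD (w i) * tmD (w i)) := by
    refine Finset.sum_congr rfl fun i _ => ?_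
    rw [energy_zero]
    congr 1
    ring
  have i4 := h3 B hB _ hv
  have i5 := h2 B hB w hw
  set V := ∑ i, energy N τ 0 (tmD (w i)) with hV
  have hV0 : 0 ≤ V := Finset.sum_nonneg fun i _ => energy_nonneg _ _ _
  have i6 : V ≤ Q * (ε * ((2 + 2 * C₁) * (C₃ * V)) + ε⁻¹ * (C₂ * ∑ i, energy N σ 0 (w i))) := by
    refine le_trans (by rw [i3]; linarith)
      (i2.trans (mul_le_mul_of_nonneg_left (add_le_add ?_ ?_) hQ0))
    · exact mul_le_mul_of_nonneg_left (mul_le_mul_of_nonneg_left i4 (by positivity)) hε0.le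
    · exact mul_le_mul_of_nonneg_left i5 (inv_nonneg.2 hε0.le)
  have i7 : ε * (Q * ((2 + 2 * C₁) * C₃)) ≤ 1 / 2 := by
    rw [hε, one_div_mul_eq_div, div_le_div_iff₀ (by positivity) (by norm_num)]
    linarith
  have i8 := mul_le_mul_of_nonneg_right i7 hV0
  linarith

end SolutionEstimates

noncomputable section Boxes

variable {d : ℕ} {N : Fin d}

/-- The coordinate directions, time being reversed. -/
def dirVec : Option (Fin d) → ℝ × EuclideanSpace ℝ (Fin d)
  | none => (-1, 0)
  | some i => (0, EuclideanSpace.single i 1)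

/-- The coordinates dual to `dirVec`. -/
def dirCoord : Option (Fin d) → (ℝ × EuclideanSpace ℝ (Fin d)) →L[ℝ] ℝ
  | none => -ContinuousLinearMap.fst ℝ ℝ (EuclideanSpace ℝ (Fin d))
  | some i => spCoord i

theorem dirCoord_dirVec (κ κ' : Option (Fin d)) :
    dirCoord κ (dirVec κ') = if κ = κ' then 1 else 0 := by
  cases κ <;> cases κ' <;> simp [dirCoord, dirVec, spCoord, PiLp.single_apply]

theorem dirCoord_line (κ κ' : Option (Fin d)) (x : ℝ × EuclideanSpace ℝ (Fin d)) (s : ℝ) :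
    dirCoord κ (x + s • dirVec κ') = dirCoord κ x + if κ = κ' then s else 0 := by
  rw [map_add, map_smul, dirCoord_dirVec]
  simp

/-- Open boxes. -/
def box (lo hi : Option (Fin d) → ℝ) : Set (ℝ × EuclideanSpace ℝ (Fin d)) :=
  {p | ∀ κ, dirCoord κ p ∈ Ioo (lo κ) (hi κ)}

theorem isOpen_box (lo hi : Option (Fin d) → ℝ) : IsOpen (box lo hi) := by
  have : box lo hi = ⋂ κ, dirCoord κ ⁻¹' Ioo (lo κ) (hi κ) := by
    ext p
    simp [box]
  rw [this]
  exact isOpen_iInter_of_finite fun κ => isOpen_Ioo.preimage (dirCoord κ).continuous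

theorem mem_box_line_iff {lo hi : Option (Fin d) → ℝ} {κ : Option (Fin d)}
    {x : ℝ × EuclideanSpace ℝ (Fin d)} (hx : dirCoord κ x = 0) (s : ℝ) :
    x + s • dirVec κ ∈ box lo hi ↔
      (∀ κ', κ' ≠ κ → dirCoord κ' x ∈ Ioo (lo κ') (hi κ')) ∧ s ∈ Ioo (lo κ) (hi κ) := by
  refine ⟨fun h => ⟨fun κ' hκ' => ?_, ?_⟩, fun h κ' => ?_⟩
  · have := h κ'
    rwa [dirCoord_line, if_neg hκ', add_zero] at this
  · have := h κ
    rwa [dirCoord_line, if_pos rfl, hx, zero_add] at this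
  · rw [dirCoord_line]
    by_cases hne : κ' = κ
    · subst hne
      rw [if_pos rfl, hx, zero_add]
      exact h.2
    · rw [if_neg hne, add_zero]
      exact h.1 κ' hne

/-- Integrals over boxes are compared along lines. -/
theorem setIntegral_box_le {lo hi lo' hi' : Option (Fin d) → ℝ} (κ : Option (Fin d))
    (hlo : ∀ κ', κ' ≠ κ → lo' κ' = lo κ') (hhi : ∀ κ', κ' ≠ κ → hi' κ' = hi κ')
    {F F' : smoothAlg d} (hF : IntegrableOn F.1 (box lo hi)) (hF' : IntegrableOn F'.1 (box lo' hi'))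
    (h : ∀ x, dirCoord κ x = 0 → (∀ κ', κ' ≠ κ → dirCoord κ' x ∈ Ioo (lo κ') (hi κ')) →
      ∫ s in Ioo (lo' κ) (hi' κ), F'.1 (x + s • dirVec κ) ≤
        ∫ s in Ioo (lo κ) (hi κ), F.1 (x + s • dirVec κ)) :
    ∫ p in box lo' hi', F'.1 p ≤ ∫ p in box lo hi, F.1 p := by
  have hm := (isOpen_box lo hi).measurableSet
  have hm' := (isOpen_box lo' hi').measurableSet
  have hi1 := hF.integrable_indicator hm
  have hi2 := hF'.integrable_indicator hm'
  rw [← integral_indicator hm, ← integral_indicator hm', ← sub_nonneg, ← integral_sub hi1 hi2]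
  have := isAddHaarMeasure_volume_prod (d := d)
  refine integral_nonneg_of_lines volume (dirCoord κ) (e := dirVec κ)
    (by rw [dirCoord_dirVec, if_pos rfl]) (hi1.sub hi2) fun x => ?_
  set y := x - dirCoord κ x • dirVec κ with hy
  have hy0 : dirCoord κ y = 0 := by
    rw [hy, map_sub, map_smul, dirCoord_dirVec, if_pos rfl]
    simp
  have hxy : ∀ s : ℝ, x + s • dirVec κ = y + (s + dirCoord κ x) • dirVec κ := fun s => by
    rw [hy, add_smul]
    abel
  simp only [hxy]
  rw [integral_add_right_eq_self (fun s : ℝ => (box lo hi).indicator F.1 (y + s • dirVec κ) -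
    (box lo' hi').indicator F'.1 (y + s • dirVec κ))]
  by_cases hP : ∀ κ', κ' ≠ κ → dirCoord κ' y ∈ Ioo (lo κ') (hi κ')
  · have hP' : ∀ κ', κ' ≠ κ → dirCoord κ' y ∈ Ioo (lo' κ') (hi' κ') := fun κ' hκ' => by
      rw [hlo κ' hκ', hhi κ' hκ']
      exact hP κ' hκ'
    have e : ∀ (f : smoothAlg d) (l u : Option (Fin d) → ℝ),
        (∀ κ', κ' ≠ κ → dirCoord κ' y ∈ Ioo (l κ') (u κ')) →
        (fun s : ℝ => (box l u).indicator f.1 (y + s • dirVec κ)) =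
          (Ioo (l κ) (u κ)).indicator fun s => f.1 (y + s • dirVec κ) := by
      intro f l u hlu
      ext s
      by_cases hs : s ∈ Ioo (l κ) (u κ)
      · rw [indicator_of_mem hs, indicator_of_mem ((mem_box_line_iff hy0 s).2 ⟨hlu, hs⟩)]
      · rw [indicator_of_notMem hs,
          indicator_of_notMem fun hc => hs ((mem_box_line_iff hy0 s).1 hc).2]
    have hint : ∀ (f : smoothAlg d) (l u : ℝ),
        Integrable ((Ioo l u).indicator fun s => f.1 (y + s • dirVec κ)) := fun f l u =>
      (((contDiff_line f y (dirVec κ)).continuous.continuousOn.integrableOn_compact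
        isCompact_Icc).mono_set Ioo_subset_Icc_self).integrable_indicator measurableSet_Ioo
    rw [integral_sub (by rw [e F lo hi hP]; exact hint _ _ _)
      (by rw [e F' lo' hi' hP']; exact hint _ _ _), e F lo hi hP, e F' lo' hi' hP',
      integral_indicator measurableSet_Ioo, integral_indicator measurableSet_Ioo, sub_nonneg]
    exact h y hy0 hP
  · have hP' : ¬ ∀ κ', κ' ≠ κ → dirCoord κ' y ∈ Ioo (lo' κ') (hi' κ') :=
      fun hc => hP fun κ' hκ' => by
      rw [← hlo κ' hκ', ← hhi κ' hκ']
      exact hc κ' hκ'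
    refine (integral_eq_zero_of_ae (Filter.Eventually.of_forall fun s => ?_)).ge
    change (box lo hi).indicator F.1 (y + s • dirVec κ) -
      (box lo' hi').indicator F'.1 (y + s • dirVec κ) = 0
    rw [indicator_of_notMem fun hc => hP ((mem_box_line_iff hy0 s).1 hc).1,
      indicator_of_notMem fun hc => hP' ((mem_box_line_iff hy0 s).1 hc).1, sub_zero]

/-- The side length of the unit box. -/
def side (d : ℕ) : ℝ := 1 / (2 * d)

/-- Lower ends of the sides of the box of size `ρ`. -/
def loEnd (N : Fin d) (ρ : Option (Fin d) → ℝ) (κ : Option (Fin d)) : ℝ :=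
  if κ = none ∨ κ = some N then 0 else - ρ κ

/-- The box of size `ρ` touching the flat boundary and the final time. -/
def sbox (N : Fin d) (ρ : Option (Fin d) → ℝ) : Set (ℝ × EuclideanSpace ℝ (Fin d)) :=
  box (loEnd N ρ) ρ

theorem side_pos (N : Fin d) : 0 < side d := by
  have : 0 < d := N.pos
  have : (0 : ℝ) < d := by exact_mod_cast this
  unfold side
  positivity

theorem side_le (N : Fin d) : side d ≤ 1 / 2 := by
  have : (1 : ℝ) ≤ d := by exact_mod_cast N.pos
  unfold side
  gcongr
  linarith

theorem abs_dirCoord_le_of_lower {ρ : Option (Fin d) → ℝ} {κ : Option (Fin d)} {x : ℝ}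
    (hx : x ∈ Icc (loEnd N ρ κ) (ρ κ)) : |x| ≤ ρ κ := by
  unfold loEnd at hx
  split_ifs at hx with h
  · rw [abs_of_nonneg hx.1]
    exact hx.2
  · exact abs_le.2 hx

theorem norm_le_of_dirCoord (N : Fin d) {p : ℝ × EuclideanSpace ℝ (Fin d)}
    (hp : ∀ κ, |dirCoord κ p| ≤ side d) : ‖p‖ ≤ 1 / 2 := by
  have hs := side_pos N
  rw [Prod.norm_def]
  refine max_le ?_ ?_
  · have := hp none
    simp only [dirCoord, neg_apply, ContinuousLinearMap.coe_fst', abs_neg] at this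
    exact this.trans (side_le N)
  · rw [EuclideanSpace.norm_eq, Real.sqrt_le_left (by norm_num)]
    have h1 : ∀ i, ‖p.2 i‖ ^ 2 ≤ side d ^ 2 := fun i =>
      pow_le_pow_left₀ (norm_nonneg _) (hp (some i)) 2
    refine (Finset.sum_le_sum fun i _ => h1 i).trans ?_
    rw [Finset.sum_const, Finset.card_univ, Fintype.card_fin, nsmul_eq_mul]
    have h2 : (d : ℝ) * side d = 1 / 2 := by
      have : (d : ℝ) ≠ 0 := by exact_mod_cast N.pos.ne'
      unfold side
      field_simp
    rw [sq, ← mul_assoc, h2]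
    linarith [side_le N]

theorem norm_le_of_mem_sbox {ρ : Option (Fin d) → ℝ} (hρ : ∀ κ, ρ κ ≤ side d)
    {p : ℝ × EuclideanSpace ℝ (Fin d)} (hp : p ∈ sbox N ρ) : ‖p‖ ≤ 1 / 2 :=
  norm_le_of_dirCoord N fun κ =>
    (abs_dirCoord_le_of_lower (Ioo_subset_Icc_self (hp κ))).trans (hρ κ)

theorem sbox_subset_halfCyl {ρ : Option (Fin d) → ℝ} (hρ : ∀ κ, ρ κ ≤ side d) :
    sbox N ρ ⊆ halfCyl N := by
  intro p hp
  have h1 := norm_le_of_mem_sbox hρ hp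
  have h2 := hp none
  have h3 := hp (some N)
  simp only [loEnd, true_or, or_true, if_true, dirCoord, neg_apply,
    ContinuousLinearMap.coe_fst', mem_Ioo] at h2 h3
  have h4 := side_le N
  have h5 := hρ none
  refine ⟨⟨by linarith, by linarith⟩, ?_, h3.1⟩
  rw [mem_ball, dist_zero_right]
  exact ((norm_snd_le p).trans h1).trans_lt (by norm_num)

theorem integrableOn_sbox {ρ : Option (Fin d) → ℝ} (hρ : ∀ κ, ρ κ ≤ side d) (f : smoothAlg d) :
    IntegrableOn f.1 (sbox N ρ) :=
  (integrableOn_halfCyl N f).mono_set (sbox_subset_halfCyl hρ)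

variable (N) in
/-- Integration over the unit box. -/
theorem setIntegral_sbox_sq_le_energy {ρ : Option (Fin d) → ℝ} (hρ : ∀ κ, ρ κ ≤ side d) (σ : ℕ)
    (γ : Fin d → ℕ) (f : smoothAlg d) :
    ∫ p in sbox N ρ, (multiD γ f ^ 2).1 p ≤ energy N σ (∑ i, γ i) f := by
  refine le_trans ?_ (intU_sq_le_energy σ rfl f)
  have h1 : ∫ p in sbox N ρ, (multiD γ f ^ 2).1 p =
      ∫ p in sbox N ρ, ((chi d ^ (σ + ∑ i, γ i) * multiD γ f) ^ 2).1 p := by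
    refine setIntegral_congr_fun (isOpen_box _ _).measurableSet fun p hp => ?_
    change (multiD γ f).1 p ^ 2 = ((chi d).1 p ^ (σ + ∑ i, γ i) * (multiD γ f).1 p) ^ 2
    rw [chi_eq_one (norm_le_of_mem_sbox hρ hp), one_pow, one_mul]
  rw [h1, intU_apply]
  exact setIntegral_mono_set (integrableOn_halfCyl N _)
    (Filter.Eventually.of_forall fun p => sq_nonneg _)
    (Filter.Eventually.of_forall (sbox_subset_halfCyl hρ))

end Boxes

noncomputable section DerivativeControl

variable {d n : ℕ} {N : Fin d}

/-- The derivations along the coordinate directions. -/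
def dirD : Option (Fin d) → Derivation ℝ (smoothAlg d) (smoothAlg d)
  | none => tmD
  | some i => spD i

theorem IsSol.dirD {m : ℕ} {B : (Fin d → ℕ) → (Fin d → ℕ) → Fin n → Fin n → ℝ}
    {w : Fin n → smoothAlg d} (hw : IsSol N m B w) {κ : Option (Fin d)} (hκ : κ ≠ some N) :
    IsSol N m B fun i => dirD κ (w i) := by
  cases κ with
  | none => exact hw.tmD
  | some i => exact hw.spD fun h => hκ (by rw [h])

variable (N) in
/-- Tangential and time derivatives of a solution are controlled by the solution. -/
theorem exists_energy_dirD_le (n σ : ℕ) {m : ℕ} (hm : 1 ≤ m) {K lam : ℝ} (hK : 0 ≤ K)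
    (hlam : 0 < lam) (κ : Option (Fin d)) :
    ∃ (σ' : ℕ) (C : ℝ), 0 ≤ C ∧ ∀ B, Admissible d n m K lam B → ∀ w : Fin n → smoothAlg d,
      IsSol N m B w →
      ∑ i, energy N σ' 0 (dirD κ (w i)) ≤ C * ∑ i, energy N σ 0 (w i) := by
  cases κ with
  | none => exact ⟨_, exists_energy_tmD_le N n σ hm hK hlam⟩
  | some k =>
    obtain ⟨C, hC, h⟩ := exists_lowEnergy_succ_le N n σ hm hK hlam
    refine ⟨σ + 1, C, hC, fun B hB w hw => (Finset.sum_le_sum fun i _ => ?_).trans (h B hB w hw)⟩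
    refine le_trans ?_ (energy_le_lowEnergy σ (Nat.lt_succ_of_le hm) (w i))
    have := intU_sq_le_energy (N := N) σ (k := 1) (γ := Pi.single k 1) (by simp) (w i)
    rw [multiD_single_one] at this
    rw [energy_zero]
    exact this

variable (N) in
theorem exists_energy_multiD_le (n : ℕ) {m : ℕ} (hm : 1 ≤ m) {K lam : ℝ} (hK : 0 ≤ K)
    (hlam : 0 < lam) (δ : Fin d → ℕ) (hδ : δ N = 0) (σ : ℕ) :
    ∃ (σ' : ℕ) (C : ℝ), 0 ≤ C ∧ ∀ B, Admissible d n m K lam B → ∀ w : Fin n → smoothAlg d,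
      IsSol N m B w → IsSol N m B (fun i => multiD δ (w i)) ∧
      ∑ i, energy N σ' 0 (multiD δ (w i)) ≤ C * ∑ i, energy N σ 0 (w i) := by
  induction δ using multiIndex_induction with
  | h0 => exact ⟨σ, 1, zero_le_one, fun B hB w hw => by simpa [multiD_zero] using hw⟩
  | hs γ k ih =>
    have hk : k ≠ N := by
      rintro rfl
      simp at hδ
    obtain ⟨σ₁, C₁, hC₁, h1⟩ := ih (by simpa [hk.symm] using hδ)
    obtain ⟨σ₂, C₂, hC₂, h2⟩ := exists_energy_dirD_le N n σ₁ hm hK hlam (some k)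
    refine ⟨σ₂, C₂ * C₁, by positivity, fun B hB w hw => ?_⟩
    obtain ⟨h3, h4⟩ := h1 B hB w hw
    have h5 := h3.spD hk
    have h6 := h2 B hB _ h3
    simp only [spD_multiD, dirD] at h5 h6
    refine ⟨h5, h6.trans ?_⟩
    rw [mul_assoc]
    exact mul_le_mul_of_nonneg_left h4 hC₂

/-- The multi-indices of size at most `2 m` with normal order at most `m`. -/
def derIdx (N : Fin d) (m : ℕ) : Finset (Fin d → ℕ) :=
  (Fintype.piFinset fun _ : Fin d => Finset.range (2 * m + 1)).filter fun γ => γ N ≤ m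

theorem mem_derIdx {m : ℕ} {γ : Fin d → ℕ} (h : ∑ i, γ i ≤ 2 * m) (hN : γ N ≤ m) :
    γ ∈ derIdx N m := by
  simp only [derIdx, Finset.mem_filter, Fintype.mem_piFinset, Finset.mem_range]
  refine ⟨fun i => ?_, hN⟩
  have := Finset.single_le_sum (f := γ) (fun i _ => Nat.zero_le _) (Finset.mem_univ i)
  omega

/-- The sum of the squares of the derivatives that occur in the boundary argument. -/
def derSq (N : Fin d) (m : ℕ) (w : Fin n → smoothAlg d) : smoothAlg d :=
  ∑ j, (∑ γ ∈ derIdx N m, multiD γ (w j) ^ 2 + tmD (w j) ^ 2)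

theorem derSq_apply (m : ℕ) (w : Fin n → smoothAlg d) (p : ℝ × EuclideanSpace ℝ (Fin d)) :
    (derSq N m w).1 p =
      ∑ j, (∑ γ ∈ derIdx N m, (multiD γ (w j)).1 p ^ 2 + (tmD (w j)).1 p ^ 2) := by
  simp [derSq, Finset.sum_apply]

theorem derSq_nonneg (m : ℕ) (w : Fin n → smoothAlg d) (p : ℝ × EuclideanSpace ℝ (Fin d)) :
    0 ≤ (derSq N m w).1 p := by
  rw [derSq_apply]
  positivity

theorem sq_multiD_le_derSq {m : ℕ} (w : Fin n → smoothAlg d) (j : Fin n) {γ : Fin d → ℕ}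
    (hγ : γ ∈ derIdx N m) (p : ℝ × EuclideanSpace ℝ (Fin d)) :
    (multiD γ (w j)).1 p ^ 2 ≤ (derSq N m w).1 p := by
  rw [derSq_apply]
  refine le_trans ?_ (Finset.single_le_sum (f := fun j => ∑ γ ∈ derIdx N m,
    (multiD γ (w j)).1 p ^ 2 + (tmD (w j)).1 p ^ 2) (fun _ _ => by positivity) (Finset.mem_univ j))
  have h := Finset.single_le_sum (f := fun γ => (multiD γ (w j)).1 p ^ 2)
    (fun _ _ => sq_nonneg _) hγ
  have := sq_nonneg ((tmD (w j)).1 p)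
  linarith

theorem sq_tmD_le_derSq (m : ℕ) (w : Fin n → smoothAlg d) (j : Fin n)
    (p : ℝ × EuclideanSpace ℝ (Fin d)) : (tmD (w j)).1 p ^ 2 ≤ (derSq N m w).1 p := by
  rw [derSq_apply]
  refine le_trans ?_ (Finset.single_le_sum (f := fun j => ∑ γ ∈ derIdx N m,
    (multiD γ (w j)).1 p ^ 2 + (tmD (w j)).1 p ^ 2) (fun _ _ => by positivity) (Finset.mem_univ j))
  have : 0 ≤ ∑ γ ∈ derIdx N m, (multiD γ (w j)).1 p ^ 2 := by positivity
  linarith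

theorem setIntegral_sum_sbox {ι : Type*} {ρ : Option (Fin d) → ℝ} (hρ : ∀ κ, ρ κ ≤ side d)
    (s : Finset ι) (f : ι → smoothAlg d) :
    ∫ p in sbox N ρ, (∑ i ∈ s, f i : smoothAlg d).1 p = ∑ i ∈ s, ∫ p in sbox N ρ, (f i).1 p := by
  rw [← integral_finsetSum s fun i _ => integrableOn_sbox hρ (f i)]
  simp [Finset.sum_apply]

variable (N) in
theorem exists_setIntegral_multiD_le (n σ : ℕ) {m : ℕ} (hm : 1 ≤ m) {K lam : ℝ} (hK : 0 ≤ K)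
    (hlam : 0 < lam) (γ : Fin d → ℕ) (hγ : γ N ≤ m) :
    ∃ C : ℝ, 0 ≤ C ∧ ∀ B, Admissible d n m K lam B → ∀ w : Fin n → smoothAlg d, IsSol N m B w →
      ∑ i, ∫ p in sbox N fun _ => side d, (multiD γ (w i) ^ 2).1 p ≤
        C * ∑ i, energy N σ 0 (w i) := by
  set δ := Function.update γ N 0 with hδ
  have e : γ = Pi.single N (γ N) + δ := by
    ext i
    by_cases hi : i = N
    · subst hi; simp [hδ]
    · simp [hδ, hi]
  obtain ⟨σ₁, C₁, hC₁, h1⟩ := exists_energy_multiD_le N n hm hK hlam δ (by simp [hδ]) σ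
  obtain ⟨C₂, hC₂, h2⟩ := exists_lowEnergy_succ_le N n σ₁ hm hK hlam
  refine ⟨C₂ * C₁, by positivity, fun B hB w hw => ?_⟩
  obtain ⟨h3, h4⟩ := h1 B hB w hw
  refine le_trans (Finset.sum_le_sum fun i _ => ?_) ((h2 B hB _ h3).trans ?_)
  · rw [e, multiD_add]
    refine (setIntegral_sbox_sq_le_energy N (fun _ => le_rfl) σ₁ _ _).trans
      (energy_le_lowEnergy σ₁ ?_ _)
    simp
    omega
  · rw [mul_assoc]
    exact mul_le_mul_of_nonneg_left h4 hC₂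

variable (N) in
theorem exists_setIntegral_derSq_le (n σ : ℕ) {m : ℕ} (hm : 1 ≤ m) {K lam : ℝ} (hK : 0 ≤ K)
    (hlam : 0 < lam) :
    ∃ C : ℝ, 0 ≤ C ∧ ∀ B, Admissible d n m K lam B → ∀ w : Fin n → smoothAlg d, IsSol N m B w →
      ∫ p in sbox N fun _ => side d, (derSq N m w).1 p ≤ C * ∑ i, energy N σ 0 (w i) := by
  have h : ∀ γ : Fin d → ℕ, ∃ C : ℝ, 0 ≤ C ∧ (γ N ≤ m → ∀ B, Admissible d n m K lam B →
      ∀ w : Fin n → smoothAlg d, IsSol N m B w →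
      ∑ i, ∫ p in sbox N fun _ => side d, (multiD γ (w i) ^ 2).1 p ≤
        C * ∑ i, energy N σ 0 (w i)) := by
    intro γ
    by_cases hγ : γ N ≤ m
    · obtain ⟨C, hC, h⟩ := exists_setIntegral_multiD_le N n σ hm hK hlam γ hγ
      exact ⟨C, hC, fun _ => h⟩
    · exact ⟨0, le_rfl, fun h => absurd h hγ⟩
  choose C hC h using h
  obtain ⟨σ', C', hC', h'⟩ := exists_energy_dirD_le N n σ hm hK hlam none
  refine ⟨∑ γ ∈ derIdx N m, C γ + C', add_nonneg (Finset.sum_nonneg fun γ _ => hC γ) hC',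
    fun B hB w hw => ?_⟩
  rw [derSq, Finset.sum_add_distrib, Finset.sum_comm]
  have hs := fun (f g : smoothAlg d) => integral_add
    (integrableOn_sbox (N := N) (ρ := fun _ => side d) (fun _ => le_rfl) f)
    (integrableOn_sbox (N := N) (ρ := fun _ => side d) (fun _ => le_rfl) g)
  refine (hs _ _).trans_le ?_
  rw [setIntegral_sum_sbox (fun _ => le_rfl), setIntegral_sum_sbox (fun _ => le_rfl), add_mul,
    Finset.sum_mul]
  refine add_le_add (Finset.sum_le_sum fun γ hγ => ?_) ?_
  · rw [setIntegral_sum_sbox (fun _ => le_rfl)]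
    exact h γ (Finset.mem_filter.1 hγ).2 B hB w hw
  · refine le_trans (Finset.sum_le_sum fun i _ => ?_) (h' B hB w hw)
    have := setIntegral_sbox_sq_le_energy N (ρ := fun _ => side d) (fun _ => le_rfl) σ' 0
      (tmD (w i))
    simpa [multiD_zero, dirD] using this

end DerivativeControl

noncomputable section NormalDirection

variable {d n : ℕ} {N : Fin d}

/-- Pointwise control on lines. -/
theorem exists_sq_line_le (k : ℕ) (hk : 1 ≤ k) (b : ℝ) (hb : 0 < b) :
    ∃ C : ℝ, 0 ≤ C ∧ ∀ (e x : ℝ × EuclideanSpace ℝ (Fin d)) (f E : smoothAlg d) (c l u : ℝ), 0 ≤ c →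
      (∀ t ∈ Ioo l u, f.1 (x + t • e) ^ 2 + ((dirDer e)^[k] f).1 (x + t • e) ^ 2 ≤
        c * E.1 (x + t • e)) →
      (∀ t ∈ Ioo l u, 0 ≤ E.1 (x + t • e)) →
      ∀ s, l ≤ s → s + b ≤ u → f.1 (x + s • e) ^ 2 ≤ C * (c * ∫ t in Ioo l u, E.1 (x + t • e)) := by
  obtain ⟨C, hC, h⟩ := exists_sq_le_integral_sq_add_sq k hk b hb
  refine ⟨C, hC, fun e x f E c l u hc hfE hE s hs hs' => ?_⟩
  have h1 := h (fun k s => ((dirDer e)^[k] f).1 (x + s • e)) (fun k s => by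
    rw [Function.iterate_succ_apply']
    exact hasDerivAt_line _ x e s) s
  refine h1.trans (mul_le_mul_of_nonneg_left ?_ hC)
  have hint : ∀ (g : smoothAlg d), IntegrableOn (fun t => g.1 (x + t • e)) (Ioo l u) :=
    fun g => ((contDiff_line g x e).continuous.continuousOn.integrableOn_compact
      isCompact_Icc).mono_set Ioo_subset_Icc_self
  have hsub : Ioo s (s + b) ⊆ Ioo l u := Ioo_subset_Ioo hs hs'
  rw [intervalIntegral.integral_of_le (by linarith), integral_Ioc_eq_integral_Ioo,
    ← integral_const_mul]
  have hint2 : IntegrableOn (fun t => c * E.1 (x + t • e)) (Ioo l u) :=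
    (hint E).const_mul c
  refine le_trans (setIntegral_mono_on ?_ (hint2.mono_set hsub) measurableSet_Ioo
    fun t ht => hfE t (hsub ht)) (setIntegral_mono_set hint2 ?_
      (Filter.Eventually.of_forall hsub))
  · exact (hint (f ^ 2 + ((dirDer e)^[k] f) ^ 2)).mono_set hsub
  · refine (ae_restrict_iff' measurableSet_Ioo).2 (Filter.Eventually.of_forall fun t ht => ?_)
    exact mul_nonneg hc (hE t ht)

/-- Contraction of the coefficients with a family of functions. -/
def coefSum (m : ℕ) (B : (Fin d → ℕ) → (Fin d → ℕ) → Fin n → Fin n → ℝ)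
    (P : (Fin d → ℕ) → (Fin d → ℕ) → Fin n → smoothAlg d) (i : Fin n) : smoothAlg d :=
  ∑ α ∈ MIdx d m, ∑ β ∈ MIdx d m, ∑ j, B α β i j • P α β j

theorem coefSum_apply (m : ℕ) (B : (Fin d → ℕ) → (Fin d → ℕ) → Fin n → Fin n → ℝ)
    (P : (Fin d → ℕ) → (Fin d → ℕ) → Fin n → smoothAlg d) (i : Fin n)
    (p : ℝ × EuclideanSpace ℝ (Fin d)) : (coefSum m B P i).1 p =
      ∑ α ∈ MIdx d m, ∑ β ∈ MIdx d m, ∑ j, B α β i j * (P α β j).1 p := by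
  simp [coefSum, Finset.sum_apply]

theorem map_coefSum (L : smoothAlg d →ₗ[ℝ] smoothAlg d) (m : ℕ)
    (B : (Fin d → ℕ) → (Fin d → ℕ) → Fin n → Fin n → ℝ)
    (P : (Fin d → ℕ) → (Fin d → ℕ) → Fin n → smoothAlg d) (i : Fin n) :
    L (coefSum m B P i) = coefSum m B (fun α β j => L (P α β j)) i := by
  simp only [coefSum, map_sum, map_smul]

theorem coefSum_add (m : ℕ) (B : (Fin d → ℕ) → (Fin d → ℕ) → Fin n → Fin n → ℝ)
    (P Q : (Fin d → ℕ) → (Fin d → ℕ) → Fin n → smoothAlg d) (i : Fin n) :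
    coefSum m B P i + coefSum m B Q i = coefSum m B (fun α β j => P α β j + Q α β j) i := by
  simp only [coefSum, smul_add, Finset.sum_add_distrib]

/-- The constant in the bound for `coefSum`. -/
def coefConst (d n m : ℕ) (K : ℝ) : ℝ := K * (MIdx d m).card ^ 2 * n

theorem coefConst_nonneg (d n m : ℕ) {K : ℝ} (hK : 0 ≤ K) : 0 ≤ coefConst d n m K := by
  unfold coefConst
  positivity

theorem Admissible.abs_coefSum_le {m : ℕ} {K lam : ℝ}
    {B : (Fin d → ℕ) → (Fin d → ℕ) → Fin n → Fin n → ℝ} (hB : Admissible d n m K lam B)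
    (hK : 0 ≤ K) {P : (Fin d → ℕ) → (Fin d → ℕ) → Fin n → smoothAlg d} {A : ℝ}
    {p : ℝ × EuclideanSpace ℝ (Fin d)}
    (h : ∀ α ∈ MIdx d m, ∀ β ∈ MIdx d m, ∀ j, |(P α β j).1 p| ≤ A) (i : Fin n) :
    |(coefSum m B P i).1 p| ≤ coefConst d n m K * A := by
  rw [coefSum_apply]
  refine (Finset.abs_sum_le_sum_abs _ _).trans ?_
  refine (Finset.sum_le_card_nsmul _ _ ((MIdx d m).card * (n * (K * A))) fun α hα => ?_).trans ?_
  · refine (Finset.abs_sum_le_sum_abs _ _).trans ?_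
    rw [← nsmul_eq_mul]
    refine Finset.sum_le_card_nsmul _ _ _ fun β hβ => ?_
    refine (Finset.abs_sum_le_sum_abs _ _).trans ?_
    refine (Finset.sum_le_card_nsmul _ _ (K * A) fun j _ => ?_).trans ?_
    · rw [abs_mul]
      exact mul_le_mul (hB.bound _ _ _ _) (h α hα β hβ j) (abs_nonneg _) hK
    · simp
  · rw [nsmul_eq_mul, coefConst]
    apply le_of_eq
    ring

/-- The part of the system that is an `m`-th order normal derivative. -/
def flux (N : Fin d) (m : ℕ) (B : (Fin d → ℕ) → (Fin d → ℕ) → Fin n → Fin n → ℝ)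
    (w : Fin n → smoothAlg d) : Fin n → smoothAlg d :=
  coefSum m B fun α β j => if m ≤ α N + β N then multiD (α + β - Pi.single N m) (w j) else 0

/-- The part of the system of normal order less than `m`. -/
def lowFlux (N : Fin d) (m : ℕ) (B : (Fin d → ℕ) → (Fin d → ℕ) → Fin n → Fin n → ℝ)
    (w : Fin n → smoothAlg d) : Fin n → smoothAlg d :=
  coefSum m B fun α β j => if m ≤ α N + β N then 0 else multiD (α + β) (w j)

theorem spD_iterate_flux_add (m : ℕ) (B : (Fin d → ℕ) → (Fin d → ℕ) → Fin n → Fin n → ℝ)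
    (w : Fin n → smoothAlg d) (i : Fin n) :
    (spD N)^[m] (flux N m B w i) + lowFlux N m B w i =
      coefSum m B (fun α β j => multiD (α + β) (w j)) i := by
  rw [← multiD_single, flux, map_coefSum, lowFlux, coefSum_add]
  congr 1
  ext1 α
  ext1 β
  ext1 j
  split_ifs with h
  · rw [add_zero, ← multiD_add, add_tsub_cancel_of_le]
    intro k
    by_cases hk : k = N
    · subst hk
      simpa using h
    · simp [hk]
  · rw [map_zero, zero_add]

theorem abs_multiD_le_sqrt {m : ℕ} (w : Fin n → smoothAlg d) (j : Fin n) {γ : Fin d → ℕ}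
    (h : ∑ i, γ i ≤ 2 * m) (hN : γ N ≤ m) (p : ℝ × EuclideanSpace ℝ (Fin d)) :
    |(multiD γ (w j)).1 p| ≤ √((derSq N m w).1 p) :=
  Real.abs_le_sqrt (sq_multiD_le_derSq w j (mem_derIdx h hN) p)

theorem le_sum_of_mem_MIdx {k : ℕ} {γ : Fin d → ℕ} (h : γ ∈ MIdx d k) (i : Fin d) : γ i ≤ k := by
  rw [← mem_MIdx.1 h]
  exact Finset.single_le_sum (f := γ) (fun i _ => Nat.zero_le _) (Finset.mem_univ i)

variable {m : ℕ} {K lam : ℝ} {B : (Fin d → ℕ) → (Fin d → ℕ) → Fin n → Fin n → ℝ}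

theorem Admissible.abs_flux_le (hB : Admissible d n m K lam B) (hK : 0 ≤ K)
    (w : Fin n → smoothAlg d) (i : Fin n) (p : ℝ × EuclideanSpace ℝ (Fin d)) :
    |(flux N m B w i).1 p| ≤ coefConst d n m K * √((derSq N m w).1 p) := by
  refine hB.abs_coefSum_le hK (fun α hα β hβ j => ?_) i
  have h1 := le_sum_of_mem_MIdx hα N
  have h2 := le_sum_of_mem_MIdx hβ N
  split_ifs with h
  · refine abs_multiD_le_sqrt w j ?_ ?_ p
    · refine (Finset.sum_le_sum (g := fun k => α k + β k) fun k _ => ?_).trans ?_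
      · exact Nat.sub_le _ _
      · rw [Finset.sum_add_distrib, mem_MIdx.1 hα, mem_MIdx.1 hβ]
        omega
    · simp
      omega
  · simp

theorem Admissible.abs_lowFlux_le (hB : Admissible d n m K lam B) (hK : 0 ≤ K)
    (w : Fin n → smoothAlg d) (i : Fin n) (p : ℝ × EuclideanSpace ℝ (Fin d)) :
    |(lowFlux N m B w i).1 p| ≤ coefConst d n m K * √((derSq N m w).1 p) := by
  refine hB.abs_coefSum_le hK (fun α hα β hβ j => ?_) i
  split_ifs with h
  · simp
  · refine abs_multiD_le_sqrt w j ?_ ?_ p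
    · simp only [Pi.add_apply, Finset.sum_add_distrib, mem_MIdx.1 hα, mem_MIdx.1 hβ]
      omega
    · simp
      omega

theorem IsSol.abs_spD_iterate_flux_le (hB : Admissible d n m K lam B) (hK : 0 ≤ K)
    {w : Fin n → smoothAlg d} (hw : IsSol N m B w) (i : Fin n)
    {p : ℝ × EuclideanSpace ℝ (Fin d)} (hp : p ∈ halfCyl N) :
    |((_root_.spD N)^[m] (flux N m B w i)).1 p| ≤
      (coefConst d n m K + 1) * √((derSq N m w).1 p) := by
  have h1 := hw.eq p hp i
  change (_root_.tmD (w i)).1 p +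
    (-1) ^ m * (coefSum m B (fun α β j => multiD (α + β) (w j)) i).1 p = 0 at h1
  rw [← spD_iterate_flux_add (N := N)] at h1
  change (_root_.tmD (w i)).1 p +
    (-1) ^ m * (((_root_.spD N)^[m] (flux N m B w i)).1 p + (lowFlux N m B w i).1 p) = 0 at h1
  have h2 := hB.abs_lowFlux_le (N := N) hK w i p
  have h3 := Real.abs_le_sqrt (sq_tmD_le_derSq (N := N) m w i p)
  have h4 : |((_root_.spD N)^[m] (flux N m B w i)).1 p + (lowFlux N m B w i).1 p| =
      |(_root_.tmD (w i)).1 p| := by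
    rw [eq_neg_of_add_eq_zero_left h1, abs_neg, abs_mul, abs_pow, abs_neg, abs_one, one_pow,
      one_mul]
  have h5 := abs_sub (((_root_.spD N)^[m] (flux N m B w i)).1 p + (lowFlux N m B w i).1 p)
    ((lowFlux N m B w i).1 p)
  rw [add_sub_cancel_right, h4] at h5
  linarith

theorem prod_single_pow {γ : Fin d → ℕ} (hγ : γ ∈ MIdx d m) :
    ∏ k, (Pi.single N (1 : ℝ) : Fin d → ℝ) k ^ γ k = if γ = Pi.single N m then 1 else 0 := by
  have hs := mem_MIdx.1 hγ
  split_ifs with h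
  · refine Finset.prod_eq_one fun k _ => ?_
    by_cases hk : k = N
    · subst hk; simp
    · simp [h, hk]
  · by_contra hne
    apply h
    have h0 : ∀ k, k ≠ N → γ k = 0 := by
      intro k hk
      by_contra hk0
      refine hne (Finset.prod_eq_zero (Finset.mem_univ k) ?_)
      simp [hk, hk0]
    rw [Finset.sum_eq_single N (fun k _ hk => h0 k hk) (by simp)] at hs
    ext k
    by_cases hk : k = N
    · subst hk; simpa using hs
    · simp [hk, h0 k hk]

theorem single_mem_MIdx : (Pi.single N m : Fin d → ℕ) ∈ MIdx d m :=
  mem_MIdx.2 (by simp)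

/-- Ellipticity bounds the pure normal derivatives. -/
theorem Admissible.sum_sq_normal_le (hB : Admissible d n m K lam B) (hK : 0 ≤ K) (hlam : 0 < lam)
    (w : Fin n → smoothAlg d) {T : ℝ} {p : ℝ × EuclideanSpace ℝ (Fin d)} (hT : 0 ≤ T)
    (hG : ∀ i, |(flux N m B w i).1 p| ≤ T)
    (hP : ∀ γ ∈ MIdx d m, γ N < m → ∀ j, |(multiD γ (w j)).1 p| ≤ T) :
    ∑ j, (multiD (Pi.single N m) (w j)).1 p ^ 2 ≤
      n * ((1 + coefConst d n m K) * T / lam) ^ 2 := by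
  classical
  set S : Fin d → ℕ := Pi.single N m
  set z : Fin n → ℝ := fun j => (multiD S (w j)).1 p with hz
  have hS : S ∈ MIdx d m := single_mem_MIdx
  have hlow : ∀ γ ∈ MIdx d m, γ ≠ S → γ N < m := by
    intro γ hγ hne
    refine lt_of_le_of_ne (le_sum_of_mem_MIdx hγ N) fun h => hne ?_
    have hs := mem_MIdx.1 hγ
    rw [← Finset.add_sum_erase _ _ (Finset.mem_univ N), h] at hs
    have h0 : ∑ k ∈ Finset.univ.erase N, γ k = 0 := by omega
    rw [Finset.sum_eq_zero_iff] at h0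
    ext k
    by_cases hk : k = N
    · subst hk; simpa [S] using h
    · simpa [S, hk] using h0 k (by simp [hk])
  have h1 : lam * ∑ i, z i ^ 2 ≤ ∑ i, z i * ∑ j, B S S i j * z j := by
    have := hB.legHad z (Pi.single N 1)
    have e1 : ∑ k, (Pi.single N (1 : ℝ) : Fin d → ℝ) k ^ 2 = 1 := by
      rw [Finset.sum_eq_single N (fun k _ hk => by simp [hk]) (by simp)]
      simp
    rw [e1, one_pow, mul_one] at this
    refine this.trans (le_of_eq ?_)
    rw [Finset.sum_eq_single S _ (fun h => absurd hS h), Finset.sum_eq_single S _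
      (fun h => absurd hS h)]
    · simp only [prod_single_pow hS, Finset.mul_sum]
      refine Finset.sum_congr rfl fun i _ => Finset.sum_congr rfl fun j _ => ?_
      rw [if_pos rfl]
      ring
    · intro β hβ hne
      simp [prod_single_pow hβ, S, hne]
    · intro α hα hne
      refine Finset.sum_eq_zero fun β hβ => ?_
      simp [prod_single_pow hα, S, hne]
  set Q : (Fin d → ℕ) → (Fin d → ℕ) → Fin n → smoothAlg d := fun α β j =>
    if α = S ∧ β = S then 0 else
      if m ≤ α N + β N then multiD (α + β - S) (w j) else 0 with hQ
  have h2 : ∀ i, (flux N m B w i).1 p = ∑ j, B S S i j * z j + (coefSum m B Q i).1 p := by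
    intro i
    have e1 : flux N m B w i =
        coefSum m B (fun α β j => if α = S ∧ β = S then multiD S (w j) else 0) i +
          coefSum m B Q i := by
      rw [coefSum_add, flux]
      congr 1
      ext1 α
      ext1 β
      ext1 j
      by_cases h : α = S ∧ β = S
      · rw [h.1, h.2]
        simp [hQ, S]
      · simp [hQ, h, S]
    rw [e1]
    change (coefSum m B _ i).1 p + _ = _
    rw [coefSum_apply, Finset.sum_eq_single S _ (fun h => absurd hS h),
      Finset.sum_eq_single S _ (fun h => absurd hS h)]
    · simp [hz]
    · intro β hβ hne
      simp [hne]
    · intro α hα hne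
      simp [hne]
  have h3 : ∀ i, |(coefSum m B Q i).1 p| ≤ coefConst d n m K * T := by
    refine hB.abs_coefSum_le hK fun α hα β hβ j => ?_
    simp only [hQ]
    split_ifs with h h'
    · simpa using hT
    · have hle : S ≤ α + β := by
        intro k
        by_cases hk : k = N
        · subst hk
          simpa [S] using h'
        · simp [S, hk]
      refine hP _ (mem_MIdx.2 ?_) ?_ j
      · have : ∑ k, (α + β - S) k + ∑ k, S k = ∑ k, (α k + β k) := by
          rw [← Finset.sum_add_distrib]
          exact Finset.sum_congr rfl fun k _ => Nat.sub_add_cancel (hle k)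
        rw [Finset.sum_add_distrib, mem_MIdx.1 hα, mem_MIdx.1 hβ, mem_MIdx.1 hS] at this
        omega
      · have h4 := le_sum_of_mem_MIdx hα N
        have h5 := le_sum_of_mem_MIdx hβ N
        have h6 : α N < m ∨ β N < m := by
          by_contra hc
          push Not at hc
          apply h
          constructor
          · by_contra hne
            exact absurd (hlow α hα hne) (by omega)
          · by_contra hne
            exact absurd (hlow β hβ hne) (by omega)
        simp [S]
        omega
    · simpa using hT
  set T' := (1 + coefConst d n m K) * T with hT'
  have h4 : ∀ i, |∑ j, B S S i j * z j| ≤ T' := by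
    intro i
    have e := h2 i
    have := abs_sub ((flux N m B w i).1 p) ((coefSum m B Q i).1 p)
    rw [e, add_sub_cancel_right, ← e] at this
    linarith [hG i, h3 i]
  have h5 : ∀ i, z i * ∑ j, B S S i j * z j ≤ lam / 2 * z i ^ 2 + lam / 2 * (T' / lam) ^ 2 := by
    intro i
    have e1 : z i * ∑ j, B S S i j * z j ≤ |z i| * T' :=
      (le_abs_self _).trans (by rw [abs_mul]; exact mul_le_mul_of_nonneg_left (h4 i) (abs_nonneg _))
    have e2 : T' = lam * (T' / lam) := by field_simp
    have e3 := two_mul_le_add_sq |z i| (T' / lam)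
    rw [sq_abs] at e3
    calc _ ≤ |z i| * T' := e1
      _ = lam / 2 * (2 * |z i| * (T' / lam)) := by rw [e2]; field_simp
      _ ≤ lam / 2 * (z i ^ 2 + (T' / lam) ^ 2) := by gcongr
      _ = _ := by ring
  have h6 := h1.trans (Finset.sum_le_sum fun i _ => h5 i)
  rw [Finset.sum_add_distrib, ← Finset.mul_sum, Finset.sum_const, Finset.card_univ,
    Fintype.card_fin, nsmul_eq_mul] at h6
  have h7 : lam / 2 * ∑ i, z i ^ 2 ≤ lam / 2 * (n * (T' / lam) ^ 2) := by linarith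
  exact le_of_mul_le_mul_left h7 (by positivity)

end NormalDirection

noncomputable section BoundaryDecay

variable {d n : ℕ} {N : Fin d}

theorem integrableOn_line (f : smoothAlg d) (x e : ℝ × EuclideanSpace ℝ (Fin d)) (a b : ℝ) :
    IntegrableOn (fun t : ℝ => f.1 (x + t • e)) (Ioo a b) :=
  ((contDiff_line f x e).continuous.continuousOn.integrableOn_compact
    isCompact_Icc).mono_set Ioo_subset_Icc_self

theorem setIntegral_Ioo_le_of_le {f : smoothAlg d} {x e : ℝ × EuclideanSpace ℝ (Fin d)}
    {a b c : ℝ} (hab : a ≤ b) (h : ∀ s ∈ Ioo a b, f.1 (x + s • e) ≤ c) :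
    ∫ s in Ioo a b, f.1 (x + s • e) ≤ (b - a) * c := by
  refine (setIntegral_mono_on (integrableOn_line f x e a b)
    (integrableOn_const (C := c) (by simp)) measurableSet_Ioo h).trans (le_of_eq ?_)
  simp [hab]

/-- Decay in the normal direction on a line. -/
theorem exists_line_decay (n : ℕ) {m : ℕ} (hm : 1 ≤ m) {K lam : ℝ} (hK : 0 ≤ K)
    (hlam : 0 < lam) :
    ∃ C : ℝ, 0 ≤ C ∧ ∀ B, Admissible d n m K lam B → ∀ w : Fin n → smoothAlg d, IsSol N m B w →
      ∀ r, 0 < r → r ≤ side d / 2 → ∀ x, dirCoord (some N) x = 0 →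
      (∀ κ, κ ≠ some N → dirCoord κ x ∈ Ioo (loEnd N (fun _ => side d) κ) (side d)) →
      ∫ s in Ioo 0 r, (∑ j, w j ^ 2 : smoothAlg d).1 (x + s • dirVec (some N)) ≤
        C * r ^ (2 * m + 1) *
          ∫ s in Ioo 0 (side d), (derSq N m w).1 (x + s • dirVec (some N)) := by
  have ha := side_pos N
  obtain ⟨C₁, hC₁, h1⟩ := exists_sq_line_le (d := d) m hm (side d / 2) (by positivity)
  obtain ⟨C₂, hC₂, h2⟩ := exists_sq_line_le (d := d) 1 le_rfl (side d / 2) (by positivity)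
  set c := coefConst d n m K with hc
  have hc0 : 0 ≤ c := coefConst_nonneg d n m hK
  set D := C₁ * (c ^ 2 + (c + 1) ^ 2) + C₂ * 2 with hD
  have hD0 : 0 ≤ D := by positivity
  refine ⟨n * (n * ((1 + c) / lam) ^ 2 * D), by positivity, fun B hB w hw r hr hra x hx hx' => ?_⟩
  set e := dirVec (some N) with he
  set I := ∫ s in Ioo 0 (side d), (derSq N m w).1 (x + s • e) with hI
  have hI0 : 0 ≤ I := setIntegral_nonneg measurableSet_Ioo fun s _ => derSq_nonneg m w _
  have hmem : ∀ t ∈ Ioo 0 (side d), x + t • e ∈ halfCyl N := fun t ht =>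
    sbox_subset_halfCyl (ρ := fun _ => side d) (fun _ => le_rfl)
      ((mem_box_line_iff hx t).2 ⟨hx', by simpa [loEnd] using ht⟩)
  have hG : ∀ s ∈ Icc 0 (side d / 2), ∀ i, |(flux N m B w i).1 (x + s • e)| ≤ √(D * I) := by
    intro s hs i
    refine Real.abs_le_sqrt ((h1 e x (flux N m B w i) (derSq N m w) (c ^ 2 + (c + 1) ^ 2) 0 (side d)
      (by positivity) (fun t ht => ?_) (fun t _ => derSq_nonneg m w _) s hs.1
      (by linarith [hs.2])).trans ?_)
    · have e1 := hB.abs_flux_le (N := N) hK w i (x + t • e)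
      have e2 := hw.abs_spD_iterate_flux_le hB hK i (hmem t ht)
      rw [← hc] at e1 e2
      have e3 := pow_le_pow_left₀ (abs_nonneg _) e1 2
      have e4 := pow_le_pow_left₀ (abs_nonneg _) e2 2
      rw [sq_abs, mul_pow, Real.sq_sqrt (derSq_nonneg m w _)] at e3 e4
      rw [add_mul]
      exact add_le_add e3 e4
    · rw [hD]
      have : 0 ≤ C₂ * 2 * I := by positivity
      linarith
  have hP : ∀ s ∈ Icc 0 (side d / 2), ∀ γ ∈ MIdx d m, γ N < m → ∀ j,
      |(multiD γ (w j)).1 (x + s • e)| ≤ √(D * I) := by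
    intro s hs γ hγ hγN j
    have hγs := mem_MIdx.1 hγ
    refine Real.abs_le_sqrt ((h2 e x (multiD γ (w j)) (derSq N m w) 2 0 (side d)
      (by positivity) (fun t ht => ?_) (fun t _ => derSq_nonneg m w _) s hs.1
      (by linarith [hs.2])).trans ?_)
    · have e1 := sq_multiD_le_derSq (N := N) (m := m) w j
        (mem_derIdx (by omega) hγN.le : γ ∈ derIdx N m) (x + t • e)
      have e2 := sq_multiD_le_derSq (N := N) (m := m) w j
        (mem_derIdx (by rw [sum_add_single]; omega) (by simp; omega) :
          γ + Pi.single N 1 ∈ derIdx N m) (x + t • e)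
      rw [← spD_multiD] at e2
      rw [two_mul]
      exact add_le_add e1 e2
    · rw [hD]
      have : 0 ≤ C₁ * (c ^ 2 + (c + 1) ^ 2) * I := by positivity
      linarith
  have hz : ∀ s ∈ Icc 0 (0 + r), ∀ j, |(multiD (Pi.single N m) (w j)).1 (x + s • e)| ≤
      √(n * ((1 + c) / lam) ^ 2 * D * I) := by
    intro s hs j
    have hs' : s ∈ Icc 0 (side d / 2) := ⟨hs.1, by linarith [hs.2]⟩
    refine Real.abs_le_sqrt ?_
    have e1 := hB.sum_sq_normal_le hK hlam w (Real.sqrt_nonneg _) (hG s hs') (hP s hs')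
    refine (Finset.single_le_sum (f := fun j => (multiD (Pi.single N m) (w j)).1 (x + s • e) ^ 2)
      (fun _ _ => sq_nonneg _) (Finset.mem_univ j)).trans (e1.trans (le_of_eq ?_))
    rw [mul_div_right_comm, mul_pow, Real.sq_sqrt (by positivity)]
    ring
  have hflat : x ∈ flatBdry N := by
    have h3 : ‖x‖ ≤ 1 / 2 := norm_le_of_dirCoord N fun κ => by
      by_cases hκ : κ = some N
      · rw [hκ, hx, abs_zero]
        exact ha.le
      · exact abs_dirCoord_le_of_lower (ρ := fun _ => side d) (Ioo_subset_Icc_self (hx' κ hκ))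
    have h4 := hx' none (by simp)
    simp only [loEnd, true_or, if_true, dirCoord, neg_apply, ContinuousLinearMap.coe_fst',
      mem_Ioo] at h4
    have h5 := side_le N
    refine ⟨⟨by linarith, by linarith⟩, ?_, hx⟩
    rw [mem_ball, dist_zero_right]
    exact ((norm_snd_le x).trans h3).trans_lt (by norm_num)
  refine (setIntegral_Ioo_le_of_le (c := n * (n * ((1 + c) / lam) ^ 2 * D * I * r ^ (2 * m))) hr.le
    fun s hs => ?_).trans (le_of_eq ?_)
  · have e0 : (∑ j, w j ^ 2 : smoothAlg d).1 (x + s • e) = ∑ j, (w j).1 (x + s • e) ^ 2 := by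
      simp [Finset.sum_apply]
    rw [e0]
    refine (Finset.sum_le_card_nsmul _ _ (n * ((1 + c) / lam) ^ 2 * D * I * r ^ (2 * m))
      fun j _ => ?_).trans (by simp)
    have e1 := abs_le_mul_pow_of_vanishing m (x := 0) (r := r)
      (A := √(n * ((1 + c) / lam) ^ 2 * D * I))
      (fun k s => ((dirDer e)^[k] (w j)).1 (x + s • e)) (fun k s => by
        rw [Function.iterate_succ_apply']
        exact hasDerivAt_line _ x e s) (fun k hk => by
        have := (hw.van j).multiD_eq_zero (γ := Pi.single N k) (by simpa using hk) x hflat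
        rw [multiD_single] at this
        simp only [zero_smul, add_zero]
        exact this) (fun s hs => by
        have := hz s hs j
        rw [multiD_single] at this
        exact this) s ⟨hs.1.le, by linarith [hs.2]⟩
    have e2 := pow_le_pow_left₀ (abs_nonneg _) e1 2
    rw [sq_abs, mul_pow, Real.sq_sqrt (by positivity), ← pow_mul, mul_comm m 2] at e2
    exact e2
  · rw [sub_zero, pow_succ]
    ring

variable (N) in
theorem exists_normal_decay (n σ : ℕ) {m : ℕ} (hm : 1 ≤ m) {K lam : ℝ} (hK : 0 ≤ K)
    (hlam : 0 < lam) :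
    ∃ C : ℝ, 0 ≤ C ∧ ∀ B, Admissible d n m K lam B → ∀ w : Fin n → smoothAlg d, IsSol N m B w →
      ∀ r, 0 < r → r ≤ side d / 2 →
      ∫ p in sbox N (Function.update (fun _ => side d) (some N) r),
        (∑ j, w j ^ 2 : smoothAlg d).1 p ≤
        C * r ^ (2 * m + 1) * ∑ i, energy N σ 0 (w i) := by
  obtain ⟨C, hC, h1⟩ := exists_line_decay (N := N) n hm hK hlam
  obtain ⟨C', hC', h2⟩ := exists_setIntegral_derSq_le N n σ hm hK hlam
  refine ⟨C * C', by positivity, fun B hB w hw r hr hra => ?_⟩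
  have ha := side_pos N
  have hle : ∀ κ, Function.update (fun _ => side d) (some N) r κ ≤ side d := fun κ => by
    rw [Function.update_apply]
    split_ifs
    · linarith
    · exact le_rfl
  have h3 := setIntegral_box_le (lo := loEnd N fun _ => side d) (hi := fun _ => side d)
    (lo' := loEnd N (Function.update (fun _ => side d) (some N) r))
    (hi' := Function.update (fun _ => side d) (some N) r) (some N)
    (fun κ hκ => by simp [loEnd, hκ]) (fun κ hκ => by simp [hκ])
    (F := (C * r ^ (2 * m + 1)) • derSq N m w) (F' := ∑ j, w j ^ 2)
    (integrableOn_sbox (N := N) (fun _ => le_rfl) _) (integrableOn_sbox hle _) (fun x hx hx' => by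
      have h4 := h1 B hB w hw r hr hra x hx hx'
      rw [← integral_const_mul] at h4
      simpa [loEnd] using h4)
  refine h3.trans ?_
  have h5 := h2 B hB w hw
  calc _ = C * r ^ (2 * m + 1) * ∫ p in sbox N fun _ => side d, (derSq N m w).1 p :=
        integral_const_mul _ _
    _ ≤ C * r ^ (2 * m + 1) * (C' * ∑ i, energy N σ 0 (w i)) := by gcongr
    _ = _ := by ring

end BoundaryDecay

noncomputable section InteriorDecay

variable {d n : ℕ} {N : Fin d}

theorem sq_dirDer_dirVec (κ : Option (Fin d)) (f : smoothAlg d)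
    (p : ℝ × EuclideanSpace ℝ (Fin d)) :
    (dirDer (dirVec κ) f).1 p ^ 2 = (dirD κ f).1 p ^ 2 := by
  cases κ with
  | none =>
    have : dirVec none = -((1, 0) : ℝ × EuclideanSpace ℝ (Fin d)) := by simp [dirVec]
    rw [this, dirDer_apply, map_neg, neg_sq]
    rfl
  | some i => rfl

/-- Parabolic lengths of the coordinate directions. -/
def parLen (m : ℕ) (r : ℝ) : Option (Fin d) → ℝ
  | none => r ^ (2 * m)
  | some _ => r

/-- The box that is small in the normal direction and in the directions in `S`. -/
def parSize (N : Fin d) (m : ℕ) (r : ℝ) (S : Finset (Option (Fin d))) (κ : Option (Fin d)) : ℝ :=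
  if κ = some N then r else if κ ∈ S then parLen m r κ else side d

theorem parLen_pos (m : ℕ) {r : ℝ} (hr : 0 < r) (κ : Option (Fin d)) : 0 < parLen m r κ := by
  cases κ
  · exact pow_pos hr _
  · exact hr

theorem parLen_le {m : ℕ} (hm : 1 ≤ m) {r : ℝ} (hr : 0 < r) (hr1 : r ≤ 1) (κ : Option (Fin d)) :
    parLen m r κ ≤ r := by
  cases κ
  · exact pow_le_of_le_one hr.le hr1 (by omega)
  · exact le_rfl

theorem parSize_le (N : Fin d) {m : ℕ} (hm : 1 ≤ m) {r : ℝ} (hr : 0 < r) (hra : r ≤ side d / 2)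
    (S : Finset (Option (Fin d))) (κ : Option (Fin d)) : parSize N m r S κ ≤ side d := by
  have h1 := side_pos N
  have h2 := side_le N
  have h3 := parLen_le hm hr (by linarith) κ
  unfold parSize
  split_ifs <;> linarith

theorem sum_sq_apply (w : Fin n → smoothAlg d) (p : ℝ × EuclideanSpace ℝ (Fin d)) :
    (∑ j, w j ^ 2 : smoothAlg d).1 p = ∑ j, (w j).1 p ^ 2 := by
  simp [Finset.sum_apply]

/-- Decay in a tangential or time direction on a line. -/
theorem exists_line_decay_dirD (N : Fin d) (n : ℕ) {m : ℕ} (hm : 1 ≤ m) :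
    ∃ C : ℝ, 0 ≤ C ∧ ∀ (w : Fin n → smoothAlg d) (κ : Option (Fin d)) (r : ℝ), 0 < r →
      r ≤ side d / 2 → ∀ ρ ρ' : Option (Fin d) → ℝ, ρ κ = side d → ρ' κ = parLen m r κ →
      ∀ x, ∫ s in Ioo (loEnd N ρ' κ) (ρ' κ), (∑ j, w j ^ 2 : smoothAlg d).1 (x + s • dirVec κ) ≤
        C * parLen m r κ * ∫ s in Ioo (loEnd N ρ κ) (ρ κ),
          (∑ j, w j ^ 2 + ∑ j, dirD κ (w j) ^ 2 : smoothAlg d).1 (x + s • dirVec κ) := by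
  have ha := side_pos N
  obtain ⟨C, hC, h1⟩ := exists_sq_line_le (d := d) 1 le_rfl (side d / 2) (by positivity)
  refine ⟨2 * (n * C), by positivity, fun w κ r hr hra ρ ρ' hρ hρ' x => ?_⟩
  set E : smoothAlg d := ∑ j, w j ^ 2 + ∑ j, dirD κ (w j) ^ 2 with hE
  have hEa : ∀ p, E.1 p = ∑ j, (w j).1 p ^ 2 + ∑ j, (dirD κ (w j)).1 p ^ 2 := fun p => by
    rw [← sum_sq_apply, ← sum_sq_apply]
    rfl
  have hE0 : ∀ p, 0 ≤ E.1 p := fun p => by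
    rw [hEa]
    positivity
  set I := ∫ s in Ioo (loEnd N ρ κ) (ρ κ), E.1 (x + s • dirVec κ)
  have hI : 0 ≤ I := setIntegral_nonneg measurableSet_Ioo fun _ _ => hE0 _
  have hω := parLen_pos m hr κ
  have hω' := parLen_le hm hr (by linarith [side_le N]) κ
  have hlo : loEnd N ρ κ ≤ loEnd N ρ' κ ∧ 0 ≤ ρ' κ - loEnd N ρ' κ ∧
      ρ' κ - loEnd N ρ' κ ≤ 2 * parLen m r κ := by
    unfold loEnd
    rw [hρ, hρ']
    split_ifs
    · exact ⟨le_rfl, by linarith, by linarith⟩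
    · exact ⟨by linarith, by linarith, by linarith⟩
  refine (setIntegral_Ioo_le_of_le (c := n * (C * I)) (by linarith [hlo.2.1])
    fun s hs => ?_).trans ?_
  · rw [sum_sq_apply]
    refine (Finset.sum_le_card_nsmul _ _ (C * I) fun j _ => ?_).trans (by simp)
    have := h1 (dirVec κ) x (w j) E 1 (loEnd N ρ κ) (ρ κ) zero_le_one (fun t _ => ?_)
      (fun t _ => hE0 _) s (by linarith [hs.1, hlo.1]) (by linarith [hs.2])
    · rwa [one_mul] at this
    · rw [one_mul, Function.iterate_one, sq_dirDer_dirVec, hEa]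
      exact add_le_add (Finset.single_le_sum (f := fun j => (w j).1 (x + t • dirVec κ) ^ 2)
          (fun _ _ => sq_nonneg _) (Finset.mem_univ j))
        (Finset.single_le_sum (f := fun j => (dirD κ (w j)).1 (x + t • dirVec κ) ^ 2)
          (fun _ _ => sq_nonneg _) (Finset.mem_univ j))
  · calc (ρ' κ - loEnd N ρ' κ) * (n * (C * I)) ≤ 2 * parLen m r κ * (n * (C * I)) := by
          gcongr
          exact hlo.2.2
      _ = _ := by ring

variable (N) in
theorem exists_parabolic_decay (n : ℕ) {m : ℕ} (hm : 1 ≤ m) {K lam : ℝ} (hK : 0 ≤ K)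
    (hlam : 0 < lam) (S : Finset (Option (Fin d))) (hS : some N ∉ S) (σ : ℕ) :
    ∃ C : ℝ, 0 ≤ C ∧ ∀ B, Admissible d n m K lam B → ∀ w : Fin n → smoothAlg d, IsSol N m B w →
      ∀ r, 0 < r → r ≤ side d / 2 →
      ∫ p in sbox N (parSize N m r S), (∑ j, w j ^ 2 : smoothAlg d).1 p ≤
        C * r ^ (2 * m + 1) * (∏ κ ∈ S, parLen m r κ) * ∑ i, energy N σ 0 (w i) := by
  classical
  induction S using Finset.induction_on generalizing σ with
  | empty =>
    obtain ⟨C, hC, h⟩ := exists_normal_decay N n σ hm hK hlam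
    refine ⟨C, hC, fun B hB w hw r hr hra => ?_⟩
    have e : parSize N m r ∅ = Function.update (fun _ => side d) (some N) r := by
      ext κ
      simp [parSize, Function.update_apply]
    rw [e, Finset.prod_empty, mul_one]
    exact h B hB w hw r hr hra
  | insert κ S hκS ih =>
    have hκ : κ ≠ some N := fun h => hS (by simp [h])
    have hS' : some N ∉ S := fun h => hS (by simp [h])
    obtain ⟨C₀, hC₀, h0⟩ := exists_line_decay_dirD N n hm
    obtain ⟨σ', C₁, hC₁, h1⟩ := exists_energy_dirD_le N n σ hm hK hlam κ
    obtain ⟨C₂, hC₂, h2⟩ := ih hS' σ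
    obtain ⟨C₃, hC₃, h3⟩ := ih hS' σ'
    refine ⟨C₀ * (C₂ + C₃ * C₁), by positivity, fun B hB w hw r hr hra => ?_⟩
    have hle := parSize_le N hm hr hra
    have hω := parLen_pos m hr κ
    have hne : ∀ κ', κ' ≠ κ → parSize N m r (insert κ S) κ' = parSize N m r S κ' :=
      fun κ' h => by simp [parSize, h]
    have h4 := setIntegral_box_le (lo := loEnd N (parSize N m r S)) (hi := parSize N m r S)
      (lo' := loEnd N (parSize N m r (insert κ S))) (hi' := parSize N m r (insert κ S)) κ
      (fun κ' h => by simp [loEnd, hne κ' h]) hne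
      (F := (C₀ * parLen m r κ) • (∑ j, w j ^ 2 + ∑ j, dirD κ (w j) ^ 2)) (F' := ∑ j, w j ^ 2)
      (integrableOn_sbox (hle S) _) (integrableOn_sbox (hle _) _) (fun x _ _ => by
        have h5 := h0 w κ r hr hra (parSize N m r S) (parSize N m r (insert κ S))
          (by simp [parSize, hκ, hκS]) (by simp [parSize, hκ]) x
        rw [← integral_const_mul] at h5
        exact h5)
    refine h4.trans ?_
    have h5 := h2 B hB w hw r hr hra
    have h6 := h3 B hB _ (hw.dirD hκ) r hr hra
    have h7 := h1 B hB w hw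
    set Z := ∏ κ ∈ S, parLen m r κ with hZ
    have hZ0 : 0 ≤ Z := Finset.prod_nonneg fun κ _ => (parLen_pos m hr κ).le
    set X := ∑ i, energy N σ 0 (w i)
    calc _ = C₀ * parLen m r κ *
          ((∫ p in sbox N (parSize N m r S), (∑ j, w j ^ 2 : smoothAlg d).1 p) +
            ∫ p in sbox N (parSize N m r S), (∑ j, dirD κ (w j) ^ 2 : smoothAlg d).1 p) := by
          rw [← integral_add (integrableOn_sbox (hle S) _) (integrableOn_sbox (hle S) _)]
          exact integral_const_mul _ _
      _ ≤ C₀ * parLen m r κ * (C₂ * r ^ (2 * m + 1) * Z * X +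
            C₃ * r ^ (2 * m + 1) * Z * (C₁ * X)) := by
          refine mul_le_mul_of_nonneg_left (add_le_add h5 (h6.trans ?_)) (by positivity)
          gcongr
      _ = _ := by
          rw [Finset.prod_insert hκS]
          ring

theorem qcylP_one (m : ℕ) (N : Fin d) : QCylP d m N 1 0 = halfCyl N := by
  ext p
  simp [QCylP, QCyl, halfCyl, and_assoc]

variable (N) in
/-- Decay of solutions in small half cylinders. -/
theorem exists_halfCyl_decay (n : ℕ) {m : ℕ} (hm : 1 ≤ m) {K lam : ℝ} (hK : 0 ≤ K)
    (hlam : 0 < lam) :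
    ∃ C : ℝ, 0 ≤ C ∧ ∀ B, Admissible d n m K lam B → ∀ w : Fin n → smoothAlg d, IsSol N m B w →
      ∀ r, 0 < r → r ≤ side d / 2 →
      ∫ p in QCylP d m N r 0, ∑ j, (w j).1 p ^ 2 ≤
        C * r ^ (d + 4 * m) * ∫ p in QCylP d m N 1 0, ∑ j, (w j).1 p ^ 2 := by
  classical
  obtain ⟨C, hC, h⟩ := exists_parabolic_decay N n hm hK hlam (Finset.univ.erase (some N))
    (by simp) 0
  refine ⟨C, hC, fun B hB w hw r hr hra => ?_⟩
  have h1 := h B hB w hw r hr hra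
  have hle := parSize_le N hm hr hra (Finset.univ.erase (some N))
  have e1 : (∏ κ ∈ Finset.univ.erase (some N), parLen m r κ) * r = r ^ (2 * m) * r ^ d := by
    have := Finset.prod_erase_mul Finset.univ (fun κ : Option (Fin d) => parLen m r κ)
      (Finset.mem_univ (some N))
    rw [Fintype.prod_option] at this
    simpa [parLen] using this
  have e2 : ∑ i, energy N 0 0 (w i) = ∫ p in QCylP d m N 1 0, ∑ j, (w j).1 p ^ 2 := by
    rw [qcylP_one]
    simp only [energy_zero, pow_zero, one_mul]
    rw [← map_sum, intU_apply]
    simp only [sum_sq_apply]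
  have hsub : QCylP d m N r 0 ⊆ sbox N (parSize N m r (Finset.univ.erase (some N))) := by
    rintro p ⟨⟨h2, h3⟩, h4⟩ κ
    rw [mem_ball, Prod.snd_zero, dist_zero_right] at h3
    rw [Prod.fst_zero, zero_sub, mem_Ioo] at h2
    cases κ with
    | none =>
      simp only [loEnd, parSize, parLen, dirCoord, true_or, if_true, mem_Ioo, neg_apply,
        ContinuousLinearMap.coe_fst', Finset.mem_erase, Finset.mem_univ, ne_eq, reduceCtorEq,
        not_false_eq_true, and_self, if_false]
      exact ⟨by linarith [h2.2], by linarith [h2.1]⟩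
    | some i =>
      have h5 : |p.2 i| < r := (PiLp.norm_apply_le p.2 i).trans_lt h3
      have h6 : parSize N m r (Finset.univ.erase (some N)) (some i) = r := by
        by_cases hi : i = N <;> simp [parSize, parLen, hi]
      rw [h6]
      refine ⟨?_, (abs_lt.1 h5).2⟩
      by_cases hi : i = N
      · subst hi
        simpa [loEnd, dirCoord, spCoord] using h4
      · simp only [loEnd, h6, reduceCtorEq, Option.some.injEq, hi, or_self, if_false]
        exact (abs_lt.1 h5).1
  have h2 := integrableOn_sbox (N := N) hle (∑ j, w j ^ 2)
  rw [show (∑ j, w j ^ 2 : smoothAlg d).1 = fun p => ∑ j, (w j).1 p ^ 2 from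
    funext (sum_sq_apply w)] at h1 h2
  refine ((setIntegral_mono_set h2 (Filter.Eventually.of_forall fun p => by positivity)
    (Filter.Eventually.of_forall hsub)).trans h1).trans (le_of_eq ?_)
  rw [e2, pow_succ, show r ^ (d + 4 * m) = r ^ (2 * m) * (r ^ (2 * m) * r ^ d) by ring, ← e1]
  ring

variable (N) in
/-- Decay of solutions in half cylinders of radius less than one. -/
theorem exists_unit_decay (n : ℕ) {m : ℕ} (hm : 1 ≤ m) {K lam : ℝ} (hK : 0 ≤ K)
    (hlam : 0 < lam) :
    ∃ C : ℝ, 0 < C ∧ ∀ B, Admissible d n m K lam B → ∀ w : Fin n → smoothAlg d, IsSol N m B w →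
      ∀ r, 0 < r → r < 1 →
      ∫ p in QCylP d m N r 0, ∑ j, (w j).1 p ^ 2 ≤
        C * r ^ (d + 4 * m) * ∫ p in QCylP d m N 1 0, ∑ j, (w j).1 p ^ 2 := by
  obtain ⟨C, hC, h⟩ := exists_halfCyl_decay N n hm hK hlam
  have ha := side_pos N
  set D := (side d / 2)⁻¹ ^ (d + 4 * m) with hD
  have hD0 : 0 < D := by positivity
  refine ⟨C + D, by positivity, fun B hB w hw r hr hr1 => ?_⟩
  set I := ∫ p in QCylP d m N 1 0, ∑ j, (w j).1 p ^ 2 with hI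
  have hI0 : 0 ≤ I := integral_nonneg fun p => by positivity
  rcases le_or_gt r (side d / 2) with hra | hra
  · refine (h B hB w hw r hr hra).trans ?_
    gcongr
    linarith
  · have h1 : ∫ p in QCylP d m N r 0, ∑ j, (w j).1 p ^ 2 ≤ I := by
      have h2 := integrableOn_halfCyl N (∑ j, w j ^ 2)
      have h3 : (∑ j, w j ^ 2 : smoothAlg d).1 = fun p => ∑ j, (w j).1 p ^ 2 :=
        funext (sum_sq_apply w)
      rw [h3] at h2
      rw [hI, qcylP_one]
      refine setIntegral_mono_set h2 (Filter.Eventually.of_forall fun p => by positivity)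
        (Filter.Eventually.of_forall ?_)
      rintro p ⟨⟨h4, h5⟩, h6⟩
      have h7 : r ^ (2 * m) ≤ 1 := pow_le_one₀ hr.le hr1.le
      rw [Prod.fst_zero, zero_sub] at h4
      exact ⟨⟨by linarith [h4.1], h4.2⟩, ball_subset_ball hr1.le h5, h6⟩
    have h2 : 1 ≤ D * r ^ (d + 4 * m) := by
      rw [hD, ← mul_pow]
      refine one_le_pow₀ ?_
      rw [inv_mul_eq_div, one_le_div (by positivity)]
      exact hra.le
    have h3 : 1 ≤ (C + D) * r ^ (d + 4 * m) := by
      have : 0 ≤ C * r ^ (d + 4 * m) := by positivity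
      linarith
    exact h1.trans (le_mul_of_one_le_left hI0 h3)

end InteriorDecay

noncomputable section Scaling

variable {d n : ℕ} {N : Fin d}

/-- The parabolic dilation. -/
def parDil (d m : ℕ) {R : ℝ} (hR : 0 < R) :
    (ℝ × EuclideanSpace ℝ (Fin d)) ≃L[ℝ] ℝ × EuclideanSpace ℝ (Fin d) :=
  (ContinuousLinearEquiv.smulLeft (Units.mk0 (R ^ (2 * m)) (pow_pos hR _).ne')).prodCongr
    (ContinuousLinearEquiv.smulLeft (Units.mk0 R hR.ne'))

theorem parDil_apply (m : ℕ) {R : ℝ} (hR : 0 < R) (p : ℝ × EuclideanSpace ℝ (Fin d)) :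
    parDil d m hR p = (R ^ (2 * m) * p.1, R • p.2) := rfl

/-- Rescaling of functions. -/
def rescale (m : ℕ) {R : ℝ} (hR : 0 < R) (X : ℝ × EuclideanSpace ℝ (Fin d)) (f : smoothAlg d) :
    smoothAlg d :=
  ⟨fun p => f.1 (X + parDil d m hR p),
    (smoothAlg_contDiff f).comp (contDiff_const.add (parDil d m hR).contDiff)⟩

theorem dirDer_rescale (m : ℕ) {R : ℝ} (hR : 0 < R) (X : ℝ × EuclideanSpace ℝ (Fin d))
    (f : smoothAlg d) (e : ℝ × EuclideanSpace ℝ (Fin d)) :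
    dirDer e (rescale m hR X f) = rescale m hR X (dirDer (parDil d m hR e) f) := by
  ext p
  have h1 : HasFDerivAt (fun p => X + parDil d m hR p)
      (parDil d m hR : (ℝ × EuclideanSpace ℝ (Fin d)) →L[ℝ] ℝ × EuclideanSpace ℝ (Fin d)) p :=
    (parDil d m hR).hasFDerivAt.const_add X
  have h2 := ((smoothAlg_differentiable f) (X + parDil d m hR p)).hasFDerivAt.comp p h1
  change fderiv ℝ (fun p => f.1 (X + parDil d m hR p)) p e =
    fderiv ℝ f.1 (X + parDil d m hR p) (parDil d m hR e)
  rw [HasFDerivAt.fderiv (f := fun p => f.1 (X + parDil d m hR p)) h2]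
  rfl

theorem dirDer_smul_dir (c : ℝ) (e : ℝ × EuclideanSpace ℝ (Fin d)) (f : smoothAlg d) :
    dirDer (c • e) f = c • dirDer e f := by
  ext p
  change fderiv ℝ f.1 p (c • e) = c • fderiv ℝ f.1 p e
  rw [map_smul]

theorem rescale_smul (m : ℕ) {R : ℝ} (hR : 0 < R) (X : ℝ × EuclideanSpace ℝ (Fin d)) (c : ℝ)
    (f : smoothAlg d) : rescale m hR X (c • f) = c • rescale m hR X f := rfl

theorem spD_rescale (m : ℕ) {R : ℝ} (hR : 0 < R) (X : ℝ × EuclideanSpace ℝ (Fin d))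
    (f : smoothAlg d) (i : Fin d) :
    spD i (rescale m hR X f) = R • rescale m hR X (spD i f) := by
  rw [spD, dirDer_rescale, ← rescale_smul, ← dirDer_smul_dir, parDil_apply]
  simp

theorem tmD_rescale (m : ℕ) {R : ℝ} (hR : 0 < R) (X : ℝ × EuclideanSpace ℝ (Fin d))
    (f : smoothAlg d) :
    tmD (rescale m hR X f) = R ^ (2 * m) • rescale m hR X (tmD f) := by
  rw [tmD, dirDer_rescale, ← rescale_smul, ← dirDer_smul_dir, parDil_apply]
  simp

theorem multiD_rescale (m : ℕ) {R : ℝ} (hR : 0 < R) (X : ℝ × EuclideanSpace ℝ (Fin d))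
    (f : smoothAlg d) (γ : Fin d → ℕ) :
    multiD γ (rescale m hR X f) = R ^ (∑ i, γ i) • rescale m hR X (multiD γ f) := by
  induction γ using multiIndex_induction with
  | h0 => simp [multiD_zero]
  | hs γ k ih =>
    rw [← spD_multiD, ih, Derivation.map_smul, spD_rescale, spD_multiD, sum_add_single, smul_smul,
      pow_succ]

theorem exists_integral_rescale (m : ℕ) {R : ℝ} (hR : 0 < R)
    (X : ℝ × EuclideanSpace ℝ (Fin d)) (hX : X.2 N = 0) :
    ∃ κ : ℝ, 0 < κ ∧ ∀ (g : ℝ × EuclideanSpace ℝ (Fin d) → ℝ) (ρ : ℝ),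
      ∫ p in QCylP d m N ρ 0, g (X + parDil d m hR p) = κ * ∫ p in QCylP d m N (R * ρ) X, g p := by
  have := isAddHaarMeasure_volume_prod (d := d)
  set L := parDil d m hR
  have hdet : LinearMap.det (L.toLinearEquiv : (ℝ × EuclideanSpace ℝ (Fin d)) →ₗ[ℝ] _) ≠ 0 :=
    (LinearEquiv.isUnit_det' L.toLinearEquiv).ne_zero
  refine ⟨|(LinearMap.det (L.toLinearEquiv : (ℝ × EuclideanSpace ℝ (Fin d)) →ₗ[ℝ] _))⁻¹|,
    abs_pos.2 (inv_ne_zero hdet), fun g ρ => ?_⟩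
  have hmeas : ∀ (r : ℝ) (Y : ℝ × EuclideanSpace ℝ (Fin d)), MeasurableSet (QCylP d m N r Y) := by
    intro r Y
    refine ((isOpen_Ioo.prod isOpen_ball).inter (isOpen_lt continuous_const
      ((continuous_coord N).comp continuous_snd))).measurableSet
  have hmem : ∀ p, X + L p ∈ QCylP d m N (R * ρ) X ↔ p ∈ QCylP d m N ρ 0 := by
    intro p
    have hRm : 0 < R ^ (2 * m) := pow_pos hR _
    have e1 : X + L p = (X.1 + R ^ (2 * m) * p.1, X.2 + R • p.2) := rfl
    have e2 : X.1 - (R * ρ) ^ (2 * m) < X.1 + R ^ (2 * m) * p.1 ↔ -ρ ^ (2 * m) < p.1 := by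
      rw [mul_pow, sub_eq_add_neg, add_lt_add_iff_left, ← mul_neg, mul_lt_mul_iff_right₀ hRm]
    have e3 : X.1 + R ^ (2 * m) * p.1 < X.1 ↔ p.1 < 0 := by
      rw [add_lt_iff_neg_left]
      exact ⟨fun h => by nlinarith, fun h => by nlinarith⟩
    have e4 : ‖R • p.2‖ < R * ρ ↔ ‖p.2‖ < ρ := by
      rw [norm_smul, Real.norm_of_nonneg hR.le, mul_lt_mul_iff_right₀ hR]
    have e5 : 0 < (X.2 + R • p.2) N ↔ 0 < p.2 N := by
      simp [hX, hR]
    rw [e1]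
    simp only [QCylP, QCyl, mem_ofPred_eq, mem_prod, mem_Ioo, mem_ball, dist_eq_norm,
      add_sub_cancel_left, sub_zero, Prod.fst_zero, Prod.snd_zero, zero_sub]
    rw [e2, e3, e4, e5]
  rw [← integral_indicator (hmeas _ _), ← integral_indicator (hmeas _ _)]
  have h1 : (fun p => (QCylP d m N ρ 0).indicator (fun p => g (X + L p)) p) =
      fun p => (fun q => (QCylP d m N (R * ρ) X).indicator g (X + q)) (L p) := by
    ext p
    by_cases hp : p ∈ QCylP d m N ρ 0
    · rw [indicator_of_mem hp]
      exact (indicator_of_mem ((hmem p).2 hp) _).symm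
    · rw [indicator_of_notMem hp]
      exact (indicator_of_notMem (fun h => hp ((hmem p).1 h)) _).symm
  rw [h1, ← integral_add_left_eq_self ((QCylP d m N (R * ρ) X).indicator g) X]
  have h2 := L.toHomeomorph.measurableEmbedding.integral_map (μ := volume)
    (fun q => (QCylP d m N (R * ρ) X).indicator g (X + q))
  refine h2.symm.trans ?_
  have h3 := Measure.map_linearMap_addHaar_eq_smul_addHaar
    (volume : Measure (ℝ × EuclideanSpace ℝ (Fin d))) hdet
  have h4 : Measure.map L.toHomeomorph volume = Measure.map
    (L.toLinearEquiv : (ℝ × EuclideanSpace ℝ (Fin d)) →ₗ[ℝ] _) volume := rfl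
  rw [h4, h3, integral_smul_measure, ENNReal.toReal_ofReal (abs_nonneg _), smul_eq_mul]

theorem isSol_rescale {m : ℕ} {B : (Fin d → ℕ) → (Fin d → ℕ) → Fin n → Fin n → ℝ} {R : ℝ}
    (hR : 0 < R) {X : ℝ × EuclideanSpace ℝ (Fin d)} (hX : X.2 N = 0)
    {u : ℝ × EuclideanSpace ℝ (Fin d) → EuclideanSpace ℝ (Fin n)} (hu : ContDiff ℝ (⊤ : ℕ∞) u)
    (heq : ∀ p ∈ QCylP d m N (2 * R) X, ∀ i,
        tder u p i + (-1 : ℝ) ^ m * ∑ α ∈ MIdx d m, ∑ β ∈ MIdx d m, ∑ j,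
          B α β i j * Dmul (α + β) u p j = 0)
    (hbd : ∀ q ∈ QCyl d m (2 * R) X, q.2 N = 0 → ∀ k < m, (pder N)^[k] u q = 0) :
    IsSol N m B fun j => rescale m hR X (component u hu j) := by
  have hcyl : ∀ p : ℝ × EuclideanSpace ℝ (Fin d), p.1 ∈ Ioo (-1) 0 → p.2 ∈ ball 0 1 →
      X + parDil d m hR p ∈ QCyl d m (2 * R) X := by
    intro p h1 h2
    have hRm : 0 < R ^ (2 * m) := pow_pos hR _
    have e : X + parDil d m hR p = (X.1 + R ^ (2 * m) * p.1, X.2 + R • p.2) := rfl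
    have e1 : R ^ (2 * m) ≤ (2 * R) ^ (2 * m) := pow_le_pow_left₀ hR.le (by linarith) _
    rw [mem_ball, dist_zero_right] at h2
    rw [e]
    refine ⟨⟨?_, ?_⟩, ?_⟩
    · change X.1 - (2 * R) ^ (2 * m) < X.1 + R ^ (2 * m) * p.1
      nlinarith [h1.1]
    · change X.1 + R ^ (2 * m) * p.1 < X.1
      nlinarith [h1.2]
    · rw [mem_ball, dist_eq_norm, add_sub_cancel_left, norm_smul, Real.norm_of_nonneg hR.le]
      nlinarith
  refine ⟨fun j => van_of_normal fun l hl p hp => ?_, fun p hp i => ?_⟩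
  · obtain ⟨hp1, hp2, hp3⟩ := hp
    obtain ⟨h, hc⟩ := pder_iterate_apply N l hu
    have h0 := hbd _ (hcyl p hp1 hp2) (by
      change X.2 N + R * p.2 N = 0
      rw [hX, show p.2 N = 0 from hp3]
      ring) l hl
    rw [← multiD_single, multiD_rescale, multiD_single, ← hc j]
    change _ * ((pder N)^[l] u (X + parDil d m hR p)) j = 0
    rw [h0]
    simp
  · obtain ⟨hp1, hp2, hp3⟩ := hp
    have h0 := heq (X + parDil d m hR p) ⟨hcyl p hp1 hp2, by
      change 0 < X.2 N + R * p.2 N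
      rw [hX, zero_add]
      exact mul_pos hR hp3⟩ i
    simp only [tder_apply_comp hu, Dmul_apply_comp (hu := hu)] at h0
    change (tmD (rescale m hR X (component u hu i))).1 p + (-1) ^ m *
      (coefSum m B (fun α β j => multiD (α + β) (rescale m hR X (component u hu j))) i).1 p = 0
    rw [coefSum_apply, tmD_rescale]
    have e : ∑ α ∈ MIdx d m, ∑ β ∈ MIdx d m, ∑ j,
        B α β i j * (multiD (α + β) (rescale m hR X (component u hu j))).1 p =
        R ^ (2 * m) * ∑ α ∈ MIdx d m, ∑ β ∈ MIdx d m, ∑ j,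
          B α β i j * (multiD (α + β) (component u hu j)).1 (X + parDil d m hR p) := by
      simp only [Finset.mul_sum]
      refine Finset.sum_congr rfl fun α hα => Finset.sum_congr rfl fun β hβ =>
        Finset.sum_congr rfl fun j _ => ?_
      have hs : ∑ k, (α + β) k = 2 * m := by
        simp only [Pi.add_apply, Finset.sum_add_distrib, mem_MIdx.1 hα, mem_MIdx.1 hβ]
        ring
      rw [multiD_rescale, hs]
      change _ * (R ^ (2 * m) * _) = _
      rw [mul_left_comm]
      rfl
    rw [e]
    change R ^ (2 * m) * (tmD (component u hu i)).1 (X + parDil d m hR p) + _ = 0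
    linear_combination R ^ (2 * m) * h0

end Scaling

/-- Boundary decay estimate for `∂_t u` for solutions of the homogeneous
Dirichlet problem with constant coefficients in half cylinders. -/
theorem statement_17 (d n m : ℕ) (hd : 1 ≤ d) (hn : 1 ≤ n) (hm : 1 ≤ m)
    (iN : Fin d) (hiN : (iN : ℕ) = d - 1)
    (K lam : ℝ) (hK : 0 ≤ K) (hlam : 0 < lam) :
    ∃ C : ℝ, 0 < C ∧
      ∀ B : (Fin d → ℕ) → (Fin d → ℕ) → Fin n → Fin n → ℝ,
      (∀ α β i j, |B α β i j| ≤ K) →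
      LegHad d n m lam B →
      ∀ R : ℝ, 0 < R → R ≤ 1 →
      ∀ X₀ : ℝ × EuclideanSpace ℝ (Fin d), X₀.2 iN = 0 →
      ∀ u : ℝ × EuclideanSpace ℝ (Fin d) → EuclideanSpace ℝ (Fin n),
      ContDiff ℝ (⊤ : ℕ∞) u →
      (∀ p ∈ QCylP d m iN (2 * R) X₀, ∀ i,
        tder u p i + (-1 : ℝ) ^ m * ∑ α ∈ MIdx d m, ∑ β ∈ MIdx d m, ∑ j,
          B α β i j * Dmul (α + β) u p j = 0) →
      (∀ q ∈ QCyl d m (2 * R) X₀, q.2 iN = 0 → ∀ k < m, (pder iN)^[k] u q = 0) →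
      ∀ r : ℝ, 0 < r → r < R →
        (∫ p in QCylP d m iN r X₀, ‖tder u p‖ ^ 2) ≤
          C * (r / R) ^ (d + 4 * m) * ∫ p in QCylP d m iN R X₀, ‖tder u p‖ ^ 2 := by
  obtain ⟨C, hC, h⟩ := exists_unit_decay iN n hm hK hlam
  refine ⟨C, hC, fun B hBK hBL R hR _ X hX u hu heq hbd r hr hrR => ?_⟩
  have h1 := h B ⟨hBK, hBL⟩ _ (isSol_rescale hR hX hu heq hbd).tmD (r / R) (div_pos hr hR)
    ((div_lt_one hR).2 hrR)
  obtain ⟨κ, hκ, hint⟩ := exists_integral_rescale (N := iN) m hR X hX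
  have e : ∀ ρ, ∫ p in QCylP d m iN ρ 0,
      ∑ j, (tmD (rescale m hR X (component u hu j))).1 p ^ 2 =
      (R ^ (2 * m)) ^ 2 * κ * ∫ p in QCylP d m iN (R * ρ) X, ‖tder u p‖ ^ 2 := by
    intro ρ
    rw [mul_assoc, ← hint, ← integral_const_mul]
    congr 1
    ext p
    rw [EuclideanSpace.norm_sq_eq, Finset.mul_sum]
    refine Finset.sum_congr rfl fun j _ => ?_
    rw [tmD_rescale, tder_apply_comp hu, Real.norm_eq_abs, sq_abs, ← mul_pow]
    rfl
  rw [e, e, mul_one, mul_div_cancel₀ _ hR.ne', mul_left_comm] at h1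
  exact le_of_mul_le_mul_left h1 (by positivity)
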